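/- Let {Γ_t}, t ∈ [0,T), be a curve shortening flow of simple closed curves on the unit sphere S² ⊂ ℝ³ with geodesic curvature κ. Suppose that at t = 0 there exists a > 0 such that for every pair of points x, y ∈ Γ₀, d(x,y)/L(0) ≥ a⁻¹ arctan((a/π) sin(π ℓ(x,y,0)/L(0))). Then for all t ∈ [0,T) and at every point of Γ_t, κ² + 1 ≤ (2π/L(t))² (1 + (2a²/π²) e^{−8π²τ(t)}), where τ(t) := ∫₀ᵗ L(s)⁻² ds. -/

import Mathlib

open Real MeasureTheory

noncomputable section

/-- Arclength derivative `∂_s f = |∂_u γ|⁻¹ ∂_u f` along the family of curves `u ↦ γ u t`. -/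
def pS (γ f : ℝ → ℝ → EuclideanSpace ℝ (Fin 3)) (u t : ℝ) : EuclideanSpace ℝ (Fin 3) :=
  ‖deriv (fun v => γ v t) u‖⁻¹ • deriv (fun v => f v t) u

/-- The geodesic curvature vector `∂_s²γ + γ` of the spherical curve `u ↦ γ u t`. -/
def curvVec (γ : ℝ → ℝ → EuclideanSpace ℝ (Fin 3)) (u t : ℝ) : EuclideanSpace ℝ (Fin 3) :=
  pS γ (pS γ γ) u t + γ u t

/-- A curve shortening flow `∂_t γ = ∂_s²γ + γ` of simple closed curves on the unit sphere
`S² ⊂ ℝ³`, defined for times `t` in the set `D` (each `γ(·,t)` is a `2π`-periodic regular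
parametrisation, injective on a period, of a simple closed spherical curve `Γ_t`). -/
structure SphereCSF (D : Set ℝ) where
  γ : ℝ → ℝ → EuclideanSpace ℝ (Fin 3)
  smooth : ContDiffOn ℝ (⊤ : ℕ∞) (fun p : ℝ × ℝ => γ p.1 p.2) (Set.univ ×ˢ D)
  spherical : ∀ t ∈ D, ∀ u, ‖γ u t‖ = 1
  periodic : ∀ t ∈ D, Function.Periodic (fun u => γ u t) (2 * π)
  regular : ∀ t ∈ D, ∀ u, deriv (fun v => γ v t) u ≠ 0
  simple : ∀ t ∈ D, Set.InjOn (fun u => γ u t) (Set.Ico 0 (2 * π))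
  flow : ∀ t ∈ D, ∀ u, HasDerivWithinAt (fun s => γ u s) (curvVec γ u t) D t

variable {D : Set ℝ}

/-- The parametrisation speed `|∂_u γ|`. -/
def SphereCSF.speed (F : SphereCSF D) (u t : ℝ) : ℝ := ‖deriv (fun v => F.γ v t) u‖

/-- The total length `L(t)` of the curve `Γ_t`. -/
def SphereCSF.length (F : SphereCSF D) (t : ℝ) : ℝ := ∫ u in (0:ℝ)..(2 * π), F.speed u t

/-- The length `ℓ` of the shorter of the two arcs of `Γ_t` joining `γ(u,t)` to `γ(v,t)`. -/
def SphereCSF.arcLen (F : SphereCSF D) (t u v : ℝ) : ℝ :=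
  min |∫ w in u..v, F.speed w t| (F.length t - |∫ w in u..v, F.speed w t|)

/-- The Euclidean chord length `d` between `γ(u,t)` and `γ(v,t)`. -/
def SphereCSF.chord (F : SphereCSF D) (t u v : ℝ) : ℝ := ‖F.γ u t - F.γ v t‖

/-- The squared geodesic curvature `κ² = |∂_s²γ + γ|²`. -/
def SphereCSF.curvSq (F : SphereCSF D) (u t : ℝ) : ℝ := ‖curvVec F.γ u t‖ ^ 2

/-- The rescaled time `τ(t) = ∫₀ᵗ L(s)⁻² ds`. -/
def SphereCSF.tau (F : SphereCSF D) (t : ℝ) : ℝ := ∫ s in (0:ℝ)..t, ((F.length s) ^ 2)⁻¹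

/-- Two continuous functions on an interval with the same exponential differ by a constant. -/
theorem sub_eq_sub_of_exp_eqOn {f g : ℝ → ℂ} {a b : ℝ} (hab : a ≤ b)
    (hf : ContinuousOn f (Set.Icc a b)) (hg : ContinuousOn g (Set.Icc a b))
    (h : ∀ x ∈ Set.Icc a b, Complex.exp (f x) = Complex.exp (g x)) :
    f b - f a = g b - g a := by
  have h1 : ∀ x ∈ Set.Icc a b, ∃ n : ℤ, f x - g x = n * (2 * π * Complex.I) := by
    intro x hx
    obtain ⟨n, hn⟩ := Complex.exp_eq_exp_iff_exists_int.1 (h x hx)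
    exact ⟨n, by rw [hn]; ring⟩
  have hpi : (2 * (π : ℂ) * Complex.I) ≠ 0 := by simp [Real.pi_ne_zero]
  have h2 : ContinuousOn (fun x => ((f x - g x) / (2 * π * Complex.I)).re) (Set.Icc a b) :=
    Complex.continuous_re.comp_continuousOn ((hf.sub hg).div_const _)
  have h3 : Set.MapsTo (fun x => ((f x - g x) / (2 * π * Complex.I)).re) (Set.Icc a b)
      (Set.range ((↑) : ℤ → ℝ)) := by
    intro x hx
    obtain ⟨n, hn⟩ := h1 x hx
    exact ⟨n, by simp only [hn]; rw [mul_div_assoc, div_self hpi]; simp⟩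
  have h4 := isPreconnected_Icc.constant_of_mapsTo
    Int.isClosedEmbedding_coe_real.isInducing.isDiscrete_range h2 h3
    (Set.right_mem_Icc.2 hab) (Set.left_mem_Icc.2 hab)
  obtain ⟨n, hn⟩ := h1 b (Set.right_mem_Icc.2 hab)
  obtain ⟨m, hm⟩ := h1 a (Set.left_mem_Icc.2 hab)
  simp only [hn, hm] at h4
  rw [mul_div_cancel_right₀ _ hpi, mul_div_cancel_right₀ _ hpi] at h4
  simp at h4
  subst h4
  linear_combination hn - hm

/-- A nonvanishing continuous function on the plane has a continuous logarithm. -/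
theorem exists_continuous_log {g : ℝ × ℝ → ℂ} (hg : Continuous g) (h0 : ∀ x, g x ≠ 0) :
    ∃ φ : ℝ × ℝ → ℂ, Continuous φ ∧ ∀ x, Complex.exp (φ x) = g x := by
  obtain ⟨φ, ⟨-, hφ⟩, -⟩ := Complex.isCoveringMapOn_exp.existsUnique_continuousMap_lifts
    ⟨g, hg⟩ (a₀ := (0, 0)) (e₀ := Complex.log (g (0, 0))) (Complex.exp_log (h0 _))
    (fun x => h0 x)
  exact ⟨φ, φ.continuous, fun x => congrFun hφ x⟩

/-- The divided difference `(Z (p + h) - Z p) / h`, continuous up to `h = 0`. -/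
theorem exists_dividedDifference {Z Z' : ℝ → ℂ} (hZ : ∀ s, HasDerivAt Z (Z' s) s)
    (hc : Continuous Z') :
    ∃ P : ℝ → ℝ → ℂ, Continuous (Function.uncurry P) ∧ (∀ p, P p 0 = Z' p) ∧
      ∀ p h : ℝ, (h : ℂ) * P p h = Z (p + h) - Z p := by
  refine ⟨fun p h => ∫ θ in (0:ℝ)..1, Z' (p + θ * h), ?_, ?_, ?_⟩
  · exact intervalIntegral.continuous_parametric_intervalIntegral_of_continuous'
      (f := fun (x : ℝ × ℝ) θ => Z' (x.1 + θ * x.2)) (by fun_prop) 0 1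
  · intro p; simp
  · intro p h
    have := intervalIntegral.integral_eq_sub_of_hasDerivAt
      (f := fun θ : ℝ => Z (p + θ * h)) (f' := fun θ : ℝ => (h : ℂ) * Z' (p + θ * h))
      (a := 0) (b := 1) (fun θ _ => by
        have h1 : HasDerivAt (fun θ : ℝ => p + θ * h) h θ := by
          simpa using ((hasDerivAt_id θ).mul_const h).const_add p
        have := (hZ (p + θ * h)).scomp θ h1
        simpa [Function.comp_def] using this) (by
        apply Continuous.intervalIntegrable; fun_prop)
    rw [intervalIntegral.integral_const_mul] at this
    rw [this]; simp

/-- A regular simple closed plane curve cannot cross a real segment at two points, with no other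
point of the curve in between, both times from the lower to the upper half plane. -/
theorem not_cross_segment_twice_upward {Z Z' : ℝ → ℂ} {L u v : ℝ}
    (hZ : ∀ s, HasDerivAt Z (Z' s) s) (hc : Continuous Z') (hL : 0 < L)
    (hper : ∀ s, Z (s + L) = Z s) (hper' : ∀ s, Z' (s + L) = Z' s)
    (hinj : ∀ p q, p < q → q < p + L → Z p ≠ Z q) (hreg : ∀ s, Z' s ≠ 0)
    (huv : u < v) (hvu : v < u + L) (hu : (Z u).im = 0) (hv : (Z v).im = 0)
    (hlt : (Z u).re < (Z v).re)
    (hseg : ∀ s, (Z s).im = 0 → (Z u).re < (Z s).re → (Z v).re ≤ (Z s).re)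
    (hu' : 0 < (Z' u).im) (hv' : 0 < (Z' v).im) : False := by
  obtain ⟨P, hPc, hP0, hP⟩ := exists_dividedDifference hZ hc
  have hLc : (L : ℂ) ≠ 0 := by exact_mod_cast hL.ne'
  have hPL : ∀ p, P p L = 0 := by
    intro p
    have := hP p L
    rw [hper, sub_self] at this
    exact (mul_eq_zero.1 this).resolve_left hLc
  set S : ℝ → ℝ → ℂ := fun p h => P p h - P (p + h) (L - h) with hS
  have hSc : Continuous (fun x : ℝ × ℝ => S x.1 x.2) := by
    have h1 : Continuous (fun x : ℝ × ℝ => P x.1 x.2) := hPc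
    have h2 : Continuous (fun x : ℝ × ℝ => P (x.1 + x.2) (L - x.2)) :=
      hPc.comp (f := fun x : ℝ × ℝ => (x.1 + x.2, L - x.2)) (by fun_prop)
    exact h1.sub h2
  have hSD : ∀ p h : ℝ, (h : ℂ) * (L - h) * S p h = L * (Z (p + h) - Z p) := by
    intro p h
    have h1 := hP p h
    have h2 := hP (p + h) (L - h)
    rw [show p + h + (L - h) = p + L by ring, hper] at h2
    push_cast at h2
    simp only [hS]
    linear_combination (L - h : ℂ) * h1 - (h : ℂ) * h2
  have hS0 : ∀ p, S p 0 = Z' p := by intro p; simp [hS, hPL, hP0]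
  have hPper : ∀ p h, 0 < h → P (p + L) h = P p h := by
    intro p h hh
    have h1 := hP (p + L) h
    rw [show p + L + h = p + h + L by ring, hper, hper, ← hP p h] at h1
    exact mul_left_cancel₀ (by exact_mod_cast hh.ne') h1
  have hSshift : ∀ p h, 0 ≤ h → S (p + h) (L - h) = - S p h := by
    intro p h hh
    rcases hh.eq_or_lt with rfl | hh
    · simp [hS, hPL, hP0, hper']
    · simp only [hS]
      rw [show p + h + (L - h) = p + L by ring, show L - (L - h) = h by ring, hPper p h hh]
      ring
  have hSne : ∀ p h, 0 ≤ h → h ≤ L → S p h ≠ 0 := by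
    intro p h h0 h1 hz
    rcases h0.eq_or_lt with rfl | h0
    · exact hreg p (by rw [← hS0, hz])
    rcases h1.eq_or_lt with rfl | h1
    · have := hSshift p 0 le_rfl
      rw [hS0] at this
      simp at this
      rw [this] at hz
      exact hreg p (neg_eq_zero.1 hz)
    · have := hSD p h
      rw [hz, mul_zero] at this
      have h2 := (mul_eq_zero.1 this.symm).resolve_left hLc
      exact hinj p (p + h) (by linarith) (by linarith) (sub_eq_zero.1 h2).symm
  obtain ⟨φ, hφc, hφ⟩ := exists_continuous_log (g := fun x : ℝ × ℝ => S x.1 (max 0 (min x.2 L)))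
    (hSc.comp (f := fun x : ℝ × ℝ => (x.1, max 0 (min x.2 L))) (by fun_prop))
    (fun x => hSne _ _ (le_max_left _ _) (max_le hL.le (min_le_right _ _)))
  have hφS : ∀ p h, 0 ≤ h → h ≤ L → Complex.exp (φ (p, h)) = S p h := by
    intro p h h0 h1
    rw [hφ]; simp [h0, h1]
  have hexpI : Complex.exp (π * Complex.I) = -1 := Complex.exp_pi_mul_I
  have hshift := sub_eq_sub_of_exp_eqOn (f := fun h => φ (u + h, L - h))
    (g := fun h => φ (u, h) + π * Complex.I) (a := 0) (b := v - u) (by linarith)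
    (by fun_prop) (by fun_prop) (by
      rintro h ⟨h0, h1⟩
      rw [Complex.exp_add, hexpI, hφS _ _ (by linarith) (by linarith),
        hφS _ _ (by linarith) (by linarith), hSshift _ _ h0]; ring)
  -- the two slit-plane valued quotients
  have hW : ((Z v - Z u).re : ℂ) = Z v - Z u := by
    apply Complex.ext <;> simp [hu, hv]
  have hWpos : 0 < (Z v - Z u).re := by simp; linarith
  have hSuv : S u (v - u) = ((L * (Z v - Z u).re / ((v - u) * (L - (v - u))) : ℝ) : ℂ) := by
    have := hSD u (v - u)
    rw [show u + (v - u) = v by ring, ← hW] at this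
    have hne : ((v - u : ℝ) : ℂ) * (L - (v - u : ℝ)) ≠ 0 := by
      norm_cast
      exact mul_ne_zero (by linarith) (by linarith)
    push_cast at this hne ⊢
    rw [eq_div_iff hne]
    linear_combination this
  set r := L * (Z v - Z u).re / ((v - u) * (L - (v - u))) with hr
  have hrpos : 0 < r := by
    apply div_pos (mul_pos hL hWpos) (mul_pos (by linarith) (by linarith))
  have hslit : ∀ q, u < q → q < u + L → q ≠ v → ∀ t : ℝ, 0 ≤ t →
      Z q - Z v ≠ -(t : ℂ) * (Z q - Z u) := by
    intro q h1 h2 h3 t ht h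
    have hre := congrArg Complex.re h
    have him := congrArg Complex.im h
    simp [hu, hv] at hre him
    have him0 : (Z q).im = 0 := by nlinarith
    have hZqv : Z q ≠ Z v := by
      rcases lt_or_gt_of_ne h3 with h | h
      · exact hinj q v h (by linarith)
      · exact (hinj v q h (by linarith)).symm
    have h4 : (Z u).re < (Z q).re := by nlinarith
    have h5 := hseg q him0 h4
    have h6 : (Z q).re = (Z v).re := by nlinarith
    exact hZqv (Complex.ext h6 (by rw [him0, hv]))
  have mem_slit : ∀ A B : ℂ, ∀ k : ℝ, 0 < k → B ≠ 0 →
      (∀ t : ℝ, 0 ≤ t → A ≠ -(t : ℂ) * B) → (k : ℂ) * (A / B) ∈ Complex.slitPlane := by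
    intro A B k hk hB h
    rw [Complex.mem_slitPlane_iff_not_le_zero]
    intro hle
    have h1 : A = -((-(k * (A / B)).re / k : ℝ) : ℂ) * B := by
      rw [Complex.le_def] at hle
      have h2 : ((((k : ℂ) * (A / B)).re : ℝ) : ℂ) = k * (A / B) := by
        apply Complex.ext
        · simp
        · simp only [Complex.ofReal_im]; simpa using hle.2.symm
      have hk' : (k : ℂ) ≠ 0 := by exact_mod_cast hk.ne'
      push_cast
      rw [h2]
      field_simp
    refine h _ ?_ h1
    have : ((k : ℂ) * (A / B)).re ≤ 0 := (Complex.le_def.1 hle).1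
    exact div_nonneg (by simpa using this) hk.le
  have hinv : (Z' u)⁻¹.im < 0 := by
    rw [Complex.inv_im]
    exact div_neg_of_neg_of_pos (by linarith) (Complex.normSq_pos.2 (hreg u))
  -- first quotient, on `[u, v]`
  have E1 := sub_eq_sub_of_exp_eqOn
    (f := fun q => φ (q, v - q) - φ (u, q - u) + π * Complex.I)
    (g := fun q => Complex.log (-S q (v - q) / S u (q - u))) (a := u) (b := v) huv.le
    (by fun_prop) (by
      apply ContinuousOn.clog
      · apply ContinuousOn.div
        · exact ((hSc.comp (f := fun q : ℝ => (q, v - q)) (by fun_prop)).neg).continuousOn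
        · exact (hSc.comp (f := fun q : ℝ => (u, q - u)) (by fun_prop)).continuousOn
        · intro q hq
          exact hSne _ _ (by linarith [hq.1]) (by linarith [hq.2])
      · rintro q ⟨h1, h2⟩
        rcases h1.eq_or_lt with rfl | h1
        · refine Or.inr ?_
          rw [sub_self, hS0, hSuv, div_eq_mul_inv, ← Complex.ofReal_neg, Complex.im_ofReal_mul]
          nlinarith
        rcases h2.eq_or_lt with rfl | h2
        · refine Or.inr ?_
          rw [sub_self, hS0, hSuv, Complex.div_ofReal_im]
          simp only [Complex.neg_im]
          exact (div_neg_of_neg_of_pos (by linarith) hrpos).ne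
        · have h3 := hSD q (v - q)
          have h4 := hSD u (q - u)
          rw [show q + (v - q) = v by ring] at h3
          rw [show u + (q - u) = q by ring] at h4
          have hne : Z q - Z u ≠ 0 := sub_ne_zero.2 (hinj u q h1 (by linarith)).symm
          have key := mem_slit (Z q - Z v) (Z q - Z u)
            (((q - u) * (L - (q - u))) / ((v - q) * (L - (v - q))))
            (div_pos (mul_pos (by linarith) (by linarith)) (mul_pos (by linarith) (by linarith)))
            hne (hslit q h1 (by linarith) h2.ne)
          convert key using 1
          have n1 : ((v - q : ℝ) : ℂ) ≠ 0 := by norm_cast; linarith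
          have n2 : ((L - (v - q) : ℝ) : ℂ) ≠ 0 := by norm_cast; linarith
          have n3 : ((q - u : ℝ) : ℂ) ≠ 0 := by norm_cast; linarith
          have n4 : ((L - (q - u) : ℝ) : ℂ) ≠ 0 := by norm_cast; linarith
          have n5 := hSne u (q - u) (by linarith) (by linarith)
          push_cast at *
          have e3 : S q (v - q) = L * (Z v - Z q) / ((v - q) * (L - (v - q))) := by
            rw [eq_div_iff (mul_ne_zero n1 n2)]; linear_combination h3
          have e4 : S u (q - u) = L * (Z q - Z u) / ((q - u) * (L - (q - u))) := by
            rw [eq_div_iff (mul_ne_zero n3 n4)]; linear_combination h4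
          rw [e3, e4]
          field_simp
          ring) (by
      rintro q ⟨h1, h2⟩
      have n5 := hSne u (q - u) (by linarith) (by linarith)
      have n6 := hSne q (v - q) (by linarith) (by linarith)
      rw [Complex.exp_add, Complex.exp_sub, hexpI, hφS _ _ (by linarith) (by linarith),
        hφS _ _ (by linarith) (by linarith), Complex.exp_log (div_ne_zero (neg_ne_zero.2 n6) n5)]
      ring)
  -- second quotient, on `[v, u + L]`
  have E2 := sub_eq_sub_of_exp_eqOn
    (f := fun q => φ (v, q - v) - φ (u, q - u))
    (g := fun q => Complex.log (S v (q - v) / S u (q - u))) (a := v) (b := u + L) hvu.le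
    (by fun_prop) (by
      apply ContinuousOn.clog
      · apply ContinuousOn.div
        · exact (hSc.comp (f := fun q : ℝ => (v, q - v)) (by fun_prop)).continuousOn
        · exact (hSc.comp (f := fun q : ℝ => (u, q - u)) (by fun_prop)).continuousOn
        · intro q hq
          exact hSne _ _ (by linarith [hq.1]) (by linarith [hq.2])
      · rintro q ⟨h1, h2⟩
        rcases h1.eq_or_lt with rfl | h1
        · refine Or.inr ?_
          rw [sub_self, hS0, hSuv, Complex.div_ofReal_im]
          exact (div_pos hv' hrpos).ne'
        rcases h2.eq_or_lt with rfl | h2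
        · refine Or.inr ?_
          have e1 := hSshift u (v - u) (by linarith)
          rw [show u + (v - u) = v by ring, show L - (v - u) = u + L - v by ring, hSuv] at e1
          have e2 := hSshift u 0 le_rfl
          rw [hS0] at e2
          simp only [add_zero, sub_zero] at e2
          rw [e1, show u + L - u = L by ring, e2, neg_div_neg_eq, div_eq_mul_inv,
            Complex.im_ofReal_mul]
          nlinarith
        · have h3 := hSD v (q - v)
          have h4 := hSD u (q - u)
          rw [show v + (q - v) = q by ring] at h3
          rw [show u + (q - u) = q by ring] at h4
          have hne : Z q - Z u ≠ 0 := sub_ne_zero.2 (hinj u q (by linarith) (by linarith)).symm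
          have key := mem_slit (Z q - Z v) (Z q - Z u)
            (((q - u) * (L - (q - u))) / ((q - v) * (L - (q - v))))
            (div_pos (mul_pos (by linarith) (by linarith)) (mul_pos (by linarith) (by linarith)))
            hne (hslit q (by linarith) (by linarith) h1.ne')
          convert key using 1
          have n1 : ((q - v : ℝ) : ℂ) ≠ 0 := by norm_cast; linarith
          have n2 : ((L - (q - v) : ℝ) : ℂ) ≠ 0 := by norm_cast; linarith
          have n3 : ((q - u : ℝ) : ℂ) ≠ 0 := by norm_cast; linarith
          have n4 : ((L - (q - u) : ℝ) : ℂ) ≠ 0 := by norm_cast; linarith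
          push_cast at *
          have e3 : S v (q - v) = L * (Z q - Z v) / ((q - v) * (L - (q - v))) := by
            rw [eq_div_iff (mul_ne_zero n1 n2)]; linear_combination h3
          have e4 : S u (q - u) = L * (Z q - Z u) / ((q - u) * (L - (q - u))) := by
            rw [eq_div_iff (mul_ne_zero n3 n4)]; linear_combination h4
          rw [e3, e4]
          field_simp) (by
      rintro q ⟨h1, h2⟩
      have n5 := hSne u (q - u) (by linarith) (by linarith)
      have n6 := hSne v (q - v) (by linarith) (by linarith)
      rw [Complex.exp_sub, hφS _ _ (by linarith) (by linarith),
        hφS _ _ (by linarith) (by linarith), Complex.exp_log (div_ne_zero n6 n5)])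
  have hL1 := hSshift u (v - u) (by linarith)
  have hL2 := hSshift u 0 le_rfl
  rw [show u + (v - u) = v by ring, show L - (v - u) = u + L - v by ring, hSuv] at hL1
  rw [hS0] at hL2
  simp only [add_zero, sub_zero] at hL2
  simp only [sub_self, hS0, hSuv, hL1, show u + L - u = L by ring, hL2] at E1 E2
  simp only [show u + (v - u) = v by ring, show L - (v - u) = u + L - v by ring, add_zero,
    sub_zero] at hshift
  have i1 := congrArg Complex.im E1
  have i2 := congrArg Complex.im E2
  have i3 := congrArg Complex.im hshift
  have a1 : (Complex.log (-Z' v / r)).im < 0 := by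
    rw [Complex.log_im, Complex.arg_neg_iff, Complex.div_ofReal_im]
    exact div_neg_of_neg_of_pos (by simpa using hv') hrpos
  have a2 : 0 ≤ (Complex.log (-(r : ℂ) / Z' u)).im := by
    rw [Complex.log_im, Complex.arg_nonneg_iff, div_eq_mul_inv, ← Complex.ofReal_neg,
      Complex.im_ofReal_mul]
    nlinarith
  have a3 : (Complex.log (-(r : ℂ) / -Z' u)).im < 0 := by
    rw [Complex.log_im, Complex.arg_neg_iff, neg_div_neg_eq, div_eq_mul_inv,
      Complex.im_ofReal_mul]
    nlinarith
  have a4 : 0 ≤ (Complex.log (Z' v / r)).im := by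
    rw [Complex.log_im, Complex.arg_nonneg_iff, Complex.div_ofReal_im]
    exact (div_pos hv' hrpos).le
  simp only [Complex.sub_im, Complex.add_im] at i1 i2 i3
  linarith

/-- A simple closed curve crossing a great circle transversally at a point misses some point of
the great circle slightly before that crossing point. -/
theorem exists_notMem_greatCircle {c₁ c₂ c₃ : ℝ → ℝ} {L p g s A : ℝ}
    (h₁ : Continuous c₁) (h₂ : Continuous c₂) (h₃ : Continuous c₃)
    (hL : 0 < L) (hp₁ : ∀ r, c₁ (r + L) = c₁ r) (hp₂ : ∀ r, c₂ (r + L) = c₂ r)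
    (hp₃ : ∀ r, c₃ (r + L) = c₃ r)
    (hinj : ∀ a b, a < b → b < a + L → c₁ a = c₁ b → c₂ a = c₂ b → c₃ a = c₃ b → False)
    (hp : c₃ p = 0) (hg : c₁ p = g) (hs : c₂ p = -s) (hg0 : 0 < g) (hs0 : 0 < s)
    (hgs : g ^ 2 + s ^ 2 = 1) (hA : HasDerivAt c₃ A p) (hA0 : A ≠ 0) :
    ∃ N₁ N₂ : ℝ, N₁ ^ 2 + N₂ ^ 2 = 1 ∧ N₁ < g ∧
      ∀ r, ¬ (c₁ r = N₁ ∧ c₂ r = N₂ ∧ c₃ r = 0) := by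
  have hev : ∀ᶠ r in nhdsWithin p {p}ᶜ, c₃ r ≠ 0 := hA.eventually_ne hA0
  rw [eventually_nhdsWithin_iff, Metric.eventually_nhds_iff] at hev
  obtain ⟨δ', hδ', hev⟩ := hev
  set δ := min (δ' / 2) (L / 4) with hδ
  have hδ0 : 0 < δ := by positivity
  have hδ1 : δ < δ' := (min_le_left _ _).trans_lt (by linarith)
  have hδ2 : δ ≤ L / 4 := min_le_right _ _
  set C : ℝ → ℝ × ℝ × ℝ := fun r => (c₁ r, c₂ r, c₃ r) with hC
  have hCc : Continuous C := by fun_prop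
  have hK : IsClosed (C '' Set.Icc (p + δ) (p + L - δ)) := (isCompact_Icc.image hCc).isClosed
  set N : ℝ → ℝ × ℝ × ℝ := fun η => (g * cos η - s * sin η, -s * cos η - g * sin η, 0) with hN
  have hNc : Continuous N := by fun_prop
  have hN0 : N 0 ∈ (C '' Set.Icc (p + δ) (p + L - δ))ᶜ := by
    rintro ⟨r, ⟨hr1, hr2⟩, hr⟩
    simp [hN, hC] at hr
    exact hinj p r (by linarith) (by linarith) (by rw [hg, hr.1]) (by rw [hs, hr.2.1])
      (by rw [hp, hr.2.2])
  have hmem : ∀ᶠ η in nhds (0 : ℝ), N η ∈ (C '' Set.Icc (p + δ) (p + L - δ))ᶜ :=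
    hNc.continuousAt.eventually (hK.isOpen_compl.mem_nhds hN0)
  rw [Metric.eventually_nhds_iff] at hmem
  obtain ⟨ε, hε, hmem⟩ := hmem
  set η := min (ε / 2) 1 with hη
  have hη0 : 0 < η := by positivity
  have hη1 : η ≤ 1 := min_le_right _ _
  have hη2 : η < ε := (min_le_left _ _).trans_lt (by linarith)
  have hsin : 0 < sin η := sin_pos_of_pos_of_lt_pi hη0 (by linarith [pi_gt_three])
  have hcs := sin_sq_add_cos_sq η
  have hcos : cos η ≤ 1 := cos_le_one η
  have hlt : g * cos η - s * sin η < g := by nlinarith [mul_pos hs0 hsin]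
  refine ⟨g * cos η - s * sin η, -s * cos η - g * sin η, ?_, hlt, ?_⟩
  · nlinarith
  rintro r ⟨e1, e2, e3⟩
  have hCper : Function.Periodic C L := by intro r; simp [hC, hp₁, hp₂, hp₃]
  obtain ⟨r', hr', hrr⟩ := hCper.exists_mem_Ico hL r (p - δ)
  simp only [hC, Prod.mk.injEq] at hrr
  by_cases hr2 : r' < p + δ
  · have hd : dist r' p < δ' := by
      rw [Real.dist_eq, abs_lt]; constructor <;> linarith [hr'.1]
    have : r' = p := by
      by_contra hne
      exact hev hd hne (by rw [← hrr.2.2, e3])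
    rw [this] at hrr
    linarith [hrr.1]
  · refine hmem (y := η) (by rw [Real.dist_eq]; simpa [abs_of_pos hη0] using hη2) ?_
    refine ⟨r', ⟨not_lt.1 hr2, by linarith [hr'.2]⟩, ?_⟩
    simp only [hC, hN, ← hrr.1, ← hrr.2.1, ← hrr.2.2, e1, e2, e3]

set_option maxHeartbeats 1000000 in
/-- If a simple closed spherical curve crosses a minor great circle arc at both end points in the
same direction, then it meets the arc at some third point. Here the great circle is
`{x₃ = 0}`, and the end points are `(g, -s, 0)` and `(g, s, 0)`. -/
theorem exists_mem_minorArc {c₁ c₂ c₃ c₁' c₂' c₃' : ℝ → ℝ} {L p q g s : ℝ}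
    (h₁ : ∀ r, HasDerivAt c₁ (c₁' r) r) (h₂ : ∀ r, HasDerivAt c₂ (c₂' r) r)
    (h₃ : ∀ r, HasDerivAt c₃ (c₃' r) r)
    (h₁' : Continuous c₁') (h₂' : Continuous c₂') (h₃' : Continuous c₃')
    (hL : 0 < L) (hp₁ : ∀ r, c₁ (r + L) = c₁ r) (hp₂ : ∀ r, c₂ (r + L) = c₂ r)
    (hp₃ : ∀ r, c₃ (r + L) = c₃ r)
    (hsph : ∀ r, c₁ r ^ 2 + c₂ r ^ 2 + c₃ r ^ 2 = 1)
    (hreg : ∀ r, ¬ (c₁' r = 0 ∧ c₂' r = 0 ∧ c₃' r = 0))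
    (hinj : ∀ a b, a < b → b < a + L → c₁ a = c₁ b → c₂ a = c₂ b → c₃ a = c₃ b → False)
    (hpq : p < q) (hqp : q < p + L)
    (hp : c₃ p = 0) (hpg : c₁ p = g) (hps : c₂ p = -s)
    (hq : c₃ q = 0) (hqg : c₁ q = g) (hqs : c₂ q = s) (hg0 : 0 < g) (hs0 : 0 < s)
    (hA : 0 < c₃' p * c₃' q) :
    ∃ r, p < r ∧ r < p + L ∧ r ≠ q ∧ c₃ r = 0 ∧ g < c₁ r := by
  have hgs : g ^ 2 + s ^ 2 = 1 := by have := hsph p; rw [hp, hpg, hps] at this; linarith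
  obtain ⟨N₁, N₂, hN, hNg, hmiss⟩ := exists_notMem_greatCircle
    (continuous_iff_continuousAt.2 fun r => (h₁ r).continuousAt)
    (continuous_iff_continuousAt.2 fun r => (h₂ r).continuousAt)
    (continuous_iff_continuousAt.2 fun r => (h₃ r).continuousAt) hL hp₁ hp₂ hp₃ hinj hp hpg hps
    hg0 hs0 hgs (h₃ p) (left_ne_zero_of_mul hA.ne')
  by_contra hno
  push Not at hno
  have hper' : ∀ (f f' : ℝ → ℝ), (∀ r, HasDerivAt f (f' r) r) → (∀ r, f (r + L) = f r) →
      ∀ r, f' (r + L) = f' r := by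
    intro f f' hf hp r
    have := (hf (r + L)).comp_add_const r L
    rw [show (fun x => f (x + L)) = f from funext hp] at this
    exact this.unique (hf r)
  set D : ℝ → ℝ := fun r => 1 - (N₁ * c₁ r + N₂ * c₂ r) with hD
  have hDpos : ∀ r, 0 < D r := by
    intro r
    simp only [hD]
    by_contra hle
    refine hmiss r ?_
    have h1 := hsph r
    have h2 : (c₁ r - N₁) ^ 2 + (c₂ r - N₂) ^ 2 + c₃ r ^ 2 ≤ 0 := by nlinarith
    have a1 : (c₁ r - N₁) ^ 2 = 0 := by nlinarith [sq_nonneg (c₁ r - N₁), sq_nonneg (c₂ r - N₂), sq_nonneg (c₃ r)]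
    have a2 : (c₂ r - N₂) ^ 2 = 0 := by nlinarith [sq_nonneg (c₁ r - N₁), sq_nonneg (c₂ r - N₂), sq_nonneg (c₃ r)]
    have a3 : (c₃ r) ^ 2 = 0 := by nlinarith [sq_nonneg (c₁ r - N₁), sq_nonneg (c₂ r - N₂), sq_nonneg (c₃ r)]
    exact ⟨by linarith [pow_eq_zero_iff (two_ne_zero) |>.1 a1],
      by linarith [pow_eq_zero_iff (two_ne_zero) |>.1 a2], pow_eq_zero_iff (two_ne_zero) |>.1 a3⟩
  -- signs normalising the orientation
  obtain ⟨τ, hτ, hτA, hτB⟩ : ∃ τ : ℝ, τ ^ 2 = 1 ∧ 0 < τ * c₃' p ∧ 0 < τ * c₃' q := by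
    rcases pos_and_pos_or_neg_and_neg_of_mul_pos hA with ⟨h1, h2⟩ | ⟨h1, h2⟩
    · exact ⟨1, by norm_num, by linarith, by linarith⟩
    · exact ⟨-1, by norm_num, by linarith, by linarith⟩
  set X : ℝ → ℝ := fun r => (N₁ * c₂ r - N₂ * c₁ r) / D r with hX
  set Y : ℝ → ℝ := fun r => c₃ r / D r with hY
  have hXY : ∀ r, X r ^ 2 + Y r ^ 2 + 1 = 2 / D r := by
    intro r
    have := (hDpos r).ne'
    simp only [hX, hY]
    field_simp
    have h1 := hsph r
    simp only [hD]
    linear_combination h1 + (c₁ r ^ 2 + c₂ r ^ 2) * hN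
  have rec1 : ∀ r, c₁ r = N₁ * (1 - D r) - N₂ * (X r * D r) := by
    intro r
    have := (hDpos r).ne'
    simp only [hX]; rw [div_mul_cancel₀ _ this]; simp only [hD]
    linear_combination -c₁ r * hN
  have rec2 : ∀ r, c₂ r = N₂ * (1 - D r) + N₁ * (X r * D r) := by
    intro r
    have := (hDpos r).ne'
    simp only [hX]; rw [div_mul_cancel₀ _ this]; simp only [hD]
    linear_combination -c₂ r * hN
  have rec3 : ∀ r, c₃ r = Y r * D r := by
    intro r
    have := (hDpos r).ne'
    simp only [hY]; rw [div_mul_cancel₀ _ this]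
  have hXYinj : ∀ a b, a < b → b < a + L → X a = X b → Y a = Y b → False := by
    intro a b hab hba hx hy
    have h1 := hXY a
    rw [hx, hy, hXY b] at h1
    have hd : D a = D b := by
      have := (hDpos a).ne'
      have := (hDpos b).ne'
      field_simp at h1
      linarith
    exact hinj a b hab hba (by rw [rec1 a, rec1 b, hx, hd]) (by rw [rec2 a, rec2 b, hx, hd])
      (by rw [rec3 a, rec3 b, hy, hd])
  -- the quadratic cutting out the minor arc
  have hquad : ∀ r, c₃ r = 0 →
      (c₁ r - g) * 2 / D r = (N₁ - g) * X r ^ 2 - 2 * N₂ * X r - (N₁ + g) := by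
    intro r hr
    have h1 := hXY r
    have hY0 : Y r = 0 := by simp [hY, hr]
    have hd := (hDpos r).ne'
    have h2 : (c₁ r - g) * 2 / D r = (c₁ r - g) * (2 / D r) := by ring
    rw [h2, ← h1, hY0]
    have h3 : D r * (X r ^ 2 + 1) = 2 := by
      rw [hY0] at h1; field_simp at h1; linarith
    have h4 := rec1 r
    linear_combination (X r ^ 2 + 1) * h4 + (-N₁ - N₂ * X r) * h3
  have hXne : X p ≠ X q := fun h => hXYinj p q hpq hqp h (by simp [hY, hp, hq])
  obtain ⟨ε, hε, hεlt⟩ : ∃ ε : ℝ, ε ^ 2 = 1 ∧ ε * X p < ε * X q := by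
    rcases lt_or_gt_of_ne hXne with h | h
    · exact ⟨1, by norm_num, by linarith⟩
    · exact ⟨-1, by norm_num, by linarith⟩
  have hε0 : ε ≠ 0 := by rintro rfl; norm_num at hε
  have hτ0 : τ ≠ 0 := by rintro rfl; norm_num at hτ
  set D' : ℝ → ℝ := fun r => -(N₁ * c₁' r + N₂ * c₂' r) with hD'
  have hDd : ∀ r, HasDerivAt D (D' r) r := fun r =>
    (((h₁ r).const_mul N₁).add ((h₂ r).const_mul N₂)).const_sub 1
  set X' : ℝ → ℝ := fun r => ((N₁ * c₂' r - N₂ * c₁' r) * D r - (N₁ * c₂ r - N₂ * c₁ r) * D' r) / D r ^ 2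
    with hX'
  set Y' : ℝ → ℝ := fun r => (c₃' r * D r - c₃ r * D' r) / D r ^ 2 with hY'
  have hXd : ∀ r, HasDerivAt X (X' r) r := fun r =>
    (((h₂ r).const_mul N₁).sub ((h₁ r).const_mul N₂)).div (hDd r) (hDpos r).ne'
  have hYd : ∀ r, HasDerivAt Y (Y' r) r := fun r => (h₃ r).div (hDd r) (hDpos r).ne'
  have hXp : ∀ r, X (r + L) = X r := by intro r; simp [hX, hD, hp₁, hp₂]
  have hYp : ∀ r, Y (r + L) = Y r := by intro r; simp [hY, hD, hp₁, hp₂, hp₃]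
  have c1 : Continuous c₁ := continuous_iff_continuousAt.2 fun r => (h₁ r).continuousAt
  have c2 : Continuous c₂ := continuous_iff_continuousAt.2 fun r => (h₂ r).continuousAt
  have c3 : Continuous c₃ := continuous_iff_continuousAt.2 fun r => (h₃ r).continuousAt
  have hDne : ∀ r, D r ^ 2 ≠ 0 := fun r => pow_ne_zero _ (hDpos r).ne'
  have hXc : Continuous X' := by
    apply Continuous.div _ _ hDne <;> fun_prop
  have hYc : Continuous Y' := by
    apply Continuous.div _ _ hDne <;> fun_prop
  refine not_cross_segment_twice_upward (Z := fun r => ((ε * X r : ℝ) : ℂ) + ((τ * Y r : ℝ) : ℂ) * Complex.I)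
    (Z' := fun r => ((ε * X' r : ℝ) : ℂ) + ((τ * Y' r : ℝ) : ℂ) * Complex.I) (L := L) (u := p) (v := q)
    ?_ (by fun_prop) hL ?_ ?_ ?_ ?_ hpq hqp ?_ ?_ ?_ ?_ ?_ ?_
  · intro r
    exact ((hXd r).const_mul ε).ofReal_comp.add
      (((hYd r).const_mul τ).ofReal_comp.mul_const Complex.I)
  · intro r; simp only [hXp, hYp]
  · intro r; simp only [hper' X X' hXd hXp, hper' Y Y' hYd hYp]
  · intro a b hab hba h
    have hr := congrArg Complex.re h
    have hi := congrArg Complex.im h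
    simp [hε0, hτ0] at hr hi
    exact hXYinj a b hab hba hr hi
  · intro r h
    have hr := congrArg Complex.re h
    have hi := congrArg Complex.im h
    simp [hε0, hτ0] at hr hi
    have hd := (hDpos r).ne'
    simp only [hX', hY', div_eq_zero_iff, hDne, or_false] at hr hi
    have hsph' : c₁ r * c₁' r + c₂ r * c₂' r + c₃ r * c₃' r = 0 := by
      have h1 := (((h₁ r).pow 2).add ((h₂ r).pow 2)).add ((h₃ r).pow 2)
      have h2 : HasDerivAt (c₁ ^ 2 + c₂ ^ 2 + c₃ ^ 2) 0 r := by
        rw [show c₁ ^ 2 + c₂ ^ 2 + c₃ ^ 2 = fun _ => 1 from funext hsph]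
        exact hasDerivAt_const _ _
      have h3 := h1.unique h2
      norm_num at h3
      linarith
    have hD'0 : D' r = 0 := by
      have : D' r * D r = 0 := by
        have e1 := hsph r
        simp only [hD, hD'] at hr hi ⊢
        linear_combination (-(N₁ * c₂ r - N₂ * c₁ r)) * hr - c₃ r * hi + (1 - (N₁ * c₁ r + N₂ * c₂ r)) * hsph' + (N₁ * c₁' r + N₂ * c₂' r) * e1 + ((1 - (N₁ * c₁ r + N₂ * c₂ r)) * (c₁ r * c₁' r + c₂ r * c₂' r) + (N₁ * c₁' r + N₂ * c₂' r) * (c₁ r ^ 2 + c₂ r ^ 2)) * hN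
      exact (mul_eq_zero.1 this).resolve_right hd
    rw [hD'0, mul_zero, sub_zero, mul_eq_zero] at hr hi
    have r1 := hr.resolve_right hd
    have r2 := hi.resolve_right hd
    have r3 : N₁ * c₁' r + N₂ * c₂' r = 0 := by simp only [hD'] at hD'0; linarith
    exact hreg r ⟨by linear_combination -c₁' r * hN + N₁ * r3 - N₂ * r1,
      by linear_combination -c₂' r * hN + N₂ * r3 + N₁ * r1, r2⟩
  · simp [hY, hp]
  · simp [hY, hq]
  · simpa using hεlt
  · intro r hr hlt
    simp [hτ0] at hr hlt ⊢
    have hr3 : c₃ r = 0 := by rw [rec3, hr, zero_mul]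
    by_contra hlt2
    push Not at hlt2
    obtain ⟨r', hr', hrr⟩ := (show Function.Periodic (fun r => (c₁ r, X r, c₃ r)) L by
      intro r; simp [hp₁, hp₃, hXp]).exists_mem_Ico hL r p
    simp only [Prod.mk.injEq] at hrr
    rw [hrr.2.1] at hlt hlt2
    rw [hrr.2.2] at hr3
    have hne : r' ≠ q := by rintro rfl; exact lt_irrefl _ hlt2
    have hnp : p < r' := lt_of_le_of_ne hr'.1 (by rintro rfl; exact lt_irrefl _ hlt)
    have h1 := hno r' hnp hr'.2 hne hr3
    have q1 := hquad p hp
    have q2 := hquad q hq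
    have q3 := hquad r' hr3
    rw [hpg, sub_self, zero_mul, zero_div] at q1
    rw [hqg, sub_self, zero_mul, zero_div] at q2
    have hle : (c₁ r' - g) * 2 / D r' ≤ 0 :=
      div_nonpos_of_nonpos_of_nonneg (by linarith) (hDpos r').le
    rw [q3] at hle
    have hlin : (N₁ - g) * (X p + X q) = 2 * N₂ := by
      have : (X p - X q) * ((N₁ - g) * (X p + X q) - 2 * N₂) = 0 := by linear_combination q2 - q1
      have := (mul_eq_zero.1 this).resolve_left (sub_ne_zero.2 hXne)
      linarith
    have hfac : (N₁ - g) * X r' ^ 2 - 2 * N₂ * X r' - (N₁ + g) =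
        (N₁ - g) * ((X r' - X p) * (X r' - X q)) := by
      linear_combination (X r' - X p) * hlin - q1
    rw [hfac] at hle
    have h5 : 0 < (X r' - X p) * (X q - X r') := by
      have : 0 < (ε * (X r' - X p)) * (ε * (X q - X r')) := mul_pos (by linarith) (by linarith)
      nlinarith
    nlinarith
  · suffices h : 0 < τ * Y' p by simpa using h
    have := hDpos p
    simp only [hY', hp, zero_mul, sub_zero]
    have e : τ * (c₃' p * D p / D p ^ 2) = τ * c₃' p / D p := by field_simp
    rw [e]; positivity
  · suffices h : 0 < τ * Y' q by simpa using h
    have := hDpos q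
    simp only [hY', hq, zero_mul, sub_zero]
    have e : τ * (c₃' q * D q / D q ^ 2) = τ * c₃' q / D q := by field_simp
    rw [e]; positivity

theorem convexOn_cos_sqrt : ConvexOn ℝ (Set.Icc 0 (π ^ 2)) fun y => cos √y := by
  have hd : ∀ y ∈ Set.Ioo 0 (π ^ 2), HasDerivAt (fun y => cos √y) (-sin √y * (1 / (2 * √y))) y :=
    fun y hy => (Real.hasDerivAt_sqrt hy.1.ne').cos
  refine MonotoneOn.convexOn_of_deriv (convex_Icc _ _) (by fun_prop) ?_ ?_
  · rw [interior_Icc]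
    exact fun y hy => (hd y hy).differentiableAt.differentiableWithinAt
  rw [interior_Icc]
  intro y hy z hz hyz
  rw [(hd y hy).deriv, (hd z hz).deriv]
  have h0 : 0 < √y := sqrt_pos.2 hy.1
  have h1 : √y ≤ √z := sqrt_le_sqrt hyz
  have h2 : √z ≤ π := (sqrt_le_left pi_pos.le).2 hz.2.le
  have hz0 := h0.trans_le h1
  have hs := strictConcaveOn_sin_Icc.concaveOn.neg.secant_mono (a := 0) (x := √y) (y := √z)
    ⟨le_rfl, pi_pos.le⟩ ⟨h0.le, h1.trans h2⟩ ⟨hz0.le, h2⟩ h0.ne' hz0.ne' h1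
  simp at hs
  calc -sin √y * (1 / (2 * √y)) = (-sin √y / √y) / 2 := by field_simp
    _ ≤ (-sin √z / √z) / 2 := by linarith
    _ = _ := by field_simp

/-- The tangent line inequality for `y ↦ cos √y`. -/
theorem two_mul_div_sin_mul_cos_sub_cos_le {z b : ℝ} (hz : 0 < z) (hzb : z ≤ b) (hb : b < π) :
    2 * z / sin z * (cos z - cos b) ≤ b ^ 2 - z ^ 2 := by
  rcases hzb.eq_or_lt with rfl | hlt
  · simp
  have hsin : 0 < sin z := sin_pos_of_pos_of_lt_pi hz (by linarith)
  have hd : HasDerivAt (fun y => cos √y) (-sin √(z ^ 2) * (1 / (2 * √(z ^ 2)))) (z ^ 2) :=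
    (Real.hasDerivAt_sqrt (by positivity)).cos
  rw [sqrt_sq hz.le] at hd
  have h := convexOn_cos_sqrt.le_slope_of_hasDerivAt (x := z ^ 2) (y := b ^ 2)
    ⟨by positivity, by gcongr; linarith⟩ ⟨by positivity, by gcongr; linarith⟩ (by gcongr) hd
  rw [slope_def_field, sqrt_sq hz.le, sqrt_sq (by linarith : (0:ℝ) ≤ b)] at h
  have hp : 0 < b ^ 2 - z ^ 2 := by nlinarith
  rw [le_div_iff₀ hp] at h
  field_simp at h ⊢
  linarith

theorem arctan_sq_mul_le {B p q : ℝ} (hp : 0 ≤ p) (hpq : p < q) (hq : q < B) :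
    (arctan B ^ 2 - arctan p ^ 2) * ((B ^ 2 - q ^ 2) / (1 + q ^ 2)) ≤
      (arctan B ^ 2 - arctan q ^ 2) * ((B ^ 2 - p ^ 2) / (1 + p ^ 2)) := by
  have key : ∀ r, 0 ≤ r → (B ^ 2 - r ^ 2) / (1 + r ^ 2) =
      (1 + B ^ 2) / 2 * (cos √((2 * arctan r) ^ 2) - cos √((2 * arctan B) ^ 2)) := by
    intro r hr
    rw [sqrt_sq (by have := arctan_nonneg.2 hr; positivity),
      sqrt_sq (by have := arctan_nonneg.2 (hp.trans (hpq.trans hq).le); positivity),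
      cos_two_mul, cos_two_mul, cos_sq_arctan, cos_sq_arctan]
    field_simp
    ring
  have a0 : 0 ≤ arctan p := arctan_nonneg.2 hp
  have a1 : arctan p < arctan q := arctan_strictMono hpq
  have a2 : arctan q < arctan B := arctan_strictMono hq
  have a3 := arctan_lt_pi_div_two B
  have hI : ∀ y, 0 ≤ y → y ≤ arctan B → (2 * y) ^ 2 ∈ Set.Icc 0 (π ^ 2) := fun y h1 h2 =>
    ⟨by positivity, pow_le_pow_left₀ (by linarith) (by linarith) 2⟩
  have h := convexOn_cos_sqrt.secant_mono (a := (2 * arctan B) ^ 2) (x := (2 * arctan p) ^ 2)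
    (y := (2 * arctan q) ^ 2) (hI _ (by linarith) le_rfl) (hI _ a0 (by linarith))
    (hI _ (by linarith) a2.le) (by nlinarith) (by nlinarith) (by gcongr)
  rw [key p hp, key q (hp.trans hpq.le)]
  set X := cos √((2 * arctan B) ^ 2)
  set Y := cos √((2 * arctan p) ^ 2)
  set Z := cos √((2 * arctan q) ^ 2)
  have n1 : 0 < (2 * arctan B) ^ 2 - (2 * arctan p) ^ 2 := by nlinarith
  have n2 : 0 < (2 * arctan B) ^ 2 - (2 * arctan q) ^ 2 := by nlinarith
  rw [← neg_sub X Y, ← neg_sub X Z, ← neg_sub ((2 * arctan B) ^ 2),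
    ← neg_sub ((2 * arctan B) ^ 2) ((2 * arctan q) ^ 2), neg_div_neg_eq, neg_div_neg_eq,
    div_le_div_iff₀ n1 n2] at h
  have h' := mul_le_mul_of_nonneg_left h (by positivity : 0 ≤ (1 + B ^ 2) / 8)
  linarith

set_option maxHeartbeats 800000 in
/-- The profile `x ↦ arcsin (M arctan (B sin πx))` is strictly concave on `[0, 1/2]`. -/
theorem strictConcaveOn_arcsin_arctan {B M : ℝ} (hB : 0 < B) (hM : 0 < M)
    (hMB : M * arctan B ≤ 1) :
    StrictConcaveOn ℝ (Set.Icc 0 (1 / 2)) fun x => arcsin (M * arctan (B * sin (π * x))) := by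
  have hpi := pi_pos
  have hsin : ∀ x ∈ Set.Ioo (0:ℝ) (1 / 2), 0 < sin (π * x) ∧ sin (π * x) < 1 ∧ 0 < cos (π * x) := by
    intro x hx
    have h1 : 0 < cos (π * x) := cos_pos_of_mem_Ioo ⟨by nlinarith [hx.1], by nlinarith [hx.2]⟩
    refine ⟨sin_pos_of_pos_of_lt_pi (by nlinarith [hx.1]) (by nlinarith [hx.2]), ?_, h1⟩
    nlinarith [sin_sq_add_cos_sq (π * x), sin_le_one (π * x)]
  have hlt : ∀ x ∈ Set.Ioo (0:ℝ) (1 / 2), 0 < M * arctan (B * sin (π * x)) ∧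
      M * arctan (B * sin (π * x)) < 1 := by
    intro x hx
    obtain ⟨h1, h2, -⟩ := hsin x hx
    have h3 : arctan (B * sin (π * x)) < arctan B := arctan_strictMono (by nlinarith)
    exact ⟨mul_pos hM (arctan_pos.2 (by positivity)), by nlinarith⟩
  have hd : ∀ x ∈ Set.Ioo (0:ℝ) (1 / 2),
      HasDerivAt (fun x => arcsin (M * arctan (B * sin (π * x))))
        (1 / √(1 - (M * arctan (B * sin (π * x))) ^ 2) *
          (M * (1 / (1 + (B * sin (π * x)) ^ 2) * (B * (cos (π * x) * π))))) x := by
    intro x hx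
    obtain ⟨h1, h2⟩ := hlt x hx
    have h3 : HasDerivAt (fun x : ℝ => π * x) π x := by simpa using (hasDerivAt_id x).const_mul π
    exact (hasDerivAt_arcsin (by linarith) h2.ne).comp x ((h3.sin.const_mul B).arctan.const_mul M)
  refine StrictAntiOn.strictConcaveOn_of_deriv (convex_Icc _ _) (by fun_prop) ?_
  rw [interior_Icc]
  intro x hx y hy hxy
  rw [(hd x hx).deriv, (hd y hy).deriv]
  obtain ⟨sx, sx1, cx⟩ := hsin x hx
  obtain ⟨sy, sy1, cy⟩ := hsin y hy
  obtain ⟨mx, mx1⟩ := hlt x hx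
  obtain ⟨my, my1⟩ := hlt y hy
  have hsxy : sin (π * x) < sin (π * y) :=
    sin_lt_sin_of_lt_of_le_pi_div_two (by nlinarith [hx.1]) (by nlinarith [hy.2]) (by nlinarith)
  set p := B * sin (π * x) with hp
  set q := B * sin (π * y) with hq
  have p0 : 0 < p := by positivity
  have hpq : p < q := by nlinarith
  have hqB : q < B := by nlinarith
  have hcx : B ^ 2 * cos (π * x) ^ 2 = B ^ 2 - p ^ 2 := by
    rw [hp]; linear_combination B ^ 2 * sin_sq_add_cos_sq (π * x)
  have hcy : B ^ 2 * cos (π * y) ^ 2 = B ^ 2 - q ^ 2 := by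
    rw [hq]; linear_combination B ^ 2 * sin_sq_add_cos_sq (π * y)
  have key := arctan_sq_mul_le p0.le hpq hqB
  have ex : 0 < 1 - (M * arctan p) ^ 2 := by nlinarith
  have ey : 0 < 1 - (M * arctan q) ^ 2 := by nlinarith
  have hDp : 0 < (B ^ 2 - p ^ 2) / (1 + p ^ 2) := div_pos (by nlinarith) (by positivity)
  have hDq : 0 < (B ^ 2 - q ^ 2) / (1 + q ^ 2) := div_pos (by nlinarith) (by positivity)
  have hDpq : (B ^ 2 - q ^ 2) / (1 + q ^ 2) ≤ (B ^ 2 - p ^ 2) / (1 + p ^ 2) :=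
    div_le_div₀ (by nlinarith) (by nlinarith) (by positivity) (by nlinarith)
  have hE : (1 - (M * arctan p) ^ 2) * ((B ^ 2 - q ^ 2) / (1 + q ^ 2)) ≤
      (1 - (M * arctan q) ^ 2) * ((B ^ 2 - p ^ 2) / (1 + p ^ 2)) := by
    have h0 : 0 ≤ 1 - (M * arctan B) ^ 2 := by
      have : 0 ≤ M * arctan B := mul_nonneg hM.le (arctan_nonneg.2 hB.le)
      nlinarith
    have h1 := mul_le_mul_of_nonneg_left key (sq_nonneg M)
    have h2 := mul_le_mul_of_nonneg_left hDpq h0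
    linarith
  have hfin : (B ^ 2 - q ^ 2) / (1 + q ^ 2) / (1 + q ^ 2) / (1 - (M * arctan q) ^ 2) <
      (B ^ 2 - p ^ 2) / (1 + p ^ 2) / (1 + p ^ 2) / (1 - (M * arctan p) ^ 2) := by
    rw [div_lt_div_iff₀ ey ex]
    have hq2 : 1 + p ^ 2 < 1 + q ^ 2 := by nlinarith
    have hE' := ((mul_comm _ _).trans_le hE).trans_eq (mul_comm _ _)
    have hfin' := div_lt_div₀' hE' hq2 (mul_pos hDp ey) (by positivity)
    rwa [mul_div_right_comm, mul_div_right_comm _ _ (1 + p ^ 2)] at hfin'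
  have sq : ∀ z, 0 < 1 - (M * arctan (B * sin (π * z))) ^ 2 →
      (1 / √(1 - (M * arctan (B * sin (π * z))) ^ 2) *
          (M * (1 / (1 + (B * sin (π * z)) ^ 2) * (B * (cos (π * z) * π))))) ^ 2 =
      M ^ 2 * π ^ 2 * (B ^ 2 * cos (π * z) ^ 2 / (1 + (B * sin (π * z)) ^ 2) /
        (1 + (B * sin (π * z)) ^ 2) / (1 - (M * arctan (B * sin (π * z))) ^ 2)) := by
    intro z hz
    rw [mul_pow, div_pow, sq_sqrt hz.le]
    field_simp
  refine lt_of_pow_lt_pow_left₀ 2 (by positivity) ?_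
  rw [sq x ex, sq y ey, hcx, hcy]
  gcongr


theorem arcsin_arctan_lt_add {B M x₁ x₂ x : ℝ} (hB : 0 < B) (hM : 0 < M)
    (hMB : M * arctan B ≤ 1) (h₁ : 0 < x₁) (h₂ : 0 < x₂) (hx : 0 < x) (hx2 : x ≤ 1 / 2)
    (hsum : x₁ + x₂ = x ∨ x₁ + x₂ = 1 - x) :
    arcsin (M * arctan (B * sin (π * x))) <
      arcsin (M * arctan (B * sin (π * x₁))) + arcsin (M * arctan (B * sin (π * x₂))) := by
  have hpi := pi_pos
  set G : ℝ → ℝ := fun x => arcsin (M * arctan (B * sin (π * x))) with hG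
  have hmono : ∀ y z, 0 ≤ y → y ≤ z → z ≤ 1 / 2 → G y ≤ G z := by
    intro y z hy hyz hz
    refine monotone_arcsin (mul_le_mul_of_nonneg_left (arctan_mono ?_) hM.le)
    refine mul_le_mul_of_nonneg_left (sin_le_sin_of_le_of_le_pi_div_two ?_ ?_ ?_) hB.le <;> nlinarith
  have hpos : ∀ y, 0 < y → y < 1 → 0 < G y := by
    intro y hy hy1
    have : 0 < sin (π * y) := sin_pos_of_pos_of_lt_pi (by positivity) (by nlinarith)
    exact arcsin_pos.2 (mul_pos hM (arctan_pos.2 (by positivity)))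
  have hsymm : ∀ y, G (1 - y) = G y := by
    intro y
    simp only [hG]
    rw [show π * (1 - y) = π - π * y by ring, sin_pi_sub]
  have hsub : ∀ y z, 0 < y → 0 < z → y + z = x → G x < G y + G z := by
    have hlin : ∀ y, 0 < y → y < x → y / x * G x < G y := by
      intro y hy hyx
      have h := (strictConcaveOn_arcsin_arctan hB hM hMB).2 (show (0:ℝ) ∈ _ by norm_num)
        (show x ∈ _ from ⟨hx.le, hx2⟩) hx.ne (show 0 < 1 - y / x by rwa [sub_pos, div_lt_one hx])
        (show 0 < y / x by positivity) (by ring)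
      have e : y / x * x = y := by field_simp
      simpa [e] using h
    intro y z hy hz hyz
    have h1 := hlin y hy (by linarith)
    have h2 := hlin z hz (by linarith)
    have e : y / x * G x + z / x * G x = G x := by
      rw [← add_mul, ← add_div, hyz, div_self hx.ne', one_mul]
    linarith
  change G x < G x₁ + G x₂
  rcases hsum with h | h
  · exact hsub _ _ h₁ h₂ h
  have p1 := hpos x₁ h₁ (by linarith)
  have p2 := hpos x₂ h₂ (by linarith)
  by_cases c1 : 1 / 2 ≤ x₁
  · have := hmono x (1 - x₁) hx.le (by linarith) (by linarith)
    rw [hsymm] at this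
    linarith
  by_cases c2 : 1 / 2 ≤ x₂
  · have := hmono x (1 - x₂) hx.le (by linarith) (by linarith)
    rw [hsymm] at this
    linarith
  by_cases c3 : x ≤ x₁
  · have := hmono x x₁ hx.le c3 (by linarith)
    linarith
  push Not at c1 c2 c3
  have := hsub x₁ (x - x₁) h₁ (by linarith) (by ring)
  have := hmono (x - x₁) x₂ (by linarith) (by linarith) (by linarith)
  linarith

section

theorem IsLocalMin.second_deriv_nonneg {f f' : ℝ → ℝ} {a f₂ : ℝ} (hmin : IsLocalMin f a)
    (hd : ∀ x, HasDerivAt f (f' x) x) (hd2 : HasDerivAt f' f₂ a) : 0 ≤ f₂ := by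
  have h1 : f' a = 0 := hmin.hasDerivAt_eq_zero (hd a)
  by_contra hneg
  push Not at hneg
  have e : deriv f = f' := funext fun x => (hd x).deriv
  have hmax : IsLocalMax f a := isLocalMax_of_deriv_deriv_neg
    (by rw [e, hd2.deriv]; exact hneg) (by rw [e, h1]) (hd a).continuousAt
  have hz : f =ᶠ[nhds a] fun _ => f a := by
    filter_upwards [hmax, hmin] with x hx hx' using le_antisymm hx hx'
  have h2 : deriv f =ᶠ[nhds a] deriv fun _ => f a := hz.deriv
  rw [e, deriv_const'] at h2
  have := h2.deriv_eq
  rw [hd2.deriv, deriv_const] at this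
  exact hneg.ne this

variable {E : Type*} [NormedAddCommGroup E] [InnerProductSpace ℝ E]

/-- A unit vector field turns by at most its total variation. -/
theorem cos_integral_le_inner {T T' : ℝ → E} (hT : ∀ r, HasDerivAt T (T' r) r)
    (hT' : Continuous T') (hn : ∀ r, ‖T r‖ = 1) {u v : ℝ} (huv : u ≤ v)
    (hκ : ∫ r in u..v, ‖T' r‖ ≤ π) : cos (∫ r in u..v, ‖T' r‖) ≤ inner ℝ (T u) (T v) := by
  have hge : -1 ≤ inner ℝ (T u) (T v) := by
    have := (abs_le.1 (abs_real_inner_le_norm (T u) (T v))).1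
    simpa [hn] using this
  rcases hκ.eq_or_lt with h | hlt
  · rw [h, cos_pi]; exact hge
  set A : ℝ → ℝ := fun r => ∫ x in u..r, ‖T' x‖ with hA
  have hAd : ∀ r, HasDerivAt A ‖T' r‖ r := fun r =>
    intervalIntegral.integral_hasDerivAt_right (hT'.norm.intervalIntegrable _ _)
      (hT'.norm.stronglyMeasurableAtFilter _ _) hT'.norm.continuousAt
  have hAmono : Monotone A := monotone_of_deriv_nonneg (fun r => (hAd r).differentiableAt)
    fun r => by rw [(hAd r).deriv]; positivity
  have hA0 : A u = 0 := intervalIntegral.integral_same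
  have hperp : ∀ r, inner ℝ (T r) (T' r) = 0 := by
    intro r
    have h1 := (hT r).inner ℝ (hT r)
    have h2 : HasDerivAt (fun r => inner ℝ (T r) (T r)) 0 r := by
      have : (fun r => inner ℝ (T r) (T r)) = fun _ : ℝ => (1:ℝ) := by
        funext r; rw [real_inner_self_eq_norm_sq, hn, one_pow]
      rw [this]; exact hasDerivAt_const _ _
    have h3 := h1.unique h2
    rw [real_inner_comm (T r) (T' r)] at h3
    linarith
  have hspeed : ∀ r, |inner ℝ (T u) (T' r)| ≤ ‖T' r‖ * √(1 - (inner ℝ (T u) (T r)) ^ 2) := by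
    intro r
    set f := inner ℝ (T u) (T r) with hf
    have h1 : inner ℝ (T u) (T' r) = inner ℝ (T u - f • T r) (T' r) := by
      rw [inner_sub_left, inner_smul_left, hperp]; simp
    have h2 : ‖T u - f • T r‖ = √(1 - f ^ 2) := by
      rw [← sqrt_sq (norm_nonneg _), norm_sub_sq_real, norm_smul, inner_smul_right, hn, hn, ← hf]
      congr 1
      simp
      ring
    rw [h1, ← h2, mul_comm]
    exact abs_real_inner_le_norm _ _
  have hev : ∀ᶠ η : ℝ in nhdsWithin 0 (Set.Ioi 0),
      cos (A v + η * (1 + (v - u))) ≤ inner ℝ (T u) (T v) := by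
    have hsmall : ∀ᶠ η : ℝ in nhdsWithin 0 (Set.Ioi 0), A v + η * (1 + (v - u)) < π := by
      refine nhdsWithin_le_nhds ?_
      have hc : Continuous fun η : ℝ => A v + η * (1 + (v - u)) := by fun_prop
      exact hc.continuousAt.eventually_lt continuousAt_const (by simpa using hlt)
    filter_upwards [hsmall, self_mem_nhdsWithin] with η hη (hη0 : 0 < η)
    have hBd : ∀ r, HasDerivAt (fun r => -cos (A r + η * (1 + (r - u))))
        (sin (A r + η * (1 + (r - u))) * (‖T' r‖ + η)) r := by
      intro r
      have h1 : HasDerivAt (fun r => η * (1 + (r - u))) η r := by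
        simpa using (((hasDerivAt_id r).sub_const u).const_add 1).const_mul η
      have h2 := (((hAd r).add h1).cos).neg
      rw [neg_mul, neg_neg] at h2
      exact h2
    have hfd : ∀ r, HasDerivAt (fun r => -inner ℝ (T u) (T r)) (-inner ℝ (T u) (T' r)) r := by
      intro r
      have := (hasDerivAt_const r (T u)).inner ℝ (hT r)
      rw [inner_zero_left, add_zero] at this
      exact this.neg
    have key := image_le_of_deriv_right_lt_deriv_boundary' (a := u) (b := v)
      (f := fun r => -inner ℝ (T u) (T r)) (f' := fun r => -inner ℝ (T u) (T' r))
      (B := fun r => -cos (A r + η * (1 + (r - u))))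
      (B' := fun r => sin (A r + η * (1 + (r - u))) * (‖T' r‖ + η))
      (fun r _ => (hfd r).continuousAt.continuousWithinAt) (fun r _ => (hfd r).hasDerivWithinAt)
      (by simp only [real_inner_self_eq_norm_sq, hn]; nlinarith [cos_le_one (A u + η * (1 + (u - u)))])
      (fun r _ => (hBd r).continuousAt.continuousWithinAt) (fun r _ => (hBd r).hasDerivWithinAt)
      ?_ (Set.right_mem_Icc.2 huv)
    · simpa using key
    intro r hr heq
    have hpos : 0 < A r + η * (1 + (r - u)) := by
      have := hAmono hr.1
      have : 0 < η * (1 + (r - u)) := mul_pos hη0 (by linarith [hr.1])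
      linarith
    have hltpi : A r + η * (1 + (r - u)) < π := by
      have := hAmono hr.2.le
      have : η * (1 + (r - u)) ≤ η * (1 + (v - u)) := by
        have := hr.2
        gcongr
      linarith
    have hsin := sin_pos_of_pos_of_lt_pi hpos hltpi
    have h1 := hspeed r
    rw [neg_inj.1 heq, ← sin_sq, sqrt_sq hsin.le] at h1
    have h2 := neg_le_abs (inner ℝ (T u) (T' r))
    nlinarith
  have hlim : Filter.Tendsto (fun η : ℝ => cos (A v + η * (1 + (v - u))))
      (nhdsWithin 0 (Set.Ioi 0)) (nhds (cos (A v))) := by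
    have : Continuous fun η : ℝ => cos (A v + η * (1 + (v - u))) := by fun_prop
    have := this.tendsto 0
    rw [zero_mul, add_zero] at this
    exact this.mono_left nhdsWithin_le_nhds
  exact le_of_tendsto hlim hev

/-- Fenchel's theorem: the total curvature of a closed curve is at least `2π`. -/
theorem two_pi_le_integral_norm {T T' : ℝ → E} (hT : ∀ r, HasDerivAt T (T' r) r)
    (hT' : Continuous T') (hn : ∀ r, ‖T r‖ = 1) {p L : ℝ} (hL : 0 < L) (hper : T (p + L) = T p)
    (hint : ∀ w : E, ∫ r in p..(p + L), inner ℝ w (T r) = 0) :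
    2 * π ≤ ∫ r in p..(p + L), ‖T' r‖ := by
  by_contra hlt
  push Not at hlt
  have hi : ∀ a b, IntervalIntegrable (fun r => ‖T' r‖) volume a b :=
    fun a b => hT'.norm.intervalIntegrable _ _
  have hnn : ∀ a b, a ≤ b → 0 ≤ ∫ r in a..b, ‖T' r‖ := fun a b hab =>
    intervalIntegral.integral_nonneg hab fun r _ => norm_nonneg _
  have hTc : Continuous T := continuous_iff_continuousAt.2 fun r => (hT r).continuousAt
  set K := ∫ r in p..(p + L), ‖T' r‖ with hK
  have hK0 : 0 ≤ K := hnn _ _ (by linarith)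
  obtain ⟨m, hm, hmK⟩ : ∃ m ∈ Set.Icc p (p + L), ∫ r in p..m, ‖T' r‖ = K / 2 := by
    have hc : ContinuousOn (fun m => ∫ r in p..m, ‖T' r‖) (Set.Icc p (p + L)) :=
      (intervalIntegral.continuous_primitive hi p).continuousOn
    have := intermediate_value_Icc (by linarith : p ≤ p + L) hc
    exact this (by simp only [intervalIntegral.integral_same]; exact ⟨by linarith, by linarith⟩)
  have hmK2 : ∫ r in m..(p + L), ‖T' r‖ = K / 2 := by
    have := intervalIntegral.integral_add_adjacent_intervals (hi p m) (hi m (p + L))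
    linarith
  have key : ∀ a b, a ≤ b → ∫ r in a..b, ‖T' r‖ = K / 2 → ∀ r ∈ Set.Icc a b,
      0 < inner ℝ (T a + T b) (T r) := by
    intro a b hab hab2 r hr
    have h1 := intervalIntegral.integral_add_adjacent_intervals (hi a r) (hi r b)
    have n1 := hnn a r hr.1
    have n2 := hnn r b hr.2
    have e1 := cos_integral_le_inner hT hT' hn hr.1 (by linarith)
    have e2 := cos_integral_le_inner hT hT' hn hr.2 (by linarith)
    rw [inner_add_left, real_inner_comm (T r) (T b)]
    have e3 := cos_add_cos (∫ x in a..r, ‖T' x‖) (∫ x in r..b, ‖T' x‖)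
    have c1 : 0 < cos (((∫ x in a..r, ‖T' x‖) + ∫ x in r..b, ‖T' x‖) / 2) :=
      cos_pos_of_mem_Ioo ⟨by linarith [pi_pos], by linarith⟩
    have c2 : 0 < cos (((∫ x in a..r, ‖T' x‖) - ∫ x in r..b, ‖T' x‖) / 2) :=
      cos_pos_of_mem_Ioo ⟨by linarith [pi_pos], by linarith⟩
    have := mul_pos c1 c2
    linarith
  have hpos : ∀ r ∈ Set.Ioc p (p + L), 0 < inner ℝ (T p + T m) (T r) := by
    intro r hr
    rcases le_total r m with h | h
    · exact key p m hm.1 hmK r ⟨hr.1.le, h⟩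
    · have := key m (p + L) hm.2 hmK2 r ⟨h, hr.2⟩
      rwa [hper, add_comm] at this
  have := intervalIntegral.intervalIntegral_pos_of_pos_on
    (f := fun r => inner ℝ (T p + T m) (T r)) (a := p) (b := p + L)
    ((by fun_prop : Continuous fun r => inner ℝ (T p + T m) (T r)).intervalIntegrable _ _)
    (fun r hr => hpos r ⟨hr.1, hr.2.le⟩) (by linarith)
  rw [hint] at this
  exact lt_irrefl _ this

theorem sq_le_mul_integral_sq {k : ℝ → ℝ} (hk : Continuous k) {u v A : ℝ} (huv : u < v)
    (hA0 : 0 ≤ A) (hA : A ≤ ∫ r in u..v, k r) : A ^ 2 / (v - u) ≤ ∫ r in u..v, k r ^ 2 := by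
  have hpos : 0 < v - u := by linarith
  have h : 0 ≤ ∫ r in u..v, (k r - A / (v - u)) ^ 2 :=
    intervalIntegral.integral_nonneg huv.le fun r _ => sq_nonneg _
  have e : ∫ r in u..v, (k r - A / (v - u)) ^ 2 =
      (∫ r in u..v, k r ^ 2) - 2 * (A / (v - u)) * (∫ r in u..v, k r) + A ^ 2 / (v - u) := by
    have : ∀ r, (k r - A / (v - u)) ^ 2 = k r ^ 2 - 2 * (A / (v - u)) * k r + (A / (v - u)) ^ 2 :=
      fun r => by ring
    simp only [this]
    rw [intervalIntegral.integral_add (Continuous.intervalIntegrable (by fun_prop) _ _)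
      (Continuous.intervalIntegrable (by fun_prop) _ _),
      intervalIntegral.integral_sub (Continuous.intervalIntegrable (by fun_prop) _ _)
      (Continuous.intervalIntegrable (by fun_prop) _ _), intervalIntegral.integral_const_mul,
      intervalIntegral.integral_const]
    simp only [smul_eq_mul]
    field_simp
  rw [e] at h
  have h2 : A / (v - u) * A ≤ A / (v - u) * ∫ r in u..v, k r := by gcongr
  have h3 : A / (v - u) * A = A ^ 2 / (v - u) := by ring
  linarith

end

/-- The comparison chord length `L/(πB) · arctan (B sin (πs/L))` for an arc of length `s` on a
closed curve of length `L`. -/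
def modelChord (B L s : ℝ) : ℝ := L / (π * B) * arctan (B * sin (π * s / L))

theorem hasDerivAt_modelChord {B L : ℝ} (hB : 0 < B) (hL : 0 < L) (s : ℝ) :
    HasDerivAt (modelChord B L) (cos (π * s / L) / (1 + (B * sin (π * s / L)) ^ 2)) s := by
  have h1 : HasDerivAt (fun s => π * s / L) (π / L) s := by
    simpa using ((hasDerivAt_id s).const_mul π).div_const L
  have h2 := ((h1.sin.const_mul B).arctan).const_mul (L / (π * B))
  refine h2.congr_deriv ?_
  have := pi_pos
  field_simp

theorem hasDerivAt_deriv_modelChord {B L : ℝ} (s : ℝ) :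
    HasDerivAt (fun s => cos (π * s / L) / (1 + (B * sin (π * s / L)) ^ 2))
      (-(π / L) * (sin (π * s / L) / (1 + (B * sin (π * s / L)) ^ 2) +
        2 * B ^ 2 * sin (π * s / L) * cos (π * s / L) ^ 2 /
          (1 + (B * sin (π * s / L)) ^ 2) ^ 2)) s := by
  have h1 : HasDerivAt (fun s => π * s / L) (π / L) s := by
    simpa using ((hasDerivAt_id s).const_mul π).div_const L
  have h2 := h1.cos.div (((h1.sin.const_mul B).pow 2).const_add 1)
    (by positivity : 1 + (B * sin (π * s / L)) ^ 2 ≠ 0)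
  refine h2.congr_deriv ?_
  have h3 : 1 + (B * sin (π * s / L)) ^ 2 ≠ 0 := by positivity
  simp only [Nat.cast_ofNat, Pi.pow_apply]
  generalize sin (π * s / L) = S at *
  generalize π / L = R
  norm_num
  field_simp
  ring

theorem modelChord_symm {B L : ℝ} (hL : 0 < L) (s : ℝ) :
    modelChord B L (L - s) = modelChord B L s := by
  unfold modelChord
  rw [show π * (L - s) / L = π - π * s / L by field_simp, sin_pi_sub]

theorem sin_pi_mul_div_nonneg {L s : ℝ} (hL : 0 < L) (h0 : 0 ≤ s) (h1 : s ≤ L) :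
    0 ≤ sin (π * s / L) := by
  refine sin_nonneg_of_nonneg_of_le_pi (by positivity) ?_
  rw [div_le_iff₀ hL]
  gcongr

theorem modelChord_nonneg {B L s : ℝ} (hB : 0 < B) (hL : 0 < L) (h0 : 0 ≤ s) (h1 : s ≤ L) :
    0 ≤ modelChord B L s := by
  have := sin_pi_mul_div_nonneg hL h0 h1
  exact mul_nonneg (by positivity) (arctan_nonneg.2 (by positivity))

theorem arctan_le_self {x : ℝ} (hx : 0 ≤ x) : arctan x ≤ x := by
  rcases hx.eq_or_lt with rfl | h
  · simp
  · have h1 : 0 < arctan x := arctan_pos.2 h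
    have := (lt_tan h1 (arctan_lt_pi_div_two x)).le
    rwa [tan_arctan] at this

theorem modelChord_le {B L s : ℝ} (hB : 0 < B) (hL : 0 < L) (h0 : 0 ≤ s) (h1 : s ≤ L) :
    modelChord B L s ≤ s := by
  have h2 := sin_pi_mul_div_nonneg hL h0 h1
  have h3 : arctan (B * sin (π * s / L)) ≤ B * (π * s / L) :=
    (arctan_le_self (by positivity)).trans
      (mul_le_mul_of_nonneg_left (sin_le (by positivity)) hB.le)
  have := mul_le_mul_of_nonneg_left h3 (by positivity : 0 ≤ L / (π * B))
  refine this.trans_eq ?_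
  have := pi_pos
  field_simp

theorem div_one_add_sq_le_arctan {x : ℝ} (hx : 0 ≤ x) : x / (1 + x ^ 2) ≤ arctan x := by
  have h1 : 0 ≤ arctan x := arctan_nonneg.2 hx
  have h2 := sin_le (show 0 ≤ 2 * arctan x by positivity)
  rw [sin_two_mul, sin_arctan, cos_arctan] at h2
  have h3 : 0 < √(1 + x ^ 2) := by positivity
  have h4 : √(1 + x ^ 2) ^ 2 = 1 + x ^ 2 := sq_sqrt (by positivity)
  have h5 : 2 * (x / √(1 + x ^ 2)) * (1 / √(1 + x ^ 2)) = 2 * (x / √(1 + x ^ 2) ^ 2) := by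
    field_simp
  rw [h5, h4] at h2
  linarith

/-- The inequality closing the maximum principle argument for the chord-arc comparison. -/
theorem chordArc_evolution_nonneg {B L m s K K₁ b R : ℝ} (hB : 0 < B) (hL : 0 < L) (hm : 1 ≤ m)
    (hs : 0 < s) (hs2 : s ≤ L / 2) (hb0 : 0 ≤ b) (hb1 : b ≤ π / 2)
    (hb : m * cos b = cos (π * s / L) / (1 + (B * sin (π * s / L)) ^ 2))
    (hK : 4 * π ^ 2 / L ≤ K) (hK₁ : 4 * b ^ 2 / s ≤ K₁)
    (hR : 4 * (-(π / L) * (sin (π * s / L) / (1 + (B * sin (π * s / L)) ^ 2) +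
        2 * B ^ 2 * sin (π * s / L) * cos (π * s / L) ^ 2 /
          (1 + (B * sin (π * s / L)) ^ 2) ^ 2)) ≤ R) :
    0 ≤ R + (arctan (B * sin (π * s / L)) / (π * B) -
          s / L * (cos (π * s / L) / (1 + (B * sin (π * s / L)) ^ 2))) * K +
        cos (π * s / L) / (1 + (B * sin (π * s / L)) ^ 2) * K₁ -
        4 * π / L * (arctan (B * sin (π * s / L)) / B -
          sin (π * s / L) / (1 + (B * sin (π * s / L)) ^ 2)) := by
  have hpi := pi_pos
  set z := π * s / L with hz
  have hz0 : 0 < z := by positivity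
  have hz1 : z ≤ π / 2 := by rw [hz, div_le_iff₀ hL]; nlinarith
  have hsz : s = z * L / π := by rw [hz]; field_simp
  have hS : 0 < sin z := sin_pos_of_pos_of_lt_pi hz0 (by linarith)
  have hC : 0 ≤ cos z := cos_nonneg_of_neg_pi_div_two_le_of_le (by linarith) hz1
  have hCb : 0 ≤ cos b := cos_nonneg_of_neg_pi_div_two_le_of_le (by linarith) hb1
  set P := 1 + (B * sin z) ^ 2 with hP
  have hP1 : 1 ≤ P := by rw [hP]; nlinarith [sq_nonneg (B * sin z)]
  have hP0 : 0 < P := by linarith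
  have hcb : cos b ≤ cos z / P := by rw [← hb]; nlinarith
  have hCP : cos z / P ≤ cos z := div_le_self hC hP1
  have hzb : z ≤ b := by
    by_contra hlt
    push Not at hlt
    have := cos_lt_cos_of_nonneg_of_le_pi_div_two hb0 hz1 hlt
    linarith
  have hkey := two_mul_div_sin_mul_cos_sub_cos_le hz0 hzb (by linarith)
  have h1 : cos z * (B * sin z) ^ 2 / P ≤ cos z - cos b := by
    have : cos z * (B * sin z) ^ 2 / P = cos z - cos z / P := by
      rw [hP]; field_simp; ring
    linarith
  have h2 : 2 * z * (cos z * B ^ 2 * sin z / P) ≤ b ^ 2 - z ^ 2 := by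
    refine le_trans ?_ hkey
    have := mul_le_mul_of_nonneg_left h1 (by positivity : 0 ≤ 2 * z / sin z)
    refine le_trans (le_of_eq ?_) this
    field_simp
  have hzC : z * cos z ≤ sin z := by
    rcases hz1.eq_or_lt with h | h
    · rw [h, cos_pi_div_two]; simp
    · have hC' : 0 < cos z := cos_pos_of_mem_Ioo ⟨by linarith, h⟩
      have := (lt_tan hz0 h).le
      rwa [tan_eq_sin_div_cos, le_div_iff₀ hC'] at this
  have hat := div_one_add_sq_le_arctan (show 0 ≤ B * sin z by positivity)
  rw [← hP] at hat
  have hco : 0 ≤ arctan (B * sin z) / (π * B) - s / L * (cos z / P) := by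
    rw [sub_nonneg]
    calc s / L * (cos z / P) = (z * cos z) / (π * P) := by rw [hsz]; field_simp
      _ ≤ sin z / (π * P) := by gcongr
      _ = (B * sin z / P) / (π * B) := by field_simp
      _ ≤ _ := by gcongr
  have t1 := mul_le_mul_of_nonneg_left hK hco
  have t2 := mul_le_mul_of_nonneg_left hK₁ (by positivity : 0 ≤ cos z / P)
  have t3 : 0 ≤ 4 * π / L * (cos z / (P * z)) * (b ^ 2 - z ^ 2 - 2 * z * (cos z * B ^ 2 * sin z / P)) :=
    mul_nonneg (by positivity) (by linarith)
  have t4 : 4 * π / L * (cos z / (P * z)) * (b ^ 2 - z ^ 2 - 2 * z * (cos z * B ^ 2 * sin z / P)) =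
      4 * (-(π / L) * (sin z / P + 2 * B ^ 2 * sin z * cos z ^ 2 / P ^ 2)) +
      (arctan (B * sin z) / (π * B) - s / L * (cos z / P)) * (4 * π ^ 2 / L) +
      cos z / P * (4 * b ^ 2 / s) - 4 * π / L * (arctan (B * sin z) / B - sin z / P) := by
    rw [hsz]
    field_simp
    ring
  linarith

/-- `c` is an arclength parametrisation of a simple closed curve of length `L` on the unit sphere,
with first and second derivatives `T` and `N`. -/
structure IsUnitSpeedLoop {E : Type*} [NormedAddCommGroup E] [InnerProductSpace ℝ E]
    (c T N : ℝ → E) (L : ℝ) : Prop where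
  length_pos : 0 < L
  hasDerivAt : ∀ r, HasDerivAt c (T r) r
  hasDerivAt_deriv : ∀ r, HasDerivAt T (N r) r
  continuous_second : Continuous N
  norm_eq_one : ∀ r, ‖c r‖ = 1
  norm_deriv : ∀ r, ‖T r‖ = 1
  periodic : ∀ r, c (r + L) = c r
  ne_of_lt : ∀ a b, a < b → b < a + L → c a ≠ c b

namespace IsUnitSpeedLoop

variable {E : Type*} [NormedAddCommGroup E] [InnerProductSpace ℝ E]
  {c T N : ℝ → E} {L : ℝ}

theorem periodic_deriv (h : IsUnitSpeedLoop c T N L) (r : ℝ) : T (r + L) = T r := by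
  have := (h.hasDerivAt (r + L)).comp_add_const r L
  rw [show (fun x => c (x + L)) = c from funext h.periodic] at this
  exact this.unique (h.hasDerivAt r)

theorem inner_deriv (h : IsUnitSpeedLoop c T N L) (r : ℝ) : inner ℝ (c r) (T r) = 0 := by
  have h1 := (h.hasDerivAt r).inner ℝ (h.hasDerivAt r)
  have h2 : HasDerivAt (fun r => inner ℝ (c r) (c r)) 0 r := by
    have : (fun r => inner ℝ (c r) (c r)) = fun _ : ℝ => (1:ℝ) := by
      funext r; rw [real_inner_self_eq_norm_sq, h.norm_eq_one, one_pow]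
    rw [this]; exact hasDerivAt_const _ _
  have h3 := h1.unique h2
  rw [real_inner_comm (c r) (T r)] at h3
  linarith

theorem inner_second (h : IsUnitSpeedLoop c T N L) (r : ℝ) : inner ℝ (c r) (N r) = -1 := by
  have h1 := (h.hasDerivAt r).inner ℝ (h.hasDerivAt_deriv r)
  rw [funext h.inner_deriv, real_inner_self_eq_norm_sq, h.norm_deriv] at h1
  have := h1.unique (hasDerivAt_const _ _)
  linarith

/-- First and second variation of the chord-arc comparison at a contact point. -/
theorem variation (h : IsUnitSpeedLoop c T N L) {B m p q : ℝ} (hB : 0 < B)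
    (hle : ∀ p q, p ≤ q → q ≤ p + L → modelChord B L (q - p) ≤ m * ‖c q - c p‖)
    (hpq : p < q) (hqp : q < p + L) (heq : m * ‖c q - c p‖ = modelChord B L (q - p))
    {h₁ h₂ : ℝ} (hh₁ : h₁ = cos (π * (q - p) / L) / (1 + (B * sin (π * (q - p) / L)) ^ 2))
    (hh₂ : h₂ = -(π / L) * (sin (π * (q - p) / L) / (1 + (B * sin (π * (q - p) / L)) ^ 2) +
        2 * B ^ 2 * sin (π * (q - p) / L) * cos (π * (q - p) / L) ^ 2 /
          (1 + (B * sin (π * (q - p) / L)) ^ 2) ^ 2)) (α β : ℝ) :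
    m ^ 2 * inner ℝ (c q - c p) (β • T q - α • T p) = modelChord B L (q - p) * h₁ * (β - α) ∧
    0 ≤ m ^ 2 * (‖β • T q - α • T p‖ ^ 2 +
        inner ℝ (c q - c p) (β ^ 2 • N q - α ^ 2 • N p)) -
      (h₁ ^ 2 + modelChord B L (q - p) * h₂) * (β - α) ^ 2 := by
  have hlin : ∀ x y ε : ℝ, HasDerivAt (fun ε : ℝ => x + y * ε) y ε := fun x y ε => by
    simpa using ((hasDerivAt_id ε).const_mul y).const_add x
  set H : ℝ → ℝ := fun s => cos (π * s / L) / (1 + (B * sin (π * s / L)) ^ 2) with hH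
  have dc : ∀ x y ε : ℝ, HasDerivAt (fun ε => c (x + y * ε)) (y • T (x + y * ε)) ε :=
    fun x y ε => (h.hasDerivAt _).scomp ε (hlin x y ε)
  have dT : ∀ x y ε : ℝ, HasDerivAt (fun ε => T (x + y * ε)) (y • N (x + y * ε)) ε :=
    fun x y ε => (h.hasDerivAt_deriv _).scomp ε (hlin x y ε)
  set Δ : ℝ → E := fun ε => c (q + β * ε) - c (p + α * ε) with hΔ
  set Δ' : ℝ → E := fun ε => β • T (q + β * ε) - α • T (p + α * ε) with hΔ'
  set S : ℝ → ℝ := fun ε => q - p + (β - α) * ε with hS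
  have dΔ : ∀ ε, HasDerivAt Δ (Δ' ε) ε := fun ε => (dc q β ε).sub (dc p α ε)
  have dΔ' : ∀ ε, HasDerivAt Δ' (β • β • N (q + β * ε) - α • α • N (p + α * ε)) ε :=
    fun ε => ((dT q β ε).const_smul β).sub ((dT p α ε).const_smul α)
  have dS : ∀ ε, HasDerivAt S (β - α) ε := fun ε => hlin _ _ ε
  have dM : ∀ ε, HasDerivAt (fun ε => modelChord B L (S ε)) (H (S ε) * (β - α)) ε :=
    fun ε => (hasDerivAt_modelChord hB h.length_pos _).comp ε (dS ε)
  have dH : HasDerivAt (fun ε => H (S ε)) (h₂ * (β - α)) 0 := by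
    have := (hasDerivAt_deriv_modelChord (B := B) (L := L) (S 0)).comp 0 (dS 0)
    have e : S 0 = q - p := by simp [hS]
    rw [e, ← hh₂] at this
    exact this
  set f : ℝ → ℝ := fun ε => m ^ 2 * inner ℝ (Δ ε) (Δ ε) - modelChord B L (S ε) ^ 2 with hf
  set f' : ℝ → ℝ := fun ε => m ^ 2 * (2 * inner ℝ (Δ ε) (Δ' ε)) -
    2 * (modelChord B L (S ε) * (H (S ε) * (β - α))) with hf'
  have df : ∀ ε, HasDerivAt f (f' ε) ε := by
    intro ε
    refine ((((dΔ ε).inner ℝ (dΔ ε)).const_mul (m ^ 2)).sub ((dM ε).pow 2)).congr_deriv ?_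
    rw [real_inner_comm (Δ ε) (Δ' ε)]
    simp only [hf']
    norm_num
    ring
  have df' : HasDerivAt f' (m ^ 2 * (2 * (inner ℝ (Δ 0) (β • β • N (q + β * 0) - α • α • N (p + α * 0))
      + inner ℝ (Δ' 0) (Δ' 0))) - 2 * (H (S 0) * (β - α) * (H (S 0) * (β - α)) +
        modelChord B L (S 0) * (h₂ * (β - α) * (β - α)))) 0 :=
    ((((dΔ 0).inner ℝ (dΔ' 0)).const_mul 2).const_mul (m ^ 2)).sub
      (((dM 0).mul (dH.mul_const (β - α))).const_mul 2)
  have hmin : IsLocalMin f 0 := by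
    have hc : Continuous S := by fun_prop
    have e0 : S 0 = q - p := by simp [hS]
    have ev : ∀ᶠ ε in nhds 0, S ε ∈ Set.Ioo 0 L :=
      hc.continuousAt.eventually (Ioo_mem_nhds (by linarith) (by linarith))
    have f0 : f 0 = 0 := by
      simp only [hf, hΔ, hS, mul_zero, add_zero, real_inner_self_eq_norm_sq, ← heq]
      ring
    filter_upwards [ev] with ε hε
    rw [f0]
    simp only [hf, real_inner_self_eq_norm_sq, hΔ]
    have h1 := hle (p + α * ε) (q + β * ε) (by have := hε.1; simp only [hS] at this; linarith)
      (by have := hε.2; simp only [hS] at this; linarith)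
    have e : q + β * ε - (p + α * ε) = S ε := by simp only [hS]; ring
    rw [e] at h1
    have h2 := modelChord_nonneg hB h.length_pos hε.1.le hε.2.le
    rw [← mul_pow]
    exact sub_nonneg.2 (pow_le_pow_left₀ h2 h1 2)
  have r1 := hmin.hasDerivAt_eq_zero (df 0)
  have r2 := hmin.second_deriv_nonneg df df'
  simp only [hf', hΔ, hΔ', hS, mul_zero, add_zero] at r1 r2
  have eH : H (q - p) = h₁ := hh₁.symm
  rw [eH] at r1 r2
  constructor
  · linarith
  · rw [real_inner_self_eq_norm_sq, smul_smul, smul_smul, ← sq, ← sq] at r2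
    linarith

end IsUnitSpeedLoop

/-- Half-angles subtended by the two parts of a minor arc add up. -/
theorem arcsin_half_chord_add {g s x y d₁ d₂ : ℝ} (hg : 0 < g) (hs : 0 < s) (hgs : g ^ 2 + s ^ 2 = 1)
    (hxy : x ^ 2 + y ^ 2 = 1) (hx : g < x) (h₁ : 0 ≤ d₁) (h₂ : 0 ≤ d₂)
    (hd₁ : d₁ ^ 2 = 2 - 2 * (g * x - s * y)) (hd₂ : d₂ ^ 2 = 2 - 2 * (g * x + s * y)) :
    arcsin (d₁ / 2) + arcsin (d₂ / 2) = arcsin s := by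
  have hs1 : s ≤ 1 := by nlinarith
  have hy1 : y < s := by nlinarith
  have hy2 : -s < y := by nlinarith
  set θ := arcsin s with hθ
  set φ := arcsin y with hφ
  have sθ : sin θ = s := sin_arcsin (by linarith) hs1
  have sφ : sin φ = y := sin_arcsin (by linarith) (by linarith)
  have cθ : cos θ = g := by
    rw [hθ, cos_arcsin, show 1 - s ^ 2 = g ^ 2 by linarith, sqrt_sq hg.le]
  have cφ : cos φ = x := by
    rw [hφ, cos_arcsin, show 1 - y ^ 2 = x ^ 2 by linarith, sqrt_sq (by linarith)]
  have l1 : φ < θ := strictMonoOn_arcsin ⟨by linarith, by linarith⟩ ⟨by linarith, hs1⟩ hy1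
  have l2 : -θ < φ := by
    rw [hθ, ← arcsin_neg]
    exact strictMonoOn_arcsin ⟨by linarith, by linarith⟩ ⟨by linarith, by linarith⟩ hy2
  have hθ2 : θ ≤ π / 2 := arcsin_le_pi_div_two s
  have key : ∀ d ω : ℝ, 0 ≤ d → 0 ≤ ω → ω ≤ π → d ^ 2 = 2 - 2 * cos ω → arcsin (d / 2) = ω / 2 := by
    intro d ω hd hω hω2 h
    have hsin : 0 ≤ sin (ω / 2) := sin_nonneg_of_nonneg_of_le_pi (by linarith) (by linarith)
    have : d / 2 = sin (ω / 2) := by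
      refine (pow_left_inj₀ (by linarith) hsin two_ne_zero).1 ?_
      rw [sin_sq_eq_half_sub, show 2 * (ω / 2) = ω by ring]
      linarith
    rw [this, arcsin_sin (by linarith) (by linarith)]
  rw [key d₁ (θ + φ) h₁ (by linarith) (by linarith) (by rw [cos_add, sθ, sφ, cθ, cφ]; linarith),
    key d₂ (θ - φ) h₂ (by linarith) (by linarith) (by rw [cos_sub, sθ, sφ, cθ, cφ]; linarith)]
  ring

namespace IsUnitSpeedLoop

variable {E : Type*} [NormedAddCommGroup E] [InnerProductSpace ℝ E]
  {c T N : ℝ → E} {L : ℝ}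

theorem mul_arctan_le_one (h : IsUnitSpeedLoop c T N L) {B m : ℝ} (hm : 0 < m) 
    (hle : ∀ p q, p ≤ q → q ≤ p + L → modelChord B L (q - p) ≤ m * ‖c q - c p‖) :
    L / (2 * m * π * B) * arctan B ≤ 1 := by
  have hL := h.length_pos
  have h1 := hle 0 (L / 2) (by linarith) (by linarith)
  have h2 : ‖c (L / 2) - c 0‖ ≤ 2 := by
    have := norm_sub_le (c (L / 2)) (c 0)
    rw [h.norm_eq_one, h.norm_eq_one] at this
    linarith
  have h3 : modelChord B L (L / 2 - 0) = 2 * m * (L / (2 * m * π * B) * arctan B) := by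
    unfold modelChord
    rw [show π * (L / 2 - 0) / L = π / 2 by field_simp; ring, sin_pi_div_two, mul_one]
    field_simp
  rw [h3] at h1
  have h4 : m * ‖c (L / 2) - c 0‖ ≤ m * 2 := by gcongr
  have h5 : 2 * m * (L / (2 * m * π * B) * arctan B) ≤ 2 * m * 1 := by linarith
  exact le_of_mul_le_mul_left h5 (by linarith)

/-- At a contact point, no third point of the curve lies on the open minor great circle arc. -/
theorem not_mem_minorArc (h : IsUnitSpeedLoop c T N L) {B m p q : ℝ} (hB : 0 < B) (hm : 0 < m)
    (hle : ∀ p q, p ≤ q → q ≤ p + L → modelChord B L (q - p) ≤ m * ‖c q - c p‖)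
    (hpq : p < q) (hqp : q - p ≤ L / 2) (heq : m * ‖c q - c p‖ = modelChord B L (q - p))
    {r : ℝ} (hpr : p < r) (hrp : r < p + L) (hrq : r ≠ q)
    (harc : arcsin (‖c r - c p‖ / 2) + arcsin (‖c r - c q‖ / 2) = arcsin (‖c q - c p‖ / 2)) :
    False := by
  have hL := h.length_pos
  have hpi := pi_pos
  have hG : ∀ s, arcsin (L / (2 * m * π * B) * arctan (B * sin (π * (s / L)))) =
      arcsin (modelChord B L s / (2 * m)) := by
    intro s
    unfold modelChord
    rw [mul_div_assoc π s L]
    congr 1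
    field_simp
  have hGle : ∀ p q, p ≤ q → q ≤ p + L →
      arcsin (modelChord B L (q - p) / (2 * m)) ≤ arcsin (‖c q - c p‖ / 2) := by
    intro p q hpq hqp
    refine monotone_arcsin ?_
    rw [div_le_div_iff₀ (by positivity) (by positivity)]
    linarith [hle p q hpq hqp]
  have hGeq : arcsin (modelChord B L (q - p) / (2 * m)) = arcsin (‖c q - c p‖ / 2) := by
    rw [← heq]; congr 1; field_simp
  have hsub : ∀ s₁ s₂, 0 < s₁ → 0 < s₂ → (s₁ + s₂ = q - p ∨ s₁ + s₂ = L - (q - p)) →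
      arcsin (modelChord B L (q - p) / (2 * m)) <
        arcsin (modelChord B L s₁ / (2 * m)) + arcsin (modelChord B L s₂ / (2 * m)) := by
    intro s₁ s₂ h1 h2 hs
    rw [← hG, ← hG, ← hG]
    refine arcsin_arctan_lt_add hB (by positivity) (h.mul_arctan_le_one hm hle) (by positivity)
      (by positivity) (div_pos (by linarith) hL) (by rw [div_le_iff₀ hL]; linarith) ?_
    rcases hs with hs | hs
    · left; rw [← add_div, hs]
    · right; rw [← add_div, hs]; field_simp
  rcases lt_or_gt_of_ne hrq with hlt | hgt
  · have h1 := hGle p r hpr.le hrp.le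
    have h2 := hGle r q hlt.le (by linarith)
    have h3 := hsub (r - p) (q - r) (by linarith) (by linarith) (Or.inl (by ring))
    rw [norm_sub_rev] at h2
    linarith
  · have h1 := hGle q r hgt.le (by linarith)
    have h2 := hGle r (p + L) hrp.le (by linarith)
    have h3 := hsub (r - q) (p + L - r) (by linarith) (by linarith) (Or.inr (by ring))
    rw [h.periodic, norm_sub_rev] at h2
    linarith

end IsUnitSpeedLoop

theorem exists_orthonormalBasis_pair {e₁ e₂ : EuclideanSpace ℝ (Fin 3)} (h₁ : ‖e₁‖ = 1)
    (h₂ : ‖e₂‖ = 1) (h : inner ℝ e₁ e₂ = 0) :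
    ∃ b : OrthonormalBasis (Fin 3) ℝ (EuclideanSpace ℝ (Fin 3)), b 0 = e₁ ∧ b 1 = e₂ := by
  have hv : Orthonormal ℝ (({0, 1} : Set (Fin 3)).domRestrict ![e₁, e₂, 0]) := by
    refine ⟨?_, ?_⟩
    · rintro ⟨i, rfl | rfl⟩ <;> simp [h₁, h₂]
    · rintro ⟨i, rfl | rfl⟩ ⟨j, rfl | rfl⟩ hij
      · exact absurd rfl hij
      · simpa using h
      · simpa [real_inner_comm] using h
      · exact absurd rfl hij
  obtain ⟨b, hb⟩ := hv.exists_orthonormalBasis_extension_of_card_eq (by simp)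
  exact ⟨b, by simpa using hb 0 (by simp), by simpa using hb 1 (by simp)⟩

namespace IsUnitSpeedLoop

variable {c T N : ℝ → EuclideanSpace ℝ (Fin 3)} {L : ℝ}

/-- At a contact point, the two unit tangent vectors are mirror images of each other. -/
theorem deriv_add_deriv_eq_smul (h : IsUnitSpeedLoop c T N L) {B m p q : ℝ} (hB : 0 < B)
    (hm : 0 < m)
    (hle : ∀ p q, p ≤ q → q ≤ p + L → modelChord B L (q - p) ≤ m * ‖c q - c p‖)
    (hpq : p < q) (hqp : q - p ≤ L / 2) (heq : m * ‖c q - c p‖ = modelChord B L (q - p))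
    {k : ℝ} (hTp : inner ℝ (c q - c p) (T p) = k * ‖c q - c p‖)
    (hTq : inner ℝ (c q - c p) (T q) = k * ‖c q - c p‖)
    (hsec : 0 ≤ ‖T q - T p‖ ^ 2 + inner ℝ (c q - c p) (N q - N p)) :
    T p + T q = (2 * k / ‖c q - c p‖) • (c q - c p) := by
  have hL := h.length_pos
  have hne : c p ≠ c q := h.ne_of_lt p q hpq (by linarith)
  set d := ‖c q - c p‖ with hd
  have hd0 : 0 < d := norm_pos_iff.2 (sub_ne_zero.2 hne.symm)
  have hcc : ∀ r, inner ℝ (c r) (c r) = 1 := fun r => by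
    rw [real_inner_self_eq_norm_sq, h.norm_eq_one, one_pow]
  have hTT : ∀ r, inner ℝ (T r) (T r) = 1 := fun r => by
    rw [real_inner_self_eq_norm_sq, h.norm_deriv, one_pow]
  by_cases hanti : c p + c q = 0
  · have hq : c q = -c p := by rw [eq_neg_iff_add_eq_zero, add_comm]; exact hanti
    have e1 : inner ℝ (c q - c p) (N q - N p) = -4 := by
      have : inner ℝ (c q - c p) (N q - N p) = 2 * inner ℝ (c q) (N q) + 2 * inner ℝ (c p) (N p) := by
        rw [inner_sub_right]
        nth_rewrite 1 [show c q - c p = (2:ℝ) • c q by rw [two_smul, hq]; abel]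
        rw [show c q - c p = (-2:ℝ) • c p by rw [hq]; module, inner_smul_left, inner_smul_left]
        simp
      rw [this, h.inner_second, h.inner_second]; norm_num
    have e2 : ‖T p + T q‖ ^ 2 ≤ 0 := by
      have e3 := norm_sub_sq_real (T q) (T p)
      have e4 := norm_add_sq_real (T p) (T q)
      rw [real_inner_comm] at e3
      rw [h.norm_deriv, h.norm_deriv] at e3 e4
      linarith
    have e5 : T p + T q = 0 := by
      have : ‖T p + T q‖ = 0 := by nlinarith [norm_nonneg (T p + T q)]
      exact norm_eq_zero.1 this
    have e6 : k = 0 := by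
      rw [show c q - c p = (-2:ℝ) • c p by rw [hq]; module, inner_smul_left, h.inner_deriv] at hTp
      have : k * d = 0 := by rw [← hTp]; simp
      exact (mul_eq_zero.1 this).resolve_right hd0.ne'
    rw [e5, e6]; simp
  set ρ := ‖c p + c q‖ with hρ
  have hρ0 : 0 < ρ := norm_pos_iff.2 hanti
  have hpar : ρ ^ 2 + d ^ 2 = 4 := by
    have e3 := norm_sub_sq_real (c q) (c p)
    have e4 := norm_add_sq_real (c p) (c q)
    rw [real_inner_comm] at e3
    rw [h.norm_eq_one, h.norm_eq_one] at e3 e4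
    linarith
  have hip : inner ℝ (c p) (c q) = ρ ^ 2 / 2 - 1 := by
    have e4 := norm_add_sq_real (c p) (c q)
    rw [h.norm_eq_one, h.norm_eq_one] at e4
    linarith
  have hip' : inner ℝ (c q) (c p) = ρ ^ 2 / 2 - 1 := by rw [real_inner_comm, hip]
  obtain ⟨b, hb0, hb1⟩ := exists_orthonormalBasis_pair
    (e₁ := (1 / ρ) • (c p + c q)) (e₂ := (1 / d) • (c q - c p))
    (by rw [norm_smul, ← hρ]; simp [abs_of_pos hρ0, hρ0.ne'])
    (by rw [norm_smul, ← hd]; simp [abs_of_pos hd0, hd0.ne'])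
    (by rw [inner_smul_left, inner_smul_right, inner_add_left, inner_sub_right, inner_sub_right,
          hcc, hcc, hip, hip']; ring)
  have hsum : ∀ x : EuclideanSpace ℝ (Fin 3),
      inner ℝ (b 0) x ^ 2 + inner ℝ (b 1) x ^ 2 + inner ℝ (b 2) x ^ 2 = ‖x‖ ^ 2 := by
    intro x
    have := b.sum_sq_norm_inner_right x
    simpa [Fin.sum_univ_three] using this
  have hext : ∀ x y : EuclideanSpace ℝ (Fin 3), inner ℝ (b 0) x = inner ℝ (b 0) y →
      inner ℝ (b 1) x = inner ℝ (b 1) y → inner ℝ (b 2) x = inner ℝ (b 2) y → x = y := by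
    intro x y e0 e1 e2
    have := hsum (x - y)
    rw [inner_sub_right, inner_sub_right, inner_sub_right, e0, e1, e2, sub_self, sub_self,
      sub_self] at this
    have : ‖x - y‖ = 0 := by nlinarith [norm_nonneg (x - y)]
    exact sub_eq_zero.1 (norm_eq_zero.1 this)
  have hs0 : 0 < d / 2 := by positivity
  have hg0 : 0 < ρ / 2 := by positivity
  have hgs : (ρ / 2) ^ 2 + (d / 2) ^ 2 = 1 := by linarith
  have d2 : d ^ 2 = 4 - ρ ^ 2 := by linarith
  have p0 : inner ℝ (b 0) (c p) = ρ / 2 := by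
    rw [hb0, inner_smul_left, inner_add_left, hcc, hip']; simp; field_simp
  have q0 : inner ℝ (b 0) (c q) = ρ / 2 := by
    rw [hb0, inner_smul_left, inner_add_left, hcc, hip]; simp; field_simp
  have p1 : inner ℝ (b 1) (c p) = -(d / 2) := by
    rw [hb1, inner_smul_left, inner_sub_left, hcc, hip']; simp; field_simp; linarith
  have q1 : inner ℝ (b 1) (c q) = d / 2 := by
    rw [hb1, inner_smul_left, inner_sub_left, hcc, hip]; simp; field_simp; linarith
  have p2 : inner ℝ (b 2) (c p) = 0 := by
    have := hsum (c p)
    rw [p0, p1, h.norm_eq_one] at this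
    exact pow_eq_zero_iff two_ne_zero |>.1 (by linarith)
  have q2 : inner ℝ (b 2) (c q) = 0 := by
    have := hsum (c q)
    rw [q0, q1, h.norm_eq_one] at this
    exact pow_eq_zero_iff two_ne_zero |>.1 (by linarith)
  have Tp1 : inner ℝ (b 1) (T p) = k := by
    rw [hb1, inner_smul_left, hTp]; simp; field_simp
  have Tq1 : inner ℝ (b 1) (T q) = k := by
    rw [hb1, inner_smul_left, hTq]; simp; field_simp
  have hexp : ∀ x y : EuclideanSpace ℝ (Fin 3), inner ℝ x y = inner ℝ (b 0) x * inner ℝ (b 0) y +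
      inner ℝ (b 1) x * inner ℝ (b 1) y + inner ℝ (b 2) x * inner ℝ (b 2) y := by
    intro x y
    rw [← b.sum_inner_mul_inner x y, Fin.sum_univ_three]
    simp only [real_inner_comm]
  have Tp0 : inner ℝ (b 0) (T p) = k * d / ρ := by
    have := h.inner_deriv p
    rw [hexp, p0, p1, p2, Tp1] at this
    field_simp; linarith
  have Tq0 : inner ℝ (b 0) (T q) = -(k * d / ρ) := by
    have := h.inner_deriv q
    rw [hexp, q0, q1, q2, Tq1] at this
    field_simp; linarith
  have hsq : inner ℝ (b 2) (T p) ^ 2 = inner ℝ (b 2) (T q) ^ 2 := by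
    have e1 := hsum (T p)
    have e2 := hsum (T q)
    rw [Tp0, Tp1, h.norm_deriv] at e1
    rw [Tq0, Tq1, h.norm_deriv] at e2
    linarith
  have hopp : inner ℝ (b 2) (T p) + inner ℝ (b 2) (T q) = 0 := by
    rcases sq_eq_sq_iff_eq_or_eq_neg.1 hsq with hs | hs
    · by_contra hne0
      have hA : 0 < inner ℝ (b 2) (T p) * inner ℝ (b 2) (T q) := by
        rw [hs]
        have : inner ℝ (b 2) (T q) ≠ 0 := by
          intro h0; rw [hs, h0] at hne0; simp at hne0
        exact mul_self_pos.2 this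
      have hder : ∀ i r, HasDerivAt (fun r => inner ℝ (b i) (c r)) (inner ℝ (b i) (T r)) r := by
        intro i r
        have := (hasDerivAt_const r (b i)).inner ℝ (h.hasDerivAt r)
        rwa [inner_zero_left, add_zero] at this
      have hTc : Continuous T := continuous_iff_continuousAt.2 fun r => (h.hasDerivAt_deriv r).continuousAt
      obtain ⟨r, hr1, hr2, hrq, hr3, hr0⟩ := exists_mem_minorArc (hder 0) (hder 1) (hder 2)
        (by fun_prop) (by fun_prop) (by fun_prop) hL (by simp [h.periodic]) (by simp [h.periodic])
        (by simp [h.periodic]) (by simp [hsum, h.norm_eq_one])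
        (by
          rintro r ⟨e0, e1, e2⟩
          have := hsum (T r)
          rw [e0, e1, e2, h.norm_deriv] at this
          norm_num at this)
        (by
          intro x y hxy hyx e0 e1 e2
          exact h.ne_of_lt x y hxy hyx (hext _ _ e0 e1 e2))
        hpq (by linarith) p2 p0 p1 q2 q0 q1 hg0 hs0 hA
      have hr := hsum (c r)
      rw [hr3, h.norm_eq_one] at hr
      refine h.not_mem_minorArc hB hm hle hpq hqp heq hr1 hr2 hrq
        (arcsin_half_chord_add hg0 hs0 hgs (by linarith) hr0 (norm_nonneg _) (norm_nonneg _)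
          (x := inner ℝ (b 0) (c r)) (y := inner ℝ (b 1) (c r)) ?_ ?_)
      · rw [norm_sub_sq_real, h.norm_eq_one, h.norm_eq_one, hexp, hr3, p0, p1]; ring
      · rw [norm_sub_sq_real, h.norm_eq_one, h.norm_eq_one, hexp, hr3, q0, q1]; ring
    · rw [hs]; ring
  have w0 : inner ℝ (b 0) (c q - c p) = 0 := by rw [inner_sub_right, p0, q0, sub_self]
  have w1 : inner ℝ (b 1) (c q - c p) = d := by rw [inner_sub_right, p1, q1]; ring
  have w2 : inner ℝ (b 2) (c q - c p) = 0 := by rw [inner_sub_right, p2, q2, sub_self]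
  refine hext _ _ ?_ ?_ ?_
  · rw [inner_add_right, inner_smul_right, Tp0, Tq0, w0]; ring
  · rw [inner_add_right, inner_smul_right, Tp1, Tq1, w1]; field_simp; ring
  · rw [inner_add_right, inner_smul_right, w2, hopp, mul_zero]

end IsUnitSpeedLoop

theorem neg_of_hasDerivAt_neg {f f' : ℝ → ℝ} {δ : ℝ} (hf : ∀ s, HasDerivAt f (f' s) s)
    (h0 : f 0 = 0) (hneg : ∀ s ∈ Set.Ioo 0 δ, f' s < 0) : ∀ s ∈ Set.Ioo 0 δ, f s < 0 := by
  intro s hs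
  have h1 : StrictAntiOn f (Set.Icc 0 s) := by
    refine strictAntiOn_of_deriv_neg (convex_Icc 0 s)
      (fun x _ => (hf x).continuousAt.continuousWithinAt) fun x hx => ?_
    rw [interior_Icc] at hx
    rw [(hf x).deriv]
    exact hneg x ⟨hx.1, hx.2.trans hs.2⟩
  have := h1 (Set.left_mem_Icc.2 hs.1.le) (Set.right_mem_Icc.2 hs.1.le) hs.1
  rwa [h0] at this

theorem sub_mul_pow_le_modelChord {B L s : ℝ} (hB : 0 < B) (hL : 0 < L) (hs : 0 ≤ s)
    (hs2 : s ≤ L / 2) : s - (π / L) ^ 2 * (1 / 2 + B ^ 2) / 3 * s ^ 3 ≤ modelChord B L s := by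
  have hpi := pi_pos
  have key : MonotoneOn
      (fun s => modelChord B L s - (s - (π / L) ^ 2 * (1 / 2 + B ^ 2) / 3 * s ^ 3))
      (Set.Icc 0 (L / 2)) := by
    have hd : ∀ x, HasDerivAt
        (fun s => modelChord B L s - (s - (π / L) ^ 2 * (1 / 2 + B ^ 2) / 3 * s ^ 3))
        (cos (π * x / L) / (1 + (B * sin (π * x / L)) ^ 2) -
          (1 - (π / L) ^ 2 * (1 / 2 + B ^ 2) * x ^ 2)) x := by
      intro x
      refine ((hasDerivAt_modelChord hB hL x).sub ((hasDerivAt_id x).sub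
        ((hasDerivAt_pow 3 x).const_mul _))).congr_deriv ?_
      norm_num
      ring
    refine monotoneOn_of_deriv_nonneg (convex_Icc _ _)
      (fun x _ => (hd x).continuousAt.continuousWithinAt)
      (fun x _ => (hd x).differentiableAt.differentiableWithinAt) fun x hx => ?_
    rw [interior_Icc] at hx
    rw [(hd x).deriv, sub_nonneg, le_div_iff₀ (by positivity)]
    set z := π * x / L with hz
    have hx0 := hx.1
    have hz0 : 0 ≤ z := by positivity
    have hz1 : z ≤ π / 2 := by rw [hz, div_le_iff₀ hL]; nlinarith [hx.2]
    have e : (π / L) ^ 2 * (1 / 2 + B ^ 2) * x ^ 2 = (1 / 2 + B ^ 2) * z ^ 2 := by rw [hz]; ring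
    rw [e]
    have hcos := one_sub_sq_div_two_le_cos (x := z)
    have hcos0 : 0 ≤ cos z := cos_nonneg_of_neg_pi_div_two_le_of_le (by linarith) hz1
    have hsin : sin z ^ 2 ≤ z ^ 2 :=
      pow_le_pow_left₀ (sin_nonneg_of_nonneg_of_le_pi hz0 (by linarith)) (sin_le hz0) 2
    rcases le_or_gt 0 (1 - (1 / 2 + B ^ 2) * z ^ 2) with h1 | h1
    · calc _ ≤ (1 - (1 / 2 + B ^ 2) * z ^ 2) * (1 + B ^ 2 * z ^ 2) := by
            rw [mul_pow]; gcongr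
        _ ≤ 1 - z ^ 2 / 2 := by
            have : 0 ≤ (1 / 2 + B ^ 2) * z ^ 2 * (B ^ 2 * z ^ 2) := by positivity
            linarith
        _ ≤ _ := hcos
    · have : 0 ≤ 1 + (B * sin z) ^ 2 := by positivity
      nlinarith
  have := key (Set.left_mem_Icc.2 (by linarith)) (Set.mem_Icc.2 ⟨hs, hs2⟩) hs
  simp [modelChord] at this
  simp only [modelChord]
  linarith

namespace IsUnitSpeedLoop

variable {c T N : ℝ → EuclideanSpace ℝ (Fin 3)} {L : ℝ}

theorem inner_deriv_second (h : IsUnitSpeedLoop c T N L) (r : ℝ) : inner ℝ (T r) (N r) = 0 := by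
  have h1 := (h.hasDerivAt_deriv r).inner ℝ (h.hasDerivAt_deriv r)
  have h2 : HasDerivAt (fun r => inner ℝ (T r) (T r)) 0 r := by
    have : (fun r => inner ℝ (T r) (T r)) = fun _ : ℝ => (1:ℝ) := by
      funext r; rw [real_inner_self_eq_norm_sq, h.norm_deriv, one_pow]
    rw [this]; exact hasDerivAt_const _ _
  have h3 := h1.unique h2
  rw [real_inner_comm (T r) (N r)] at h3
  linarith

/-- At a contact point of the chord-arc comparison, the time derivative of the difference is
nonnegative, up to the evolution of the perturbation factor. -/
theorem chordArc_nonneg (h : IsUnitSpeedLoop c T N L) {B m p q : ℝ} (hB : 0 < B) (hm : 1 ≤ m)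
    (hle : ∀ p q, p ≤ q → q ≤ p + L → modelChord B L (q - p) ≤ m * ‖c q - c p‖)
    (hpq : p < q) (hqp : q - p ≤ L / 2) (heq : m * ‖c q - c p‖ = modelChord B L (q - p)) :
    0 ≤ m * (inner ℝ (c q - c p) (N q - N p) / ‖c q - c p‖) +
        (arctan (B * sin (π * (q - p) / L)) / (π * B) -
          (q - p) / L * (cos (π * (q - p) / L) / (1 + (B * sin (π * (q - p) / L)) ^ 2))) *
            (∫ r in p..(p + L), ‖N r‖ ^ 2) +
        cos (π * (q - p) / L) / (1 + (B * sin (π * (q - p) / L)) ^ 2) *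
          (∫ r in p..q, ‖N r‖ ^ 2) -
        4 * π / L * (arctan (B * sin (π * (q - p) / L)) / B -
          sin (π * (q - p) / L) / (1 + (B * sin (π * (q - p) / L)) ^ 2)) := by
  have hL := h.length_pos
  have hpi := pi_pos
  have hm0 : 0 < m := by linarith
  have hne : c p ≠ c q := h.ne_of_lt p q hpq (by linarith)
  have hvar := h.variation hB hle hpq (by linarith) heq rfl rfl
  set d := ‖c q - c p‖ with hd
  have hd0 : 0 < d := norm_pos_iff.2 (sub_ne_zero.2 hne.symm)
  set h₁ := cos (π * (q - p) / L) / (1 + (B * sin (π * (q - p) / L)) ^ 2) with hh₁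
  set h₂ := -(π / L) * (sin (π * (q - p) / L) / (1 + (B * sin (π * (q - p) / L)) ^ 2) +
        2 * B ^ 2 * sin (π * (q - p) / L) * cos (π * (q - p) / L) ^ 2 /
          (1 + (B * sin (π * (q - p) / L)) ^ 2) ^ 2) with hh₂
  rw [← heq] at hvar
  have hTq : inner ℝ (c q - c p) (T q) = h₁ / m * d := by
    have := (hvar 0 1).1
    simp only [one_smul, zero_smul, sub_zero, mul_one] at this
    field_simp
    have e : m * (m * inner ℝ (c q - c p) (T q)) = m * (h₁ * d) := by linarith
    linarith [mul_left_cancel₀ hm0.ne' e]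
  have hTp : inner ℝ (c q - c p) (T p) = h₁ / m * d := by
    have := (hvar 1 0).1
    simp only [one_smul, zero_smul, zero_sub, inner_neg_right] at this
    field_simp
    have e : m * (m * inner ℝ (c q - c p) (T p)) = m * (h₁ * d) := by linarith
    linarith [mul_left_cancel₀ hm0.ne' e]
  have hpar := h.deriv_add_deriv_eq_smul hB hm0 hle hpq hqp heq hTp hTq (by
    have := (hvar 1 1).2
    simp only [one_smul, one_pow, sub_self] at this
    have e : 0 < m ^ 2 := by positivity
    by_contra hlt
    push Not at hlt
    nlinarith)
  have hnorm : ‖T p + T q‖ ^ 2 = 4 * (h₁ / m) ^ 2 := by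
    rw [hpar, norm_smul, ← hd, mul_pow, norm_eq_abs, sq_abs]; field_simp; ring
  have hR : 4 * h₂ ≤ m * (inner ℝ (c q - c p) (N q - N p) / d) := by
    have := (hvar (-1) 1).2
    simp only [one_smul, one_pow, neg_smul, sub_neg_eq_add, even_two, Even.neg_pow] at this
    rw [add_comm (T q), hnorm] at this
    have e : m ^ 2 * (4 * (h₁ / m) ^ 2) = 4 * h₁ ^ 2 := by field_simp
    rw [mul_add, e] at this
    have e2 : m * (inner ℝ (c q - c p) (N q - N p) / d) =
        (m ^ 2 * inner ℝ (c q - c p) (N q - N p)) / (m * d) := by field_simp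
    rw [e2, le_div_iff₀ (by positivity)]
    linarith
  have hz1 : π * (q - p) / L ≤ π / 2 := by rw [div_le_iff₀ hL]; nlinarith
  have hz0 : 0 < π * (q - p) / L := div_pos (mul_pos hpi (by linarith)) hL
  have hh0 : 0 ≤ h₁ := div_nonneg (cos_nonneg_of_neg_pi_div_two_le_of_le (by linarith) hz1)
    (by positivity)
  have hinner : inner ℝ (T p) (T q) = 2 * (h₁ / m) ^ 2 - 1 := by
    have := norm_add_sq_real (T p) (T q)
    rw [hnorm, h.norm_deriv, h.norm_deriv] at this
    linarith
  have hk0 : 0 ≤ h₁ / m := by positivity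
  have hk1 : h₁ / m ≤ 1 := by
    have := real_inner_le_norm (T p) (T q)
    rw [hinner, h.norm_deriv, h.norm_deriv] at this
    nlinarith
  have hcb : cos (arccos (h₁ / m)) = h₁ / m := cos_arccos (by linarith) hk1
  have hb1 : arccos (h₁ / m) ≤ π / 2 := arccos_le_pi_div_two.2 hk0
  have hb0 := arccos_nonneg (h₁ / m)
  have hNc := h.continuous_second.norm
  have hTc : Continuous T := continuous_iff_continuousAt.2 fun r => (h.hasDerivAt_deriv r).continuousAt
  refine chordArc_evolution_nonneg (m := m) (b := arccos (h₁ / m)) hB hL hm (by linarith) hqp hb0 hb1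
    (by rw [hcb]; exact (mul_div_cancel₀ h₁ hm0.ne').trans hh₁) ?_ ?_ hR
  · have := sq_le_mul_integral_sq hNc (u := p) (v := p + L) (A := 2 * π) (by linarith) (by linarith)
      (two_pi_le_integral_norm h.hasDerivAt_deriv h.continuous_second h.norm_deriv hL
        (h.periodic_deriv p) fun w => ?_)
    · refine le_trans (le_of_eq ?_) this
      rw [add_sub_cancel_left]; ring
    · rw [intervalIntegral.integral_eq_sub_of_hasDerivAt (f := fun r => inner ℝ w (c r))
        (fun r _ => by simpa using (hasDerivAt_const r w).inner ℝ (h.hasDerivAt r))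
        (Continuous.intervalIntegrable (by fun_prop) _ _), h.periodic, sub_self]
  · have := sq_le_mul_integral_sq hNc (u := p) (v := q) (A := 2 * arccos (h₁ / m)) hpq
      (by linarith) ?_
    · refine le_trans (le_of_eq ?_) this
      ring
    · by_contra hlt
      push Not at hlt
      have e1 := cos_integral_le_inner h.hasDerivAt_deriv h.continuous_second h.norm_deriv hpq.le
        (by linarith)
      have e2 := cos_lt_cos_of_nonneg_of_le_pi
        (intervalIntegral.integral_nonneg hpq.le fun r _ => norm_nonneg (N r)) (by linarith) hlt
      rw [cos_two_mul, hcb] at e2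
      linarith

/-- If no chord is shorter than the model chord, then the curvature is bounded pointwise. -/
theorem norm_second_sq_le (h : IsUnitSpeedLoop c T N L) {N₁ N₂ : ℝ → EuclideanSpace ℝ (Fin 3)}
    (hN₁ : ∀ r, HasDerivAt N (N₁ r) r) (hN₂ : ∀ r, HasDerivAt N₁ (N₂ r) r) (hN₂c : Continuous N₂)
    {B : ℝ} (hB : 0 < B)
    (hle : ∀ p q, p ≤ q → q ≤ p + L → modelChord B L (q - p) ≤ ‖c q - c p‖) (p : ℝ) :
    ‖N p‖ ^ 2 ≤ (2 * π / L) ^ 2 * (1 + 2 * B ^ 2) := by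
  have hL := h.length_pos
  have hpi := pi_pos
  set c₀ : ℝ := (π / L) ^ 2 * (1 / 2 + B ^ 2) / 3 with hc₀
  have hc₀0 : 0 < c₀ := by positivity
  have hbound : ∀ s, 0 ≤ s → s ≤ L / 2 → s ^ 2 - 2 * c₀ * s ^ 4 ≤ ‖c (p + s) - c p‖ ^ 2 := by
    intro s hs hs2
    have h1 := sub_mul_pow_le_modelChord hB hL hs hs2
    rw [← hc₀] at h1
    have h2 := hle p (p + s) (by linarith) (by linarith)
    rw [add_sub_cancel_left] at h2
    have h3 : s - c₀ * s ^ 3 ≤ ‖c (p + s) - c p‖ := h1.trans h2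
    rcases le_or_gt 0 (s - c₀ * s ^ 3) with h4 | h4
    · have := pow_le_pow_left₀ h4 h3 2
      nlinarith [sq_nonneg (c₀ * s ^ 3)]
    · nlinarith [sq_nonneg (‖c (p + s) - c p‖), mul_nonneg hs (neg_nonneg.2 h4.le),
        mul_nonneg hc₀0.le (pow_nonneg hs 4)]
  have hTN : ∀ r, inner ℝ (T r) (N r) = 0 := h.inner_deriv_second
  have hNN : ∀ r, inner ℝ (T r) (N₁ r) = -‖N r‖ ^ 2 := by
    intro r
    have h1 := (h.hasDerivAt_deriv r).inner ℝ (hN₁ r)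
    rw [funext hTN, real_inner_self_eq_norm_sq] at h1
    have := h1.unique (hasDerivAt_const _ _)
    linarith
  have sh : ∀ {f f' : ℝ → EuclideanSpace ℝ (Fin 3)}, (∀ r, HasDerivAt f (f' r) r) →
      ∀ s, HasDerivAt (fun s => f (p + s)) (f' (p + s)) s :=
    fun hf s => (hf (p + s)).comp_const_add p s
  have dc := sh h.hasDerivAt
  have dT := sh h.hasDerivAt_deriv
  have dN := sh hN₁
  have dN₁ := sh hN₂
  set Δ : ℝ → EuclideanSpace ℝ (Fin 3) := fun s => c (p + s) - c p with hΔ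
  have dΔ : ∀ s, HasDerivAt Δ (T (p + s)) s := fun s => (dc s).sub_const _
  set Φ₀ : ℝ → ℝ := fun s => inner ℝ (Δ s) (Δ s) - s ^ 2 + 2 * c₀ * s ^ 4 with hΦ₀
  set Φ₁ : ℝ → ℝ := fun s => 2 * inner ℝ (T (p + s)) (Δ s) - 2 * s + 8 * c₀ * s ^ 3 with hΦ₁
  set Φ₂ : ℝ → ℝ := fun s => 2 * inner ℝ (N (p + s)) (Δ s) + 24 * c₀ * s ^ 2 with hΦ₂
  set Φ₃ : ℝ → ℝ := fun s => 2 * inner ℝ (N₁ (p + s)) (Δ s) + 48 * c₀ * s with hΦ₃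
  set Φ₄ : ℝ → ℝ := fun s => 2 * (inner ℝ (N₂ (p + s)) (Δ s) - ‖N (p + s)‖ ^ 2) + 48 * c₀ with hΦ₄
  have d₀ : ∀ s, HasDerivAt Φ₀ (Φ₁ s) s := by
    intro s
    refine ((((dΔ s).inner ℝ (dΔ s)).sub (hasDerivAt_pow 2 s)).add
      ((hasDerivAt_pow 4 s).const_mul (2 * c₀))).congr_deriv ?_
    rw [real_inner_comm (Δ s)]
    simp only [hΦ₁]
    norm_num
    rw [real_inner_comm (Δ s)]
    ring
  have d₁ : ∀ s, HasDerivAt Φ₁ (Φ₂ s) s := by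
    intro s
    refine (((((dT s).inner ℝ (dΔ s)).const_mul 2).sub ((hasDerivAt_id s).const_mul 2)).add
      ((hasDerivAt_pow 3 s).const_mul (8 * c₀))).congr_deriv ?_
    rw [real_inner_self_eq_norm_sq, h.norm_deriv]
    simp only [hΦ₂]
    norm_num
    ring
  have d₂ : ∀ s, HasDerivAt Φ₂ (Φ₃ s) s := by
    intro s
    refine ((((dN s).inner ℝ (dΔ s)).const_mul 2).add
      ((hasDerivAt_pow 2 s).const_mul (24 * c₀))).congr_deriv ?_
    rw [real_inner_comm, hTN]
    simp only [hΦ₃]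
    norm_num
    ring
  have d₃ : ∀ s, HasDerivAt Φ₃ (Φ₄ s) s := by
    intro s
    refine ((((dN₁ s).inner ℝ (dΔ s)).const_mul 2).add
      ((hasDerivAt_id s).const_mul (48 * c₀))).congr_deriv ?_
    rw [real_inner_comm, hNN]
    simp only [hΦ₄]
    norm_num
    ring
  have hΔ0 : Δ 0 = 0 := by simp [hΔ]
  by_contra hlt
  push Not at hlt
  have e4 : Φ₄ 0 < 0 := by
    simp only [hΦ₄, hΔ0, inner_zero_right, add_zero]
    have : 24 * c₀ = (2 * π / L) ^ 2 * (1 + 2 * B ^ 2) := by rw [hc₀]; field_simp; ring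
    linarith
  have hΔc : Continuous Δ := continuous_iff_continuousAt.2 fun s => (dΔ s).continuousAt
  have hNc := h.continuous_second
  have c4 : Continuous Φ₄ := by fun_prop
  obtain ⟨δ, hδ, hδ4⟩ := Metric.eventually_nhds_iff.1 (c4.continuousAt.eventually_lt_const e4)
  have n4 : ∀ s ∈ Set.Ioo 0 δ, Φ₄ s < 0 := fun s hs =>
    hδ4 (by rw [dist_zero_right, norm_of_nonneg hs.1.le]; exact hs.2)
  have n3 := neg_of_hasDerivAt_neg d₃ (by simp [hΦ₃, hΔ0]) n4
  have n2 := neg_of_hasDerivAt_neg d₂ (by simp [hΦ₂, hΔ0]) n3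
  have n1 := neg_of_hasDerivAt_neg d₁ (by simp [hΦ₁, hΔ0]) n2
  have n0 := neg_of_hasDerivAt_neg d₀ (by simp [hΦ₀, hΔ0]) n1
  have hm0 : 0 < min δ L / 2 := by positivity
  have := n0 (min δ L / 2) ⟨hm0, by linarith [min_le_left δ L]⟩
  have h5 := hbound (min δ L / 2) hm0.le (by linarith [min_le_right δ L])
  simp only [hΦ₀, real_inner_self_eq_norm_sq, hΔ] at this
  linarith

end IsUnitSpeedLoop

section Smoothness

variable {E : Type*} [NormedAddCommGroup E] [NormedSpace ℝ E] {f : ℝ → ℝ → E}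

theorem differentiableAt_fst_of_contDiffOn {D : Set ℝ}
    (hf : ContDiffOn ℝ (⊤ : ℕ∞) (fun p : ℝ × ℝ => f p.1 p.2) (Set.univ ×ˢ D))
    {t : ℝ} (ht : t ∈ D) (u : ℝ) :
    HasDerivAt (fun v => f v t)
      (fderivWithin ℝ (fun p : ℝ × ℝ => f p.1 p.2) (Set.univ ×ˢ D) (u, t) (1, 0)) u := by
  have h1 := ((hf.differentiableOn (by simp)) (u, t) ⟨Set.mem_univ _, ht⟩).hasFDerivWithinAt
  have h2 : HasDerivAt (fun v : ℝ => (v, t)) ((1 : ℝ), (0 : ℝ)) u :=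
    (hasDerivAt_id u).prodMk (hasDerivAt_const u t)
  exact h1.comp_hasDerivAt (f := fun v : ℝ => (v, t)) u h2
    (Filter.Eventually.of_forall fun v => ⟨Set.mem_univ _, ht⟩)

theorem hasDerivAt_fst_of_contDiffOn {D : Set ℝ}
    (hf : ContDiffOn ℝ (⊤ : ℕ∞) (fun p : ℝ × ℝ => f p.1 p.2) (Set.univ ×ˢ D))
    {t : ℝ} (ht : t ∈ D) (u : ℝ) :
    HasDerivAt (fun v => f v t) (deriv (fun v => f v t) u) u :=
  (differentiableAt_fst_of_contDiffOn hf ht u).differentiableAt.hasDerivAt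

theorem contDiffOn_deriv_fst {D : Set ℝ} (hD : UniqueDiffOn ℝ D)
    (hf : ContDiffOn ℝ (⊤ : ℕ∞) (fun p : ℝ × ℝ => f p.1 p.2) (Set.univ ×ˢ D)) :
    ContDiffOn ℝ (⊤ : ℕ∞) (fun p : ℝ × ℝ => deriv (fun v => f v p.2) p.1) (Set.univ ×ˢ D) := by
  have h1 := hf.fderivWithin (m := ((⊤ : ℕ∞) : WithTop ℕ∞)) (uniqueDiffOn_univ.prod hD) (by simp)
  refine (h1.clm_apply (contDiffOn_const (c := ((1 : ℝ), (0 : ℝ))))).congr fun p hp => ?_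
  exact (differentiableAt_fst_of_contDiffOn hf hp.2 p.1).deriv

/-- Mixed partial derivatives commute. -/
theorem hasDerivAt_deriv_fst {D : Set ℝ} {g : ℝ → ℝ → E}
    (hf : ContDiffOn ℝ (⊤ : ℕ∞) (fun p : ℝ × ℝ => f p.1 p.2) (Set.univ ×ˢ D)) {t : ℝ}
    (ht : D ∈ nhds t) (hg : ∀ u, ∀ᶠ s in nhds t, HasDerivAt (fun s => f u s) (g u s) s) (u : ℝ) :
    HasDerivAt (fun s => deriv (fun v => f v s) u) (deriv (fun v => g v t) u) t := by
  set G : ℝ × ℝ → E := fun p => f p.1 p.2 with hG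
  have hat : ∀ s, D ∈ nhds s → ∀ v, ContDiffAt ℝ (⊤ : ℕ∞) G (v, s) := fun s hs v =>
    hf.contDiffAt (prod_mem_nhds Filter.univ_mem hs)
  have hev : ∀ᶠ s in nhds t, D ∈ nhds s := eventually_mem_nhds_iff.2 ht
  have e1 : ∀ s, D ∈ nhds s → ∀ v, HasDerivAt (fun v => f v s) (fderiv ℝ G (v, s) (1, 0)) v := by
    intro s hs v
    have h2 : HasDerivAt (fun v : ℝ => (v, s)) ((1 : ℝ), (0 : ℝ)) v :=
      (hasDerivAt_id v).prodMk (hasDerivAt_const v s)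
    exact ((hat s hs v).differentiableAt (by simp)).hasFDerivAt.comp_hasDerivAt v h2
  have e2 : ∀ v, HasDerivAt (fun s => f v s) (fderiv ℝ G (v, t) (0, 1)) t := by
    intro v
    have h2 : HasDerivAt (fun s : ℝ => (v, s)) ((0 : ℝ), (1 : ℝ)) t :=
      (hasDerivAt_const t v).prodMk (hasDerivAt_id t)
    exact ((hat t ht v).differentiableAt (by simp)).hasFDerivAt.comp_hasDerivAt t h2
  have hfd : HasFDerivAt (fderiv ℝ G) (fderiv ℝ (fderiv ℝ G) (u, t)) (u, t) :=
    (((hat t ht u).fderiv_right (m := 1) (by norm_cast)).differentiableAt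
      (by simp)).hasFDerivAt
  have hsymm := (hat t ht u).isSymmSndFDerivAt (by
    rw [minSmoothness_of_isRCLikeNormedField]
    exact WithTop.coe_le_coe.2 (le_top : (2 : ℕ∞) ≤ ⊤))
  have eg : (fun v => g v t) = fun v => fderiv ℝ G (v, t) (0, 1) :=
    funext fun v => (hg v).self_of_nhds.unique (e2 v)
  have d1 : HasDerivAt (fun v => fderiv ℝ G (v, t) (0, 1))
      (fderiv ℝ (fderiv ℝ G) (u, t) (1, 0) (0, 1)) u := by
    have h2 : HasDerivAt (fun v : ℝ => (v, t)) ((1 : ℝ), (0 : ℝ)) u :=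
      (hasDerivAt_id u).prodMk (hasDerivAt_const u t)
    exact (ContinuousLinearMap.apply ℝ E ((0 : ℝ), (1 : ℝ))).hasFDerivAt.comp_hasDerivAt u
      (hfd.comp_hasDerivAt u h2)
  have d2 : HasDerivAt (fun s => fderiv ℝ G (u, s) (1, 0))
      (fderiv ℝ (fderiv ℝ G) (u, t) (0, 1) (1, 0)) t := by
    have h2 : HasDerivAt (fun s : ℝ => (u, s)) ((0 : ℝ), (1 : ℝ)) t :=
      (hasDerivAt_const t u).prodMk (hasDerivAt_id t)
    exact (ContinuousLinearMap.apply ℝ E ((1 : ℝ), (0 : ℝ))).hasFDerivAt.comp_hasDerivAt t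
      (hfd.comp_hasDerivAt t h2)
  rw [eg, d1.deriv, hsymm (1, 0) (0, 1)]
  refine d2.congr_of_eventuallyEq ?_
  filter_upwards [hev] with s hs using (e1 s hs u).deriv

end Smoothness

namespace SphereCSF

variable {T : ℝ} (F : SphereCSF (Set.Ico 0 T))

/-- The unit tangent vector `∂_s γ`. -/
def tangent : ℝ → ℝ → EuclideanSpace ℝ (Fin 3) := pS F.γ F.γ

/-- The second arclength derivative `∂_s² γ`. -/
def second : ℝ → ℝ → EuclideanSpace ℝ (Fin 3) := pS F.γ F.tangent

theorem speed_pos {t : ℝ} (ht : t ∈ Set.Ico 0 T) (u : ℝ) : 0 < F.speed u t :=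
  norm_pos_iff.2 (F.regular t ht u)

theorem contDiffOn_speed : ContDiffOn ℝ (⊤ : ℕ∞) (fun p : ℝ × ℝ => F.speed p.1 p.2)
    (Set.univ ×ˢ Set.Ico 0 T) :=
  (contDiffOn_deriv_fst (uniqueDiffOn_Ico 0 T) F.smooth).norm ℝ fun p hp => F.regular p.2 hp.2 p.1

theorem contDiffOn_pS {f : ℝ → ℝ → EuclideanSpace ℝ (Fin 3)}
    (hf : ContDiffOn ℝ (⊤ : ℕ∞) (fun p : ℝ × ℝ => f p.1 p.2) (Set.univ ×ˢ Set.Ico 0 T)) :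
    ContDiffOn ℝ (⊤ : ℕ∞) (fun p : ℝ × ℝ => pS F.γ f p.1 p.2) (Set.univ ×ˢ Set.Ico 0 T) :=
  (F.contDiffOn_speed.inv fun p hp => (F.speed_pos hp.2 p.1).ne').smul
    (contDiffOn_deriv_fst (uniqueDiffOn_Ico 0 T) hf)

theorem contDiffOn_tangent : ContDiffOn ℝ (⊤ : ℕ∞) (fun p : ℝ × ℝ => F.tangent p.1 p.2)
    (Set.univ ×ˢ Set.Ico 0 T) := F.contDiffOn_pS F.smooth

theorem contDiffOn_second : ContDiffOn ℝ (⊤ : ℕ∞) (fun p : ℝ × ℝ => F.second p.1 p.2)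
    (Set.univ ×ˢ Set.Ico 0 T) := F.contDiffOn_pS F.contDiffOn_tangent

theorem hasDerivAt_pS {f : ℝ → ℝ → EuclideanSpace ℝ (Fin 3)}
    (hf : ContDiffOn ℝ (⊤ : ℕ∞) (fun p : ℝ × ℝ => f p.1 p.2) (Set.univ ×ˢ Set.Ico 0 T))
    {t : ℝ} (ht : t ∈ Set.Ico 0 T) (u : ℝ) :
    HasDerivAt (fun v => f v t) (F.speed u t • pS F.γ f u t) u := by
  refine (hasDerivAt_fst_of_contDiffOn hf ht u).congr_deriv ?_
  exact (smul_inv_smul₀ (F.speed_pos ht u).ne' _).symm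

theorem norm_tangent {t : ℝ} (ht : t ∈ Set.Ico 0 T) (u : ℝ) : ‖F.tangent u t‖ = 1 := by
  have := (F.speed_pos ht u).ne'
  unfold speed at this
  simp only [tangent, pS, norm_smul, norm_inv, norm_norm]
  exact inv_mul_cancel₀ this

theorem inner_tangent {t : ℝ} (ht : t ∈ Set.Ico 0 T) (u : ℝ) :
    inner ℝ (F.γ u t) (F.tangent u t) = 0 := by
  have h0 := F.hasDerivAt_pS F.smooth ht u
  have h1 := h0.inner ℝ h0
  simp only [real_inner_self_eq_norm_sq, F.spherical t ht, real_inner_comm (F.γ u t),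
    inner_smul_right] at h1
  have := h1.unique (hasDerivAt_const u _)
  have h2 := (F.speed_pos ht u).ne'
  have h3 : F.speed u t * inner ℝ (F.γ u t) (F.tangent u t) = 0 := by
    unfold tangent
    linarith
  exact (mul_eq_zero.1 h3).resolve_left h2

theorem inner_tangent_second {t : ℝ} (ht : t ∈ Set.Ico 0 T) (u : ℝ) :
    inner ℝ (F.tangent u t) (F.second u t) = 0 := by
  have h0 := F.hasDerivAt_pS F.contDiffOn_tangent ht u
  have h1 := h0.inner ℝ h0
  simp only [real_inner_self_eq_norm_sq, F.norm_tangent ht, real_inner_comm (F.tangent u t),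
    inner_smul_right] at h1
  have := h1.unique (hasDerivAt_const u _)
  have h2 := (F.speed_pos ht u).ne'
  have h3 : F.speed u t * inner ℝ (F.tangent u t) (F.second u t) = 0 := by
    unfold second
    linarith
  exact (mul_eq_zero.1 h3).resolve_left h2

theorem inner_second {t : ℝ} (ht : t ∈ Set.Ico 0 T) (u : ℝ) :
    inner ℝ (F.γ u t) (F.second u t) = -1 := by
  have h1 := (F.hasDerivAt_pS F.smooth ht u).inner ℝ (F.hasDerivAt_pS F.contDiffOn_tangent ht u)
  rw [funext (F.inner_tangent ht)] at h1
  have h2 := h1.unique (hasDerivAt_const u _)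
  change inner ℝ (F.γ u t) (F.speed u t • F.second u t) +
    inner ℝ (F.speed u t • F.tangent u t) (F.tangent u t) = 0 at h2
  rw [inner_smul_right, inner_smul_left, real_inner_self_eq_norm_sq, F.norm_tangent ht] at h2
  have h3 := F.speed_pos ht u
  have h4 : F.speed u t * (inner ℝ (F.γ u t) (F.second u t) + 1) = 0 := by
    simp at h2; linarith
  linarith [(mul_eq_zero.1 h4).resolve_left h3.ne']

theorem curvVec_eq (u t : ℝ) : curvVec F.γ u t = F.second u t + F.γ u t := rfl

theorem curvSq_add_one {t : ℝ} (ht : t ∈ Set.Ico 0 T) (u : ℝ) :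
    F.curvSq u t + 1 = ‖F.second u t‖ ^ 2 := by
  unfold curvSq
  rw [F.curvVec_eq, norm_add_sq_real, real_inner_comm, F.inner_second ht, F.spherical t ht]
  ring

theorem hasDerivAt_flow {t : ℝ} (ht : t ∈ Set.Ioo 0 T) (u : ℝ) :
    HasDerivAt (fun s => F.γ u s) (F.second u t + F.γ u t) t :=
  (F.flow t ⟨ht.1.le, ht.2⟩ u).hasDerivAt (Ico_mem_nhds ht.1 ht.2)

theorem hasDerivAt_speed {t : ℝ} (ht : t ∈ Set.Ioo 0 T) (u : ℝ) :
    HasDerivAt (fun s => F.speed u s) ((1 - ‖F.second u t‖ ^ 2) * F.speed u t) t := by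
  have ht' : t ∈ Set.Ico 0 T := ⟨ht.1.le, ht.2⟩
  have h1 := hasDerivAt_deriv_fst (g := fun u t => F.second u t + F.γ u t) F.smooth
    (Ico_mem_nhds ht.1 ht.2)
    (fun u => by filter_upwards [Ioo_mem_nhds ht.1 ht.2] with s hs using F.hasDerivAt_flow hs u) u
  have hd : HasDerivAt (fun v => F.second v t + F.γ v t)
      (deriv (fun v => F.second v t + F.γ v t) u) u :=
    ((hasDerivAt_fst_of_contDiffOn F.contDiffOn_second ht' u).add
      (hasDerivAt_fst_of_contDiffOn F.smooth ht' u)).differentiableAt.hasDerivAt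
  set W := deriv (fun v => F.second v t + F.γ v t) u with hW
  have h2 := h1.norm_sq.sqrt (by
    have := F.regular t ht' u
    positivity)
  have e : (fun s => √(‖deriv (fun v => F.γ v s) u‖ ^ 2)) = fun s => F.speed u s := by
    funext s; rw [sqrt_sq (norm_nonneg _)]; rfl
  rw [e] at h2
  refine h2.congr_deriv ?_
  rw [sqrt_sq (norm_nonneg _)]
  have h3 := (F.hasDerivAt_pS F.contDiffOn_tangent ht' u).inner ℝ hd
  have e3 : (fun v => inner ℝ (F.tangent v t) (F.second v t + F.γ v t)) = fun _ => (0 : ℝ) := by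
    funext v
    rw [inner_add_right, F.inner_tangent_second ht', real_inner_comm, F.inner_tangent ht', add_zero]
  rw [e3] at h3
  have h4 := h3.unique (hasDerivAt_const u _)
  change inner ℝ (F.tangent u t) W + inner ℝ (F.speed u t • F.second u t) _ = 0 at h4
  rw [inner_smul_left, inner_add_right, real_inner_self_eq_norm_sq,
    real_inner_comm (F.γ u t), F.inner_second ht'] at h4
  have h5 : inner ℝ (deriv (fun v => F.γ v t) u) W = F.speed u t * inner ℝ (F.tangent u t) W := by
    have : deriv (fun v => F.γ v t) u = F.speed u t • F.tangent u t :=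
      (smul_inv_smul₀ (F.speed_pos ht' u).ne' _).symm
    rw [this, inner_smul_left]
    rfl
  have h6 := F.speed_pos ht' u
  rw [h5]
  change 2 * _ / (2 * F.speed u t) = _
  simp at h4
  field_simp
  linarith

end SphereCSF

namespace SphereCSF

variable {T : ℝ} (F : SphereCSF (Set.Ico 0 T))

/-- The length of the arc of `Γ_t` from parameter `u` to parameter `v`. -/
def arc (t u v : ℝ) : ℝ := ∫ w in u..v, F.speed w t

/-- The inverse of the arclength function measured from parameter `0`. -/
def param (t : ℝ) : ℝ → ℝ := Function.invFun (F.arc t 0)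

section Slice

variable {F} {t : ℝ}

theorem continuous_slice {E : Type*} [NormedAddCommGroup E] [NormedSpace ℝ E] {f : ℝ → ℝ → E}
    (hf : ContDiffOn ℝ (⊤ : ℕ∞) (fun p : ℝ × ℝ => f p.1 p.2) (Set.univ ×ˢ Set.Ico 0 T))
    (ht : t ∈ Set.Ico 0 T) : Continuous fun u => f u t :=
  continuous_iff_continuousAt.2 fun u => (hasDerivAt_fst_of_contDiffOn hf ht u).continuousAt

theorem periodic_deriv_of_periodic {E : Type*} [NormedAddCommGroup E] [NormedSpace ℝ E]
    {f : ℝ → E} {P : ℝ} (hf : Function.Periodic f P) : Function.Periodic (deriv f) P := by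
  intro u
  rw [← deriv_comp_add_const, funext hf]

theorem periodic_speed (ht : t ∈ Set.Ico 0 T) :
    Function.Periodic (fun u => F.speed u t) (2 * π) := fun u => by
  simp only [speed]
  rw [periodic_deriv_of_periodic (F.periodic t ht)]

theorem periodic_pS (ht : t ∈ Set.Ico 0 T) {f : ℝ → ℝ → EuclideanSpace ℝ (Fin 3)}
    (hf : Function.Periodic (fun u => f u t) (2 * π)) :
    Function.Periodic (fun u => pS F.γ f u t) (2 * π) := fun u => by
  simp only [pS]
  rw [periodic_deriv_of_periodic (F.periodic t ht), periodic_deriv_of_periodic hf]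

theorem periodic_second (ht : t ∈ Set.Ico 0 T) :
    Function.Periodic (fun u => F.second u t) (2 * π) :=
  periodic_pS ht (periodic_pS ht (F.periodic t ht))

theorem continuous_speed (ht : t ∈ Set.Ico 0 T) : Continuous fun u => F.speed u t :=
  continuous_slice F.contDiffOn_speed ht

theorem arc_add (ht : t ∈ Set.Ico 0 T) (u v w : ℝ) :
    F.arc t u v + F.arc t v w = F.arc t u w :=
  intervalIntegral.integral_add_adjacent_intervals
    ((continuous_speed ht).intervalIntegrable _ _) ((continuous_speed ht).intervalIntegrable _ _)

theorem arc_period (ht : t ∈ Set.Ico 0 T) (u : ℝ) : F.arc t u (u + 2 * π) = F.length t := by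
  simpa [arc, length] using (periodic_speed ht).intervalIntegral_add_eq u 0

theorem arc_pos (ht : t ∈ Set.Ico 0 T) {u v : ℝ} (h : u < v) : 0 < F.arc t u v :=
  intervalIntegral.intervalIntegral_pos_of_pos
    ((continuous_speed ht).intervalIntegrable _ _) (F.speed_pos ht) h

theorem arc_nonneg (ht : t ∈ Set.Ico 0 T) {u v : ℝ} (h : u ≤ v) : 0 ≤ F.arc t u v :=
  intervalIntegral.integral_nonneg h fun w _ => (F.speed_pos ht w).le

theorem length_pos (ht : t ∈ Set.Ico 0 T) : 0 < F.length t := by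
  rw [← arc_period ht 0]
  exact arc_pos ht (by positivity)

theorem hasDerivAt_arc (ht : t ∈ Set.Ico 0 T) (u v : ℝ) :
    HasDerivAt (fun v => F.arc t u v) (F.speed v t) v :=
  intervalIntegral.integral_hasDerivAt_right ((continuous_speed ht).intervalIntegrable _ _)
    (continuous_speed ht).stronglyMeasurable.stronglyMeasurableAtFilter
    (continuous_speed ht).continuousAt

theorem strictMono_arc (ht : t ∈ Set.Ico 0 T) : StrictMono (F.arc t 0) := fun u v h => by
  have := arc_pos (F := F) ht h
  have := arc_add (F := F) ht 0 u v
  linarith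

theorem surjective_arc (ht : t ∈ Set.Ico 0 T) : Function.Surjective (F.arc t 0) := by
  have hL : 0 < ∫ w in (0 : ℝ)..2 * π, F.speed w t := length_pos ht
  exact (continuous_iff_continuousAt.2 fun v => (hasDerivAt_arc ht 0 v).continuousAt).surjective
    ((periodic_speed ht).tendsto_atTop_intervalIntegral_of_pos hL (by positivity))
    ((periodic_speed ht).tendsto_atBot_intervalIntegral_of_pos hL (by positivity))

theorem param_arc (ht : t ∈ Set.Ico 0 T) (u : ℝ) : F.param t (F.arc t 0 u) = u :=
  Function.leftInverse_invFun (strictMono_arc ht).injective u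

theorem arc_param (ht : t ∈ Set.Ico 0 T) (r : ℝ) : F.arc t 0 (F.param t r) = r :=
  Function.rightInverse_invFun (surjective_arc ht) r

theorem strictMono_param (ht : t ∈ Set.Ico 0 T) : StrictMono (F.param t) := fun x y hxy => by
  rwa [← (strictMono_arc (F := F) ht).lt_iff_lt, arc_param ht, arc_param ht]

theorem continuous_param (ht : t ∈ Set.Ico 0 T) : Continuous (F.param t) := by
  have h : F.param t =
      ((strictMono_arc (F := F) ht).orderIsoOfSurjective _ (surjective_arc ht)).symm := by
    funext r
    rw [OrderIso.eq_symm_apply]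
    exact arc_param ht r
  rw [h]
  exact OrderIso.continuous _

theorem hasDerivAt_param (ht : t ∈ Set.Ico 0 T) (r : ℝ) :
    HasDerivAt (F.param t) (F.speed (F.param t r) t)⁻¹ r :=
  HasDerivAt.of_local_left_inverse (continuous_param ht).continuousAt (hasDerivAt_arc ht 0 _)
    (F.speed_pos ht _).ne' (Filter.Eventually.of_forall (arc_param ht))

theorem hasDerivAt_comp_param (ht : t ∈ Set.Ico 0 T) {f : ℝ → ℝ → EuclideanSpace ℝ (Fin 3)}
    (hf : ContDiffOn ℝ (⊤ : ℕ∞) (fun p : ℝ × ℝ => f p.1 p.2) (Set.univ ×ˢ Set.Ico 0 T)) (r : ℝ) :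
    HasDerivAt (fun r => f (F.param t r) t) (pS F.γ f (F.param t r) t) r :=
  ((F.hasDerivAt_pS hf ht (F.param t r)).scomp r (hasDerivAt_param ht r)).congr_deriv
    (inv_smul_smul₀ (F.speed_pos ht _).ne' _)

theorem ne_of_lt_of_lt (ht : t ∈ Set.Ico 0 T) {u v : ℝ} (huv : u < v) (hvu : v < u + 2 * π) :
    F.γ u t ≠ F.γ v t := by
  intro h
  have hp : (0 : ℝ) < 2 * π := by positivity
  have hm : ∀ w, toIcoMod hp 0 w ∈ Set.Ico 0 (2 * π) := fun w => by
    simpa using toIcoMod_mem_Ico hp 0 w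
  have hγ : ∀ w, F.γ (toIcoMod hp 0 w) t = F.γ w t := fun w => by
    rw [toIcoMod]
    exact (F.periodic t ht).sub_zsmul_eq _
  have := F.simple t ht (hm u) (hm v) (by simpa only [hγ] using h)
  simp only [toIcoMod, zsmul_eq_mul] at this
  have e : v - u = ((toIcoDiv hp 0 v - toIcoDiv hp 0 u : ℤ) : ℝ) * (2 * π) := by
    push_cast; linarith
  generalize toIcoDiv hp 0 v - toIcoDiv hp 0 u = n at e
  have h1 : (0 : ℝ) < n := by
    by_contra hn
    push Not at hn
    nlinarith
  have h2 : (n : ℝ) < 1 := by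
    by_contra hn
    push Not at hn
    nlinarith
  have h3 : 0 < n := by exact_mod_cast h1
  have h4 : n < 1 := by exact_mod_cast h2
  omega

theorem arc_add_period (ht : t ∈ Set.Ico 0 T) (u : ℝ) :
    F.arc t 0 (u + 2 * π) = F.arc t 0 u + F.length t := by
  rw [← arc_period ht u, arc_add ht]

theorem param_add_length (ht : t ∈ Set.Ico 0 T) (r : ℝ) :
    F.param t (r + F.length t) = F.param t r + 2 * π := by
  rw [← param_arc ht (F.param t r + 2 * π), arc_add_period ht, arc_param ht]

theorem isUnitSpeedLoop (ht : t ∈ Set.Ico 0 T) :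
    IsUnitSpeedLoop (fun r => F.γ (F.param t r) t) (fun r => F.tangent (F.param t r) t)
      (fun r => F.second (F.param t r) t) (F.length t) where
  length_pos := length_pos ht
  hasDerivAt := hasDerivAt_comp_param ht F.smooth
  hasDerivAt_deriv := hasDerivAt_comp_param ht F.contDiffOn_tangent
  continuous_second := (continuous_slice F.contDiffOn_second ht).comp (continuous_param ht)
  norm_eq_one _ := F.spherical t ht _
  norm_deriv _ := F.norm_tangent ht _
  periodic r := by
    rw [param_add_length ht]
    exact F.periodic t ht _
  ne_of_lt a b hab hba := by
    have hmono := strictMono_param (F := F) ht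
    refine ne_of_lt_of_lt ht (hmono hab) ?_
    rw [← param_add_length ht]
    exact hmono hba

theorem integral_second_sq_comp_param (ht : t ∈ Set.Ico 0 T) (u v : ℝ) :
    ∫ r in F.arc t 0 u..F.arc t 0 v, ‖F.second (F.param t r) t‖ ^ 2 =
      ∫ w in u..v, ‖F.second w t‖ ^ 2 * F.speed w t := by
  rw [← intervalIntegral.integral_comp_mul_deriv (f := F.arc t 0) (f' := fun w => F.speed w t)
    (g := fun r => ‖F.second (F.param t r) t‖ ^ 2)
    (fun w _ => hasDerivAt_arc ht 0 w) (continuous_speed ht).continuousOn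
    (((continuous_slice F.contDiffOn_second ht).comp (continuous_param ht)).norm.pow 2)]
  simp only [Function.comp, param_arc ht]

theorem modelChord_le_comp_param (ht : t ∈ Set.Ico 0 T) {B m : ℝ}
    (hle : ∀ u v, u ≤ v → v ≤ u + 2 * π →
      modelChord B (F.length t) (F.arc t u v) ≤ m * ‖F.γ v t - F.γ u t‖) {p q : ℝ}
    (hpq : p ≤ q) (hqp : q ≤ p + F.length t) :
    modelChord B (F.length t) (q - p) ≤
      m * ‖F.γ (F.param t q) t - F.γ (F.param t p) t‖ := by
  have hmono := strictMono_param (F := F) ht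
  have h1 := hle (F.param t p) (F.param t q) (hmono.monotone hpq)
    (by rw [← param_add_length ht]; exact hmono.monotone hqp)
  have h2 := arc_add (F := F) ht 0 (F.param t p) (F.param t q)
  rw [arc_param ht, arc_param ht] at h2
  rwa [show F.arc t (F.param t p) (F.param t q) = q - p by linarith] at h1

/-- The pointwise curvature bound following from the chord-arc comparison. -/
theorem second_sq_le_of_modelChord_le (ht : t ∈ Set.Ico 0 T) {B : ℝ} (hB : 0 < B)
    (hle : ∀ u v, u ≤ v → v ≤ u + 2 * π →
      modelChord B (F.length t) (F.arc t u v) ≤ ‖F.γ v t - F.γ u t‖) (u : ℝ) :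
    ‖F.second u t‖ ^ 2 ≤ (2 * π / F.length t) ^ 2 * (1 + 2 * B ^ 2) := by
  have h3 := F.contDiffOn_pS F.contDiffOn_second
  have h4 := F.contDiffOn_pS h3
  have := (isUnitSpeedLoop (F := F) ht).norm_second_sq_le
    (hasDerivAt_comp_param ht F.contDiffOn_second) (hasDerivAt_comp_param ht h3)
    ((continuous_slice h4 ht).comp (continuous_param ht)) hB
    (fun p q hpq hqp => by
      simpa using modelChord_le_comp_param (m := 1) ht (by simpa using hle) hpq hqp)
    (F.arc t 0 u)
  simpa only [param_arc ht] using this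

end Slice

end SphereCSF

/-- Evolution of the model chord when the lengths evolve by curve shortening and `B` solves
`B' = -4π² B / L²`. -/
theorem hasDerivAt_modelChord_comp {B L s : ℝ → ℝ} {t K K₁ : ℝ} (hB0 : 0 < B t) (hL0 : 0 < L t)
    (hB : HasDerivAt B (-(4 * π ^ 2) * B t / L t ^ 2) t) (hL : HasDerivAt L (L t - K) t)
    (hs : HasDerivAt s (s t - K₁) t) :
    HasDerivAt (fun r => modelChord (B r) (L r) (s r))
      (modelChord (B t) (L t) (s t) -
        ((arctan (B t * sin (π * s t / L t)) / (π * B t) -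
          s t / L t * (cos (π * s t / L t) / (1 + (B t * sin (π * s t / L t)) ^ 2))) * K +
        cos (π * s t / L t) / (1 + (B t * sin (π * s t / L t)) ^ 2) * K₁ -
        4 * π / L t * (arctan (B t * sin (π * s t / L t)) / B t -
          sin (π * s t / L t) / (1 + (B t * sin (π * s t / L t)) ^ 2)))) t := by
  have hpi := pi_pos
  have h1 := hL.div (hB.const_mul π) (by positivity)
  have h2 := (hB.mul ((hs.const_mul π).div hL hL0.ne').sin).arctan
  refine (h1.mul h2).congr_deriv ?_
  simp only [modelChord, Pi.mul_apply, Pi.div_apply]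
  have hP : 1 + (B t * sin (π * s t / L t)) ^ 2 ≠ 0 := by positivity
  generalize sin (π * s t / L t) = S at *
  generalize cos (π * s t / L t) = C at *
  generalize arctan (B t * S) = A at *
  field_simp
  ring

namespace SphereCSF

variable {T : ℝ} (F : SphereCSF (Set.Ico 0 T))

section Continuity

variable {F} {b : ℝ}

theorem clamp_mem (hb : b ∈ Set.Ico 0 T) (r : ℝ) : max 0 (min r b) ∈ Set.Ico 0 T :=
  ⟨le_max_left _ _, (max_le hb.1 (min_le_right _ _)).trans_lt hb.2⟩

theorem clamp_eq {r : ℝ} (hr : r ∈ Set.Icc 0 b) : max 0 (min r b) = r := by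
  rw [min_eq_left hr.2, max_eq_right hr.1]

theorem continuous_clamp {E : Type*} [NormedAddCommGroup E] [NormedSpace ℝ E] {f : ℝ → ℝ → E}
    (hf : ContDiffOn ℝ (⊤ : ℕ∞) (fun p : ℝ × ℝ => f p.1 p.2) (Set.univ ×ˢ Set.Ico 0 T))
    (hb : b ∈ Set.Ico 0 T) : Continuous fun p : ℝ × ℝ => f p.1 (max 0 (min p.2 b)) :=
  hf.continuousOn.comp_continuous (f := fun p : ℝ × ℝ => (p.1, max 0 (min p.2 b)))
    (by fun_prop) fun p => ⟨Set.mem_univ _, clamp_mem hb p.2⟩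

theorem continuous_arc_clamp (hb : b ∈ Set.Ico 0 T) :
    Continuous fun p : (ℝ × ℝ) × ℝ => F.arc (max 0 (min p.2 b)) p.1.1 p.1.2 := by
  have h2 : Continuous fun q : ((ℝ × ℝ) × ℝ) × ℝ => F.speed q.2 (max 0 (min q.1.2 b)) :=
    Continuous.comp (g := fun p : ℝ × ℝ => F.speed p.1 (max 0 (min p.2 b)))
      (f := fun q : ((ℝ × ℝ) × ℝ) × ℝ => (q.2, q.1.2))
      (continuous_clamp F.contDiffOn_speed hb) (by fun_prop)
  have h1 : ∀ g : (ℝ × ℝ) × ℝ → ℝ, Continuous g →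
      Continuous fun p : (ℝ × ℝ) × ℝ => F.arc (max 0 (min p.2 b)) 0 (g p) := fun g hg =>
    intervalIntegral.continuous_parametric_intervalIntegral_of_continuous
      (f := fun (p : (ℝ × ℝ) × ℝ) w => F.speed w (max 0 (min p.2 b)))
      h2 hg
  refine ((h1 (fun p => p.1.2) (by fun_prop)).sub (h1 (fun p => p.1.1) (by fun_prop))).congr
    fun p => ?_
  simp only [Pi.sub_apply]
  rw [sub_eq_iff_eq_add', arc_add (clamp_mem hb _)]

theorem continuous_length_clamp (hb : b ∈ Set.Ico 0 T) :
    Continuous fun r => F.length (max 0 (min r b)) :=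
  Continuous.comp (g := fun p : (ℝ × ℝ) × ℝ => F.arc (max 0 (min p.2 b)) p.1.1 p.1.2)
    (f := fun r : ℝ => (((0 : ℝ), 2 * π), r)) (continuous_arc_clamp hb) (by fun_prop)

theorem tau_eq {t : ℝ} (ht : t ∈ Set.Icc 0 b) :
    F.tau t = ∫ s in (0 : ℝ)..t, ((F.length (max 0 (min s b))) ^ 2)⁻¹ := by
  refine intervalIntegral.integral_congr fun s hs => ?_
  rw [Set.uIcc_of_le ht.1] at hs
  rw [clamp_eq ⟨hs.1, hs.2.trans ht.2⟩]

theorem continuous_inv_length_sq_clamp (hb : b ∈ Set.Ico 0 T) :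
    Continuous fun s => ((F.length (max 0 (min s b))) ^ 2)⁻¹ :=
  ((continuous_length_clamp hb).pow 2).inv₀ fun s =>
    pow_ne_zero 2 (length_pos (clamp_mem hb s)).ne'

theorem continuousOn_tau (hb : b ∈ Set.Ico 0 T) : ContinuousOn F.tau (Set.Icc 0 b) :=
  (intervalIntegral.continuous_primitive
    (fun x y => (continuous_inv_length_sq_clamp (F := F) hb).intervalIntegrable x y) 0).continuousOn.congr
      fun _ ht => tau_eq ht

end Continuity

section Evolution

variable {F} {t : ℝ}

theorem hasDerivAt_tau (ht : t ∈ Set.Ioo 0 T) : HasDerivAt F.tau ((F.length t ^ 2)⁻¹) t := by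
  obtain ⟨b, hb1, hb2⟩ := exists_between ht.2
  have hb : b ∈ Set.Ico 0 T := ⟨(ht.1.trans hb1).le, hb2⟩
  have h1 := (continuous_inv_length_sq_clamp (F := F) hb).integral_hasStrictDerivAt 0 t
  have h2 := h1.hasDerivAt
  rw [clamp_eq ⟨ht.1.le, hb1.le⟩] at h2
  refine h2.congr_of_eventuallyEq ?_
  filter_upwards [Ioo_mem_nhds ht.1 hb1] with s hs using tau_eq ⟨hs.1.le, hs.2.le⟩

theorem hasDerivAt_arc_time (ht : t ∈ Set.Ioo 0 T) (u v : ℝ) :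
    HasDerivAt (fun s => F.arc s u v)
      (F.arc t u v - ∫ w in u..v, ‖F.second w t‖ ^ 2 * F.speed w t) t := by
  obtain ⟨b, hb1, hb2⟩ := exists_between ht.2
  have hb : b ∈ Set.Ico 0 T := ⟨(ht.1.trans hb1).le, hb2⟩
  have ht' : t ∈ Set.Ico 0 T := ⟨ht.1.le, ht.2⟩
  have hc : Continuous fun p : ℝ × ℝ =>
      (1 - ‖F.second p.1 (max 0 (min p.2 b))‖ ^ 2) * F.speed p.1 (max 0 (min p.2 b)) :=
    (continuous_const.sub ((continuous_clamp F.contDiffOn_second hb).norm.pow 2)).mul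
      (continuous_clamp F.contDiffOn_speed hb)
  obtain ⟨M, hM⟩ := ((isCompact_uIcc (a := u) (b := v)).prod (isCompact_Icc (a := 0) (b := b))
    ).exists_bound_of_continuousOn hc.continuousOn
  have hs2 := continuous_slice F.contDiffOn_second ht'
  have hsp := continuous_speed (F := F) ht'
  have key := intervalIntegral.hasDerivAt_integral_of_dominated_loc_of_deriv_le (𝕜 := ℝ)
    (μ := volume) (a := u) (b := v) (F := fun s w => F.speed w s) (x₀ := t)
    (F' := fun s w => (1 - ‖F.second w s‖ ^ 2) * F.speed w s) (bound := fun _ => M)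
    (Ioo_mem_nhds ht.1 hb1)
    (by
      filter_upwards [Ioo_mem_nhds ht.1 hb1] with s hs
      exact (continuous_speed ⟨hs.1.le, hs.2.trans hb2⟩).aestronglyMeasurable)
    (hsp.intervalIntegrable _ _)
    (Continuous.aestronglyMeasurable (by fun_prop))
    (Filter.Eventually.of_forall fun w hw s hs => by
      have := hM (w, s) ⟨Set.uIoc_subset_uIcc hw, hs.1.le, hs.2.le⟩
      simpa only [clamp_eq ⟨hs.1.le, hs.2.le⟩] using this)
    (continuous_const.intervalIntegrable _ _)
    (Filter.Eventually.of_forall fun w hw s hs => F.hasDerivAt_speed ⟨hs.1, hs.2.trans hb2⟩ w)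
  refine key.2.congr_deriv ?_
  unfold arc
  rw [← intervalIntegral.integral_sub (hsp.intervalIntegrable _ _)
    (Continuous.intervalIntegrable (by fun_prop) _ _)]
  congr 1
  funext w
  ring

theorem hasDerivAt_length (ht : t ∈ Set.Ioo 0 T) :
    HasDerivAt F.length
      (F.length t - ∫ w in (0 : ℝ)..2 * π, ‖F.second w t‖ ^ 2 * F.speed w t) t :=
  hasDerivAt_arc_time ht 0 (2 * π)

theorem hasDerivAt_dist (ht : t ∈ Set.Ioo 0 T) {u v : ℝ} (hne : F.γ v t ≠ F.γ u t) :
    HasDerivAt (fun s => ‖F.γ v s - F.γ u s‖)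
      (‖F.γ v t - F.γ u t‖ + inner ℝ (F.γ v t - F.γ u t) (F.second v t - F.second u t) /
        ‖F.γ v t - F.γ u t‖) t := by
  have h0 : 0 < ‖F.γ v t - F.γ u t‖ := norm_pos_iff.2 (sub_ne_zero.2 hne)
  have h1 := (((F.hasDerivAt_flow ht v).sub (F.hasDerivAt_flow ht u)).norm_sq).sqrt
    (by simp only [Pi.sub_apply]; positivity)
  simp only [Pi.sub_apply, sqrt_sq (norm_nonneg _)] at h1
  refine h1.congr_deriv ?_
  rw [show F.second v t + F.γ v t - (F.second u t + F.γ u t) =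
    F.second v t - F.second u t + (F.γ v t - F.γ u t) by abel, inner_add_right,
    real_inner_self_eq_norm_sq]
  field_simp
  ring

/-- At a first contact the chord-arc comparison is strictly increasing in time. -/
theorem exists_pos_hasDerivAt_of_contact (ht : t ∈ Set.Ioo 0 T) {ε : ℝ} (hε : 0 < ε)
    {B : ℝ → ℝ} (hB0 : 0 < B t) (hB : HasDerivAt B (-(4 * π ^ 2) * B t / F.length t ^ 2) t)
    (hle : ∀ u v, u ≤ v → v ≤ u + 2 * π →
      modelChord (B t) (F.length t) (F.arc t u v) ≤ exp (ε * (1 + t)) * ‖F.γ v t - F.γ u t‖)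
    {u v : ℝ} (huv : u < v) (hvu : v < u + 2 * π) (hhalf : F.arc t u v ≤ F.length t / 2)
    (heq : exp (ε * (1 + t)) * ‖F.γ v t - F.γ u t‖ =
      modelChord (B t) (F.length t) (F.arc t u v)) :
    ∃ d, 0 < d ∧ HasDerivAt (fun s => exp (ε * (1 + s)) * ‖F.γ v s - F.γ u s‖ -
      modelChord (B s) (F.length s) (F.arc s u v)) d t := by
  have ht' : t ∈ Set.Ico 0 T := ⟨ht.1.le, ht.2⟩
  have hne : F.γ v t ≠ F.γ u t := (ne_of_lt_of_lt ht' huv hvu).symm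
  have h0 : 0 < ‖F.γ v t - F.γ u t‖ := norm_pos_iff.2 (sub_ne_zero.2 hne)
  have hm : HasDerivAt (fun s => exp (ε * (1 + s))) (exp (ε * (1 + t)) * ε) t := by
    simpa using (((hasDerivAt_id t).const_add 1).const_mul ε).exp
  refine ⟨_, ?_, (hm.mul (hasDerivAt_dist ht hne)).sub (hasDerivAt_modelChord_comp hB0
    (length_pos ht') hB (hasDerivAt_length ht) (hasDerivAt_arc_time ht u v))⟩
  have hadd : F.arc t 0 v - F.arc t 0 u = F.arc t u v := by
    have := arc_add (F := F) ht' 0 u v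
    linarith
  have hm1 : 1 ≤ exp (ε * (1 + t)) := one_le_exp (mul_nonneg hε.le (by linarith [ht.1]))
  have key := (isUnitSpeedLoop (F := F) ht').chordArc_nonneg (m := exp (ε * (1 + t)))
    (p := F.arc t 0 u) (q := F.arc t 0 v) hB0 hm1
    (fun p q hpq hqp => modelChord_le_comp_param ht' hle hpq hqp)
    (strictMono_arc ht' huv) (by rwa [hadd]) (by simpa only [param_arc ht', hadd] using heq)
  rw [← arc_add_period ht', integral_second_sq_comp_param ht', integral_second_sq_comp_param ht',
    hadd] at key
  simp only [param_arc ht'] at key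
  have hper : ∫ w in u..(u + 2 * π), ‖F.second w t‖ ^ 2 * F.speed w t =
      ∫ w in (0 : ℝ)..2 * π, ‖F.second w t‖ ^ 2 * F.speed w t := by
    have hp : Function.Periodic (fun w => ‖F.second w t‖ ^ 2 * F.speed w t) (2 * π) := fun w => by
      simp only [periodic_second ht' w, periodic_speed ht' w]
    simpa using hp.intervalIntegral_add_eq u 0
  rw [hper] at key
  have hpos : 0 < exp (ε * (1 + t)) * ε * ‖F.γ v t - F.γ u t‖ := by positivity
  rw [mul_add (exp (ε * (1 + t))), heq]
  linarith

end Evolution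

end SphereCSF

/-- Maximum principle at the first contact time: a function which is positive initially, and whose
time derivative is positive wherever it first touches zero, stays positive. -/
theorem pos_of_first_contact {K : Set (ℝ × ℝ)} (hK : IsCompact K) {b : ℝ} {Z : ℝ × ℝ → ℝ → ℝ}
    (hZ : ContinuousOn (fun p : (ℝ × ℝ) × ℝ => Z p.1 p.2) (K ×ˢ Set.Icc 0 b))
    (h0 : ∀ x ∈ K, 0 < Z x 0)
    (hcontact : ∀ t ∈ Set.Ioc 0 b, (∀ x ∈ K, 0 ≤ Z x t) → ∀ x ∈ K, Z x t = 0 →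
      ∃ d, 0 < d ∧ HasDerivAt (Z x) d t) :
    ∀ t ∈ Set.Icc 0 b, ∀ x ∈ K, 0 < Z x t := by
  by_contra! hcon
  obtain ⟨t', ht', x', hx', hbad⟩ := hcon
  have hcomp : IsCompact (K ×ˢ Set.Icc (0 : ℝ) b) := hK.prod isCompact_Icc
  set S := (K ×ˢ Set.Icc (0 : ℝ) b) ∩ (fun p : (ℝ × ℝ) × ℝ => Z p.1 p.2) ⁻¹' Set.Iic 0 with hS
  have hScomp : IsCompact S := hcomp.of_isClosed_subset
    (hZ.preimage_isClosed_of_isClosed hcomp.isClosed isClosed_Iic) Set.inter_subset_left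
  obtain ⟨⟨x, t⟩, ⟨⟨hx, ht⟩, hxt⟩, hmin⟩ := hScomp.exists_isMinOn
    ⟨(x', t'), ⟨hx', ht'⟩, hbad⟩ (continuous_snd (X := ℝ × ℝ) (Y := ℝ)).continuousOn
  simp only at hx ht
  have hpos : ∀ y ∈ K, ∀ s ∈ Set.Ico 0 t, 0 < Z y s := by
    intro y hy s hs
    by_contra hle
    have h1 : ((y, s) : (ℝ × ℝ) × ℝ) ∈ S :=
      ⟨⟨hy, hs.1, hs.2.le.trans ht.2⟩, not_lt.1 hle⟩
    exact absurd (show t ≤ s from hmin h1) (not_le.2 hs.2)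
  have ht0 : 0 < t := by
    rcases ht.1.eq_or_lt with h | h
    · subst h
      exact absurd (show Z x 0 ≤ 0 from hxt) (not_le.2 (h0 x hx))
    · exact h
  have hcont : ∀ y ∈ K, ContinuousOn (Z y) (Set.Icc 0 t) := fun y hy =>
    hZ.comp (f := fun s => (y, s)) (by fun_prop) fun s hs => ⟨hy, hs.1, hs.2.trans ht.2⟩
  have hnonneg : ∀ y ∈ K, 0 ≤ Z y t := by
    intro y hy
    by_contra hlt
    push Not at hlt
    obtain ⟨s, hs, hs0⟩ := intermediate_value_Icc' ht.1 (hcont y hy) ⟨hlt.le, (h0 y hy).le⟩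
    rcases hs.2.eq_or_lt with h | h
    · rw [h] at hs0; linarith
    · linarith [hpos y hy s ⟨hs.1, h⟩]
  have hzero : Z x t = 0 := le_antisymm hxt (hnonneg x hx)
  obtain ⟨d, hd, hderiv⟩ := hcontact t ⟨ht0, ht.2⟩ hnonneg x hx hzero
  have h1 := ((hasDerivAt_iff_tendsto_slope.1 hderiv).eventually (lt_mem_nhds hd)).filter_mono
    (nhdsWithin_mono t fun s (hs : s ∈ Set.Iio t) => ne_of_lt hs)
  obtain ⟨s, hs, hs1⟩ := (h1.and (Ioo_mem_nhdsLT ht0)).exists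
  have h2 := hpos x hx s ⟨hs1.1.le, hs1.2⟩
  rw [slope_def_field, hzero, sub_zero] at hs
  exact absurd hs (not_lt.2 (div_nonpos_of_nonneg_of_nonpos h2.le (by linarith [hs1.2])))

theorem IsUnitSpeedLoop.sub_sq_le_norm_sub {E : Type*} [NormedAddCommGroup E]
    [InnerProductSpace ℝ E] {c T N : ℝ → E} {L M : ℝ} (h : IsUnitSpeedLoop c T N L)
    (hM : ∀ r, ‖N r‖ ≤ M) {p q : ℝ} (hpq : p ≤ q) :
    (q - p) - M * (q - p) ^ 2 ≤ ‖c q - c p‖ := by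
  have hM0 : 0 ≤ M := (norm_nonneg _).trans (hM 0)
  have h1 : ∀ x ∈ Set.Icc p q, ‖T x - T p‖ ≤ M * (q - p) := by
    intro x hx
    refine ((convex_univ (𝕜 := ℝ) (E := ℝ)).norm_image_sub_le_of_norm_hasDerivWithin_le
      (fun y _ => (h.hasDerivAt_deriv y).hasDerivWithinAt) (fun y _ => hM y) (Set.mem_univ p)
      (Set.mem_univ x)).trans ?_
    rw [norm_of_nonneg (by linarith [hx.1])]
    exact mul_le_mul_of_nonneg_left (by linarith [hx.2]) hM0
  have h2 := (convex_Icc p q).norm_image_sub_le_of_norm_hasDerivWithin_le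
    (f := fun x => c x - x • T p) (f' := fun x => T x - T p) (C := M * (q - p))
    (fun x _ => by
      have h3 := ((h.hasDerivAt x).sub
        ((hasDerivAt_id x).smul_const (T p))).hasDerivWithinAt (s := Set.Icc p q)
      rw [one_smul] at h3
      exact h3)
    h1 (Set.left_mem_Icc.2 hpq) (Set.right_mem_Icc.2 hpq)
  rw [norm_of_nonneg (sub_nonneg.2 hpq)] at h2
  have h3 : (q - p) • T p = (c q - c p) - (c q - q • T p - (c p - p • T p)) := by
    rw [sub_smul]; abel
  have h4 : ‖(q - p) • T p‖ = q - p := by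
    rw [norm_smul, h.norm_deriv, mul_one, norm_of_nonneg (sub_nonneg.2 hpq)]
  have h5 := norm_sub_le (c q - c p) (c q - q • T p - (c p - p • T p))
  rw [← h3, h4] at h5
  linarith

namespace SphereCSF

variable {T : ℝ} (F : SphereCSF (Set.Ico 0 T))

/-- The difference between `m` times the chord and the model chord. -/
def gap (B m t u v : ℝ) : ℝ :=
  m * ‖F.γ v t - F.γ u t‖ - modelChord B (F.length t) (F.arc t u v)

section Gap

variable {F} {t : ℝ}

theorem arc_swap (ht : t ∈ Set.Ico 0 T) (u v : ℝ) :
    F.arc t v (u + 2 * π) = F.length t - F.arc t u v := by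
  have h1 := arc_add (F := F) ht u v (u + 2 * π)
  rw [arc_period ht] at h1
  linarith

theorem gap_swap (ht : t ∈ Set.Ico 0 T) (B m u v : ℝ) :
    F.gap B m t v (u + 2 * π) = F.gap B m t u v := by
  have h2 : F.γ (u + 2 * π) t = F.γ u t := F.periodic t ht u
  simp only [gap]
  rw [arc_swap ht, modelChord_symm (length_pos ht), h2, norm_sub_rev]

theorem gap_periodic (ht : t ∈ Set.Ico 0 T) (B m δ : ℝ) :
    Function.Periodic (fun u => F.gap B m t u (u + δ)) (2 * π) := fun u => by
  simp only
  rw [← gap_swap ht B m u (u + δ), ← gap_swap ht B m (u + δ) (u + 2 * π),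
    show u + 2 * π + δ = u + δ + 2 * π by ring]

theorem gap_pos_of_arc_le (ht : t ∈ Set.Ico 0 T) {B m m₀ M ρ u v : ℝ} (hB : 0 < B)
    (hm₀ : 0 < m₀) (hm : m₀ ≤ m) (hM : ∀ w, ‖F.second w t‖ ≤ M) (hρ : 1 < m₀ * (1 - M * ρ))
    (huv : u < v) (hvu : v ≤ u + 2 * π) (harc : F.arc t u v ≤ ρ) : 0 < F.gap B m t u v := by
  have hs := arc_pos (F := F) ht huv
  have hM0 : 0 ≤ M := (norm_nonneg _).trans (hM 0)
  have h1 := (isUnitSpeedLoop (F := F) ht).sub_sq_le_norm_sub (fun r => hM _)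
    (strictMono_arc (F := F) ht huv).le
  have hadd : F.arc t 0 v - F.arc t 0 u = F.arc t u v := by
    have := arc_add (F := F) ht 0 u v
    linarith
  simp only [param_arc ht, hadd] at h1
  have h2 : F.arc t u v ≤ F.length t := by
    have h3 := arc_nonneg (F := F) ht hvu
    rw [arc_swap ht] at h3
    linarith
  have h3 := modelChord_le hB (length_pos ht) hs.le h2
  have h4 : F.arc t u v * (1 - M * ρ) ≤ ‖F.γ v t - F.γ u t‖ := by
    refine le_trans ?_ h1
    nlinarith [mul_le_mul_of_nonneg_left harc (mul_nonneg hM0 hs.le)]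
  have h5 := mul_le_mul_of_nonneg_left h4 hm₀.le
  have h6 := mul_le_mul_of_nonneg_right hm (norm_nonneg (F.γ v t - F.γ u t))
  unfold gap
  nlinarith

theorem gap_nonneg_of_initial (hT : 0 < T) {a : ℝ} (ha : 0 < a)
    (h0 : ∀ u ∈ Set.Ico (0 : ℝ) (2 * π), ∀ v ∈ Set.Ico (0 : ℝ) (2 * π),
      F.chord 0 u v / F.length 0
        ≥ a⁻¹ * Real.arctan (a / π * Real.sin (π * F.arcLen 0 u v / F.length 0)))
    {u v : ℝ} (huv : u ≤ v) (hvu : v ≤ u + 2 * π) : 0 ≤ F.gap (a / π) 1 0 u v := by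
  have ht : (0 : ℝ) ∈ Set.Ico 0 T := ⟨le_rfl, hT⟩
  have hL := length_pos (F := F) ht
  have hpi := pi_pos
  have base : ∀ x ∈ Set.Ico (0 : ℝ) (2 * π), ∀ y ∈ Set.Ico (0 : ℝ) (2 * π), x ≤ y →
      0 ≤ F.gap (a / π) 1 0 x y := by
    intro x hx y hy hxy
    have h1 := h0 x hx y hy
    have h2 := arc_nonneg (F := F) ht hxy
    have h3 : sin (π * F.arcLen 0 x y / F.length 0) =
        sin (π * F.arc 0 x y / F.length 0) := by
      have e : F.arcLen 0 x y = min (F.arc 0 x y) (F.length 0 - F.arc 0 x y) := by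
        unfold arc at h2
        simp only [arcLen, arc, abs_of_nonneg h2]
      rw [e]
      rcases min_choice (F.arc 0 x y) (F.length 0 - F.arc 0 x y) with h | h
      · rw [h]
      · rw [h, ← sin_pi_sub]
        congr 1
        field_simp
        ring
    rw [h3, ge_iff_le, le_div_iff₀ hL] at h1
    simp only [gap, modelChord, one_mul, sub_nonneg]
    rw [norm_sub_rev]
    refine le_trans (le_of_eq ?_) h1
    field_simp
  obtain ⟨x, hx, hxe⟩ := (gap_periodic (F := F) ht (a / π) 1 (v - u)).exists_mem_Ico₀
    (by positivity) u
  simp only [add_sub_cancel] at hxe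
  rw [hxe]
  rcases lt_or_ge (x + (v - u)) (2 * π) with h | h
  · exact base x hx _ ⟨by linarith [hx.1], h⟩ (by linarith)
  · have := base (x + (v - u) - 2 * π) ⟨by linarith, by linarith [hx.2]⟩ x hx (by linarith)
    rwa [← gap_swap ht, sub_add_cancel] at this

theorem gap_nonneg_of_compact (ht : t ∈ Set.Ico 0 T) {B m r : ℝ}
    (hdiag : ∀ u v, u < v → v ≤ u + r → v ≤ u + 2 * π → 0 < F.gap B m t u v)
    (hK : ∀ u v, u ∈ Set.Icc 0 (2 * π) → r ≤ v - u → v - u ≤ 2 * π - r → 0 ≤ F.gap B m t u v)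
    {u v : ℝ} (huv : u ≤ v) (hvu : v ≤ u + 2 * π) : 0 ≤ F.gap B m t u v := by
  have hself : ∀ w, F.gap B m t w w = 0 := fun w => by simp [gap, arc, modelChord]
  rcases huv.eq_or_lt with rfl | huv
  · exact (hself u).ge
  rcases hvu.eq_or_lt with rfl | hvu
  · rw [gap_swap ht, hself]
  rcases le_or_gt (v - u) r with h1 | h1
  · exact (hdiag u v huv (by linarith) hvu.le).le
  rcases le_or_gt (v - u) (2 * π - r) with h2 | h2
  · obtain ⟨x, hx, hxe⟩ := (gap_periodic (F := F) ht B m (v - u)).exists_mem_Ico₀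
      (by positivity) u
    simp only [add_sub_cancel] at hxe
    rw [hxe]
    exact hK _ _ ⟨hx.1, hx.2.le⟩ (by linarith) (by linarith)
  · rw [← gap_swap ht]
    exact (hdiag _ _ hvu (by linarith) (by linarith)).le

theorem continuousOn_gap {b : ℝ} (hb : b ∈ Set.Ico 0 T) {B m : ℝ → ℝ} (hB0 : ∀ t, B t ≠ 0)
    (hB : ContinuousOn B (Set.Icc 0 b)) (hm : Continuous m) (K : Set (ℝ × ℝ)) :
    ContinuousOn (fun p : (ℝ × ℝ) × ℝ => F.gap (B p.2) (m p.2) p.2 p.1.1 p.1.2)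
      (K ×ˢ Set.Icc 0 b) := by
  have hγ := continuous_clamp F.smooth hb
  have hγ1 : Continuous fun p : (ℝ × ℝ) × ℝ => F.γ p.1.1 (max 0 (min p.2 b)) :=
    Continuous.comp (g := fun p : ℝ × ℝ => F.γ p.1 (max 0 (min p.2 b)))
      (f := fun p : (ℝ × ℝ) × ℝ => (p.1.1, p.2)) hγ (by fun_prop)
  have hγ2 : Continuous fun p : (ℝ × ℝ) × ℝ => F.γ p.1.2 (max 0 (min p.2 b)) :=
    Continuous.comp (g := fun p : ℝ × ℝ => F.γ p.1 (max 0 (min p.2 b)))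
      (f := fun p : (ℝ × ℝ) × ℝ => (p.1.2, p.2)) hγ (by fun_prop)
  have harc := continuous_arc_clamp (F := F) hb
  have hlen : Continuous fun p : (ℝ × ℝ) × ℝ => F.length (max 0 (min p.2 b)) :=
    Continuous.comp (g := fun t => F.length (max 0 (min t b)))
      (f := fun p : (ℝ × ℝ) × ℝ => p.2) (continuous_length_clamp hb) (by fun_prop)
  have hB' : ContinuousOn (fun p : (ℝ × ℝ) × ℝ => B p.2) (K ×ˢ Set.Icc 0 b) :=
    hB.comp continuous_snd.continuousOn fun p hp => hp.2
  have hpi := pi_pos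
  have key : ContinuousOn (fun p : (ℝ × ℝ) × ℝ =>
      m p.2 * ‖F.γ p.1.2 (max 0 (min p.2 b)) - F.γ p.1.1 (max 0 (min p.2 b))‖ -
        modelChord (B p.2) (F.length (max 0 (min p.2 b)))
          (F.arc (max 0 (min p.2 b)) p.1.1 p.1.2)) (K ×ˢ Set.Icc 0 b) := by
    have h1 : ContinuousOn (fun p : (ℝ × ℝ) × ℝ => sin (π * F.arc (max 0 (min p.2 b)) p.1.1 p.1.2 /
        F.length (max 0 (min p.2 b)))) (K ×ˢ Set.Icc 0 b) :=
      (continuous_sin.comp ((continuous_const.mul harc).div hlen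
        fun p => (length_pos (clamp_mem hb p.2)).ne')).continuousOn
    have h2 := (hlen.continuousOn (s := K ×ˢ Set.Icc 0 b)).div (hB'.const_mul π)
      fun p _ => mul_ne_zero hpi.ne' (hB0 p.2)
    exact ((hm.comp continuous_snd).mul (hγ2.sub hγ1).norm).continuousOn.sub
      (h2.mul (continuous_arctan.comp_continuousOn (hB'.mul h1)))
  refine key.congr fun p hp => ?_
  simp only [gap, clamp_eq hp.2]

end Gap

/-- The coefficient of the comparison at time `t`. -/
def coeff (a t : ℝ) : ℝ := a / π * exp (-4 * π ^ 2 * F.tau t)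

variable {F}

theorem coeff_pos {a : ℝ} (ha : 0 < a) (t : ℝ) : 0 < F.coeff a t := by
  unfold coeff
  positivity

theorem hasDerivAt_coeff {a t : ℝ} (ht : t ∈ Set.Ioo 0 T) :
    HasDerivAt (F.coeff a) (-(4 * π ^ 2) * F.coeff a t / F.length t ^ 2) t := by
  refine (((hasDerivAt_tau (F := F) ht).const_mul (-4 * π ^ 2)).exp.const_mul (a / π)).congr_deriv ?_
  unfold coeff
  ring

theorem gap_coeff_nonneg {a : ℝ} (ha : 0 < a)
    (h0 : ∀ u ∈ Set.Ico (0 : ℝ) (2 * π), ∀ v ∈ Set.Ico (0 : ℝ) (2 * π),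
      F.chord 0 u v / F.length 0
        ≥ a⁻¹ * Real.arctan (a / π * Real.sin (π * F.arcLen 0 u v / F.length 0)))
    {ε b : ℝ} (hε : 0 < ε) (hb : b ∈ Set.Ico 0 T) {u v : ℝ} (huv : u ≤ v)
    (hvu : v ≤ u + 2 * π) : 0 ≤ F.gap (F.coeff a b) (exp (ε * (1 + b))) b u v := by
  have hT : 0 < T := hb.1.trans_lt hb.2
  have hpi := pi_pos
  have hD : ∀ {s}, s ∈ Set.Icc 0 b → s ∈ Set.Ico 0 T := fun hs => ⟨hs.1, hs.2.trans_lt hb.2⟩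
  obtain ⟨M₀, hM₀⟩ := ((isCompact_Icc (a := 0) (b := 2 * π)).prod (isCompact_Icc (a := 0) (b := b))
    ).exists_bound_of_continuousOn (continuous_clamp F.contDiffOn_second hb).continuousOn
  obtain ⟨V₀, hV₀⟩ := ((isCompact_Icc (a := 0) (b := 2 * π)).prod (isCompact_Icc (a := 0) (b := b))
    ).exists_bound_of_continuousOn (continuous_clamp F.contDiffOn_speed hb).continuousOn
  have hM : ∀ s ∈ Set.Icc 0 b, ∀ w, ‖F.second w s‖ ≤ M₀ := by
    intro s hs w
    obtain ⟨x, hx, hxe⟩ := (periodic_second (F := F) (hD hs)).exists_mem_Ico₀ (by positivity) w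
    have := hM₀ (x, s) ⟨⟨hx.1, hx.2.le⟩, hs⟩
    simp only [clamp_eq hs] at this hxe
    rwa [hxe]
  have hV : ∀ s ∈ Set.Icc 0 b, ∀ w, F.speed w s ≤ V₀ := by
    intro s hs w
    obtain ⟨x, hx, hxe⟩ := (periodic_speed (F := F) (hD hs)).exists_mem_Ico₀ (by positivity) w
    have := hV₀ (x, s) ⟨⟨hx.1, hx.2.le⟩, hs⟩
    simp only [clamp_eq hs] at this hxe
    rw [hxe]
    exact (le_abs_self _).trans this
  have hb0 : (0 : ℝ) ∈ Set.Icc 0 b := ⟨le_rfl, hb.1⟩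
  have hMn : 0 ≤ M₀ := (norm_nonneg _).trans (hM 0 hb0 0)
  have hVp : 0 < V₀ := (F.speed_pos (hD hb0) 0).trans_le (hV 0 hb0 0)
  have hm1 : 1 < exp ε := one_lt_exp_iff.2 hε
  set ρ := (1 - (exp ε)⁻¹) / (2 * (M₀ + 1)) with hρ
  have hinv : (exp ε)⁻¹ < 1 := inv_lt_one_of_one_lt₀ hm1
  have hρ0 : 0 < ρ := div_pos (by linarith) (by positivity)
  have hρ1 : 1 < exp ε * (1 - M₀ * ρ) := by
    have h1 : M₀ * ρ < 1 - (exp ε)⁻¹ := by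
      rw [hρ, mul_div_assoc', div_lt_iff₀ (by positivity)]
      nlinarith
    have h2 : exp ε * (exp ε)⁻¹ = 1 := mul_inv_cancel₀ (exp_pos ε).ne'
    have h3 := mul_lt_mul_of_pos_left h1 (exp_pos ε)
    linarith
  set r := ρ / V₀ with hr
  have hr0 : 0 < r := div_pos hρ0 hVp
  have hdiag : ∀ s ∈ Set.Icc 0 b, ∀ u v, u < v → v ≤ u + r → v ≤ u + 2 * π →
      0 < F.gap (F.coeff a s) (exp (ε * (1 + s))) s u v := by
    intro s hs u v h1 h2 h3
    refine gap_pos_of_arc_le (hD hs) (coeff_pos ha s) (exp_pos ε)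
      (exp_le_exp.2 (by nlinarith [hs.1])) (hM s hs) hρ1 h1 h3 ?_
    have h4 : F.arc s u v ≤ ∫ _ in u..v, V₀ :=
      intervalIntegral.integral_mono_on h1.le ((continuous_speed (hD hs)).intervalIntegrable _ _)
        intervalIntegrable_const fun w _ => hV s hs w
    rw [intervalIntegral.integral_const, smul_eq_mul] at h4
    have h5 : (v - u) * V₀ ≤ r * V₀ := mul_le_mul_of_nonneg_right (by linarith) hVp.le
    rw [hr, div_mul_cancel₀ _ hVp.ne'] at h5
    linarith
  set K : Set (ℝ × ℝ) := {p | p.1 ∈ Set.Icc 0 (2 * π) ∧ r ≤ p.2 - p.1 ∧ p.2 - p.1 ≤ 2 * π - r} with hKd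
  have hK : IsCompact K := by
    refine ((isCompact_Icc (a := 0) (b := 2 * π)).prod
      (isCompact_Icc (a := 0) (b := 4 * π))).of_isClosed_subset ?_ ?_
    · exact (isClosed_Icc.preimage continuous_fst).inter
        ((isClosed_le (f := fun _ : ℝ × ℝ => r) (g := fun p => p.2 - p.1)
          (by fun_prop) (by fun_prop)).inter
        (isClosed_le (f := fun p : ℝ × ℝ => p.2 - p.1) (g := fun _ => 2 * π - r)
          (by fun_prop) (by fun_prop)))
    · rintro ⟨x, y⟩ ⟨⟨h1, h2⟩, h3, h4⟩
      simp only at h1 h2 h3 h4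
      exact ⟨⟨h1, h2⟩, by simp only; linarith, by simp only; linarith⟩
  have hBc : ContinuousOn (F.coeff a) (Set.Icc 0 b) :=
    ((continuousOn_tau (F := F) hb).const_mul _).rexp.const_mul _
  have hpos := pos_of_first_contact hK
    (Z := fun x s => F.gap (F.coeff a s) (exp (ε * (1 + s))) s x.1 x.2)
    (continuousOn_gap (m := fun s => exp (ε * (1 + s))) hb (fun s => (coeff_pos ha s).ne') hBc
      (by fun_prop) K) ?_ ?_ b ⟨hb.1, le_rfl⟩
  · exact gap_nonneg_of_compact hb (hdiag b ⟨hb.1, le_rfl⟩)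
      (fun u v hu h1 h2 => (hpos (u, v) ⟨hu, h1, h2⟩).le) huv hvu
  · rintro ⟨x, y⟩ ⟨hx, h1, h2⟩
    simp only at hx h1 h2 ⊢
    have h3 := gap_nonneg_of_initial hT ha h0 (u := x) (v := y) (by linarith) (by linarith)
    have e : F.coeff a 0 = a / π := by simp [coeff, tau]
    have h4 : 0 < ‖F.γ y 0 - F.γ x 0‖ := norm_pos_iff.2 (sub_ne_zero.2
      (ne_of_lt_of_lt (hD hb0) (by linarith) (by linarith)).symm)
    rw [e, add_zero, mul_one]
    simp only [gap] at h3 ⊢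
    nlinarith
  · rintro s hs hnn ⟨x, y⟩ ⟨hx, h1, h2⟩ hz
    simp only at hx h1 h2 hz ⊢
    have hs' : s ∈ Set.Icc 0 b := ⟨hs.1.le, hs.2⟩
    have hsT : s ∈ Set.Ioo 0 T := ⟨hs.1, (hD hs').2⟩
    have hle : ∀ u v, u ≤ v → v ≤ u + 2 * π → modelChord (F.coeff a s) (F.length s) (F.arc s u v) ≤
        exp (ε * (1 + s)) * ‖F.γ v s - F.γ u s‖ := fun u v huv hvu =>
      sub_nonneg.1 (gap_nonneg_of_compact (hD hs') (hdiag s hs')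
        (fun u v hu h1 h2 => hnn (u, v) ⟨hu, h1, h2⟩) huv hvu)
    rcases le_or_gt (F.arc s x y) (F.length s / 2) with hhalf | hhalf
    · exact exists_pos_hasDerivAt_of_contact hsT hε (coeff_pos ha s) (hasDerivAt_coeff hsT) hle
        (by linarith) (by linarith) hhalf (sub_eq_zero.1 hz)
    · rw [← gap_swap (hD hs')] at hz
      obtain ⟨d, hd, hderiv⟩ := exists_pos_hasDerivAt_of_contact hsT hε (coeff_pos ha s)
        (hasDerivAt_coeff hsT) hle (u := y) (v := x + 2 * π) (by linarith) (by linarith)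
        (by rw [arc_swap (hD hs')]; linarith) (sub_eq_zero.1 hz)
      refine ⟨d, hd, hderiv.congr_of_eventuallyEq ?_⟩
      filter_upwards [Ioo_mem_nhds hsT.1 hsT.2] with s' hs'
      exact (gap_swap ⟨hs'.1.le, hs'.2⟩ _ _ x y).symm

theorem modelChord_coeff_le {a : ℝ} (ha : 0 < a)
    (h0 : ∀ u ∈ Set.Ico (0 : ℝ) (2 * π), ∀ v ∈ Set.Ico (0 : ℝ) (2 * π),
      F.chord 0 u v / F.length 0
        ≥ a⁻¹ * Real.arctan (a / π * Real.sin (π * F.arcLen 0 u v / F.length 0)))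
    {t : ℝ} (ht : t ∈ Set.Ico 0 T) {u v : ℝ} (huv : u ≤ v) (hvu : v ≤ u + 2 * π) :
    modelChord (F.coeff a t) (F.length t) (F.arc t u v) ≤ ‖F.γ v t - F.γ u t‖ := by
  have hc : Continuous fun ε : ℝ => exp (ε * (1 + t)) * ‖F.γ v t - F.γ u t‖ := by fun_prop
  have h1 := (hc.tendsto 0).mono_left (nhdsWithin_le_nhds (s := Set.Ioi 0))
  rw [zero_mul, exp_zero, one_mul] at h1
  refine ge_of_tendsto h1 ?_
  filter_upwards [self_mem_nhdsWithin] with ε hε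
  exact sub_nonneg.1 (gap_coeff_nonneg ha h0 hε ht huv hvu)

end SphereCSF

/-- The curvature estimate for curve shortening flow on the unit sphere: if at `t = 0`
the chord-arc inequality `d/L ≥ a⁻¹ arctan((a/π) sin(πℓ/L))` holds for some `a > 0` and
all pairs of points, then for all `t ∈ [0,T)` and at every point of `Γ_t`,
`κ² + 1 ≤ (2π/L)²(1 + (2a²/π²) e^{−8π²τ})` where `τ(t) = ∫₀ᵗ L⁻² ds`. -/
theorem curvature_estimate (T : ℝ) (hT : 0 < T)
    (F : SphereCSF (Set.Ico 0 T)) (a : ℝ) (ha : 0 < a)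
    (h0 : ∀ u ∈ Set.Ico (0 : ℝ) (2 * π), ∀ v ∈ Set.Ico (0 : ℝ) (2 * π),
      F.chord 0 u v / F.length 0
        ≥ a⁻¹ * Real.arctan (a / π * Real.sin (π * F.arcLen 0 u v / F.length 0)))
    (t : ℝ) (ht : t ∈ Set.Ico (0 : ℝ) T) (u : ℝ) :
    F.curvSq u t + 1
      ≤ (2 * π / F.length t) ^ 2 *
          (1 + 2 * a ^ 2 / π ^ 2 * Real.exp (-8 * π ^ 2 * F.tau t)) := by
  have hB : F.coeff a t ^ 2 = a ^ 2 / π ^ 2 * exp (-8 * π ^ 2 * F.tau t) := by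
    rw [SphereCSF.coeff, mul_pow, div_pow, ← exp_nat_mul]
    congr 2
    push_cast
    ring
  have h1 := SphereCSF.second_sq_le_of_modelChord_le ht (SphereCSF.coeff_pos ha t)
    (fun u v huv hvu => SphereCSF.modelChord_coeff_le ha h0 ht huv hvu) u
  rw [F.curvSq_add_one ht]
  refine h1.trans_eq ?_
  rw [hB]
  ring

end
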